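/- Let d ≥ 2 be even and let n = p + q > d with p, q ≥ 1. Let 0 ≤ η < min{d, n−d} and let 0 < κ < (n−d−η)/2. Let N(t) be a non-decreasing function with N(t) = O(t^η). Then there exists δ ∈ (0, 1) such that for almost all F ∈ Y_{p,q}^{(d)} there exists t_F > 0 such that for all t > t_F and all intervals I ⊂ [−N(t), N(t)] with |I| = t^{−κ}: | #{v ∈ ℤⁿ : F(v) ∈ I and ‖v‖ ≤ t} − c_F·t^{n−d−κ} | < t^{δ(n−d−κ)}, where c_F > 0 is the constant such that vol(F⁻¹(I) ∩ B_T) = c_F·|I|·T^{n−d} + O_F(|I|·N^{1/d}·T^{n−d−1}·log T) for all measurable I ⊆ [−N, N], N ≥ 1 and T > 2N^{1/d}. -/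

import Mathlib

open MeasureTheory Matrix Filter

noncomputable section

/-- `SL_n(ℝ)`. -/
abbrev SLR (n : ℕ) := Matrix.SpecialLinearGroup (Fin n) ℝ

instance (n : ℕ) : TopologicalSpace (SLR n) :=
  TopologicalSpace.induced (fun g => (g : Matrix (Fin n) (Fin n) ℝ)) inferInstance

instance (n : ℕ) : MeasurableSpace (SLR n) := borel _

/-- Euclidean norm on `ℝⁿ`. -/
def eucNorm {n : ℕ} (v : Fin n → ℝ) : ℝ := Real.sqrt (∑ i, v i ^ 2)

/-- `F₀(v) = Σ_{i=1}^p v_i^d − Σ_{i=p+1}^n v_i^d` on `ℝ^{p+q}`. -/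
def F0 (p q d : ℕ) (v : Fin (p + q) → ℝ) : ℝ :=
  ∑ i : Fin (p + q), (if (i : ℕ) < p then (1 : ℝ) else -1) * v i ^ d

/-- The polynomial `F = g·F₀`, i.e. `F(v) = F₀(v g)` (row vectors, right action). -/
def Fg (p q d : ℕ) (g : SLR (p + q)) (v : Fin (p + q) → ℝ) : ℝ :=
  F0 p q d (Matrix.vecMul v (g : Matrix (Fin (p + q)) (Fin (p + q)) ℝ))

/-- The coercion `ℤⁿ → ℝⁿ`. -/
def intVec {n : ℕ} (v : Fin n → ℤ) : Fin n → ℝ := fun i => (v i : ℝ)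

/-- `#{v ∈ ℤⁿ : F(v) ∈ I, ‖v‖ ≤ t}` for `F = g·F₀`. -/
def NF (p q d : ℕ) (g : SLR (p + q)) (I : Set ℝ) (t : ℝ) : ℕ :=
  Nat.card {v : Fin (p + q) → ℤ | Fg p q d g (intVec v) ∈ I ∧ eucNorm (intVec v) ≤ t}

/-- The sup norm of an integer vector, as a natural number. -/
def height {m : ℕ} (v : Fin m → ℤ) : ℕ := Finset.univ.sup fun i => (v i).natAbs

lemma height_le_iff {m : ℕ} {v : Fin m → ℤ} {R : ℕ} :
    height v ≤ R ↔ ∀ i, (v i).natAbs ≤ R := by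
  simp [height]

lemma height_eq_zero_iff {m : ℕ} {v : Fin m → ℤ} : height v = 0 ↔ v = 0 := by
  rw [← Nat.le_zero, height_le_iff]
  simp [funext_iff]

lemma one_le_height {m : ℕ} {v : Fin m → ℤ} (hv : v ≠ 0) : 1 ≤ height v :=
  Nat.one_le_iff_ne_zero.2 fun h => hv (height_eq_zero_iff.1 h)

lemma height_smul {m : ℕ} (g : ℤ) (v : Fin m → ℤ) : height (g • v) = g.natAbs * height v := by
  have h : ∀ s : Finset (Fin m), (s.sup fun i => ((g • v) i).natAbs)
      = g.natAbs * s.sup fun i => (v i).natAbs := by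
    intro s
    induction s using Finset.induction_on with
    | empty => simp
    | insert a s _ ih =>
      rw [Finset.sup_insert, Finset.sup_insert, ih]
      simp [Int.natAbs_mul, Nat.mul_max_mul_left]
  exact h _

/-- The integer vectors of height at most `R`. -/
def intBox (m R : ℕ) : Finset (Fin m → ℤ) := Fintype.piFinset fun _ => Finset.Icc (-R : ℤ) R

lemma mem_intBox {m R : ℕ} {v : Fin m → ℤ} : v ∈ intBox m R ↔ height v ≤ R := by
  rw [height_le_iff, intBox, Fintype.mem_piFinset]
  refine forall_congr' fun i => ?_
  rw [Finset.mem_Icc]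
  omega

lemma card_intBox (m R : ℕ) : (intBox m R).card = (2 * R + 1) ^ m := by
  rw [intBox, Fintype.card_piFinset]
  simp only [Int.card_Icc, Finset.prod_const, Finset.card_univ, Fintype.card_fin]
  congr 1
  omega

lemma card_height_eq_le (m r : ℕ) (hr : 1 ≤ r) :
    (((intBox m r).filter fun v => height v = r).card : ℝ) ≤ 2 * m * (3 * r : ℝ) ^ (m - 1) := by
  obtain ⟨k, rfl⟩ : ∃ k, r = k + 1 := ⟨r - 1, by omega⟩
  have h1 : (intBox m (k + 1)).filter (fun v => height v = k + 1) = intBox m (k + 1) \ intBox m k := by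
    ext v
    simp only [Finset.mem_filter, Finset.mem_sdiff, mem_intBox]
    omega
  have h2 : intBox m k ⊆ intBox m (k + 1) := fun v hv => by
    rw [mem_intBox] at *
    omega
  rw [h1, Finset.card_sdiff_of_subset h2, Nat.cast_sub (Finset.card_le_card h2), card_intBox,
    card_intBox]
  push_cast
  have h3 := abs_pow_sub_pow_le (2 * (k + 1 : ℝ) + 1) (2 * k + 1) m
  rw [max_eq_left (by rw [abs_of_nonneg (by positivity), abs_of_nonneg (by positivity)]; linarith),
    abs_of_nonneg (a := (2 * (k + 1 : ℝ) + 1)) (by positivity)] at h3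
  refine (le_abs_self _).trans (h3.trans ?_)
  have h4 : |2 * (k + 1 : ℝ) + 1 - (2 * k + 1)| = 2 := by
    rw [show 2 * (k + 1 : ℝ) + 1 - (2 * k + 1) = 2 by ring]; norm_num
  rw [h4]
  gcongr
  linarith

lemma sum_height_le (m R : ℕ) (f : ℕ → ℝ) (hf : ∀ r, 0 ≤ f r) :
    ∑ v ∈ (intBox m R).filter (· ≠ 0), f (height v)
      ≤ ∑ r ∈ Finset.Icc 1 R, 2 * m * (3 * r : ℝ) ^ (m - 1) * f r := by
  rw [← Finset.sum_fiberwise_of_maps_to (g := height) (t := Finset.Icc 1 R)]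
  · refine Finset.sum_le_sum fun r hr => ?_
    rw [Finset.mem_Icc] at hr
    rw [Finset.sum_congr rfl (g := fun _ => f r)
      (fun v hv => by rw [(Finset.mem_filter.1 hv).2]), Finset.sum_const, nsmul_eq_mul]
    refine mul_le_mul_of_nonneg_right (le_trans ?_ (card_height_eq_le m r hr.1)) (hf r)
    exact_mod_cast Finset.card_le_card fun v hv => by
      simp only [Finset.mem_filter, mem_intBox] at hv ⊢
      omega
  · intro v hv
    simp only [Finset.mem_filter, mem_intBox] at hv
    exact Finset.mem_Icc.2 ⟨one_le_height hv.2, hv.1⟩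

lemma sum_inv_le_one_add_log (R : ℕ) : ∑ r ∈ Finset.Icc 1 R, (r : ℝ)⁻¹ ≤ 1 + Real.log R := by
  have h := harmonic_le_one_add_log R
  rw [harmonic_eq_sum_Icc] at h
  push_cast at h
  exact h

lemma sum_height_pow_le_log {m d : ℕ} (hd : 1 ≤ d) (hdm : d ≤ m) (R : ℕ) :
    ∑ v ∈ (intBox m R).filter (· ≠ 0), ((height v : ℝ)⁻¹) ^ d
      ≤ 2 * m * 3 ^ (m - 1) * (R : ℝ) ^ (m - d) * (1 + Real.log R) := by
  refine (sum_height_le m R (fun r => ((r : ℝ)⁻¹) ^ d) fun r => by positivity).trans ?_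
  refine le_trans ?_ (mul_le_mul_of_nonneg_left (sum_inv_le_one_add_log R) (by positivity))
  rw [Finset.mul_sum]
  refine Finset.sum_le_sum fun r hr => ?_
  rw [Finset.mem_Icc] at hr
  have hr0 : (0 : ℝ) < r := by exact_mod_cast hr.1
  have h1 : (r : ℝ) ^ (m - 1) * ((r : ℝ)⁻¹) ^ d = (r : ℝ) ^ (m - d) * (r : ℝ)⁻¹ := by
    rw [inv_pow, ← div_eq_mul_inv, ← div_eq_mul_inv, div_eq_div_iff (by positivity) (by positivity),
      ← pow_succ, ← pow_add]
    congr 1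
    omega
  calc 2 * m * (3 * r : ℝ) ^ (m - 1) * ((r : ℝ)⁻¹) ^ d
      = 2 * m * 3 ^ (m - 1) * ((r : ℝ) ^ (m - 1) * ((r : ℝ)⁻¹) ^ d) := by rw [mul_pow]; ring
    _ = 2 * m * 3 ^ (m - 1) * ((r : ℝ) ^ (m - d) * (r : ℝ)⁻¹) := by rw [h1]
    _ ≤ 2 * m * 3 ^ (m - 1) * ((R : ℝ) ^ (m - d) * (r : ℝ)⁻¹) := by
      gcongr
      exact hr.2
    _ = _ := by ring

lemma sum_height_pow_le {m d : ℕ} (hd : 1 ≤ d) (hdm : d ≤ m) (R : ℕ) :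
    ∑ v ∈ (intBox m R).filter (· ≠ 0), ((height v : ℝ)⁻¹) ^ (d - 1)
      ≤ 2 * m * 3 ^ (m - 1) * (R : ℝ) ^ (m + 1 - d) := by
  refine (sum_height_le m R (fun r => ((r : ℝ)⁻¹) ^ (d - 1)) fun r => by positivity).trans ?_
  have h2 : ∀ r ∈ Finset.Icc 1 R, 2 * m * (3 * r : ℝ) ^ (m - 1) * ((r : ℝ)⁻¹) ^ (d - 1)
      ≤ 2 * m * 3 ^ (m - 1) * (R : ℝ) ^ (m - d) := by
    intro r hr
    rw [Finset.mem_Icc] at hr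
    have hr0 : (0 : ℝ) < r := by exact_mod_cast hr.1
    have h1 : (r : ℝ) ^ (m - 1) * ((r : ℝ)⁻¹) ^ (d - 1) = (r : ℝ) ^ (m - d) := by
      rw [inv_pow, ← div_eq_mul_inv, div_eq_iff (by positivity), ← pow_add]
      congr 1
      omega
    calc 2 * m * (3 * r : ℝ) ^ (m - 1) * ((r : ℝ)⁻¹) ^ (d - 1)
        = 2 * m * 3 ^ (m - 1) * ((r : ℝ) ^ (m - 1) * ((r : ℝ)⁻¹) ^ (d - 1)) := by
          rw [mul_pow]; ring
      _ = 2 * m * 3 ^ (m - 1) * (r : ℝ) ^ (m - d) := by rw [h1]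
      _ ≤ _ := by
        gcongr
        exact hr.2
  refine (Finset.sum_le_sum h2).trans ?_
  rw [Finset.sum_const, Nat.card_Icc, nsmul_eq_mul, show m + 1 - d = (m - d) + 1 by omega, pow_succ]
  simp only [add_tsub_cancel_right]
  apply le_of_eq
  ring

/-- Two integer vectors are parallel. -/
def Parallel {m : ℕ} (v w : Fin m → ℤ) : Prop := ∀ i k, v i * w k = v k * w i

instance {m : ℕ} (v w : Fin m → ℤ) : Decidable (Parallel v w) := by
  unfold Parallel; infer_instance

lemma Parallel.symm {m : ℕ} {v w : Fin m → ℤ} (h : Parallel v w) : Parallel w v := fun i k => by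
  linarith [h i k, h k i, mul_comm (w i) (v k), mul_comm (w k) (v i)]

lemma Parallel.exists_smul {m : ℕ} {v w : Fin m → ℤ} (h : Parallel v w) (hv : v ≠ 0) :
    ∃ (a b : ℤ) (u : Fin m → ℤ), v = a • u ∧ w = b • u := by
  obtain ⟨i, hi⟩ : ∃ i, v i ≠ 0 := by
    by_contra! h0
    exact hv (funext h0)
  obtain ⟨G, a, b, hG, hab, ha, hb⟩ := Int.exists_gcd_one' (Int.gcd_pos_of_ne_zero_left (w i) hi)
  have ha0 : a ≠ 0 := by
    rintro rfl
    simp [hi] at ha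
  have h1 : ∀ k, a * w k = b * v k := fun k => by
    have := h i k
    rw [ha, hb] at this
    apply mul_left_cancel₀ (show (G : ℤ) ≠ 0 by exact_mod_cast hG.ne')
    linarith
  have h2 : ∀ k, ∃ c, v k = a * c := fun k =>
    (Int.isCoprime_iff_gcd_eq_one.2 hab).dvd_of_dvd_mul_left ⟨w k, (h1 k).symm⟩
  choose u hu using h2
  refine ⟨a, b, u, funext hu, funext fun k => ?_⟩
  apply mul_left_cancel₀ ha0
  rw [h1 k, hu k]
  simp only [Pi.smul_apply, smul_eq_mul]
  ring

/-- The nonzero integer vectors of height at most `R`. -/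
def intBoxNeZero (m R : ℕ) : Finset (Fin m → ℤ) := (intBox m R).filter (· ≠ 0)

lemma mem_intBoxNeZero {m R : ℕ} {v : Fin m → ℤ} : v ∈ intBoxNeZero m R ↔ height v ≤ R ∧ v ≠ 0 := by
  simp [intBoxNeZero, mem_intBox]

lemma sum_parallel_le {m d : ℕ} (hd : 2 ≤ d) (hdm : d ≤ m) (R : ℕ) :
    ∑ p ∈ (intBoxNeZero m R ×ˢ intBoxNeZero m R).filter (fun p => Parallel p.1 p.2),
        min (((height p.1 : ℝ)⁻¹) ^ (d - 1)) (((height p.2 : ℝ)⁻¹) ^ (d - 1))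
      ≤ 24 * m * 3 ^ (m - 1) * (R : ℝ) ^ (m + 1 - d) * (1 + Real.log R) := by
  set F : (Fin m → ℤ) × (Fin m → ℤ) → ℝ := fun p =>
    min (((height p.1 : ℝ)⁻¹) ^ (d - 1)) (((height p.2 : ℝ)⁻¹) ^ (d - 1)) with hF
  have hF0 : ∀ p, 0 ≤ F p := fun p => le_min (by positivity) (by positivity)
  set φ : (Σ _ : Fin 2 → ℤ, Fin m → ℤ) → (Fin m → ℤ) × (Fin m → ℤ) :=
    fun t => (t.1 0 • t.2, t.1 1 • t.2) with hφ
  set T := (intBoxNeZero 2 R).sigma fun c => intBoxNeZero m (R / height c) with hT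
  have hht : ∀ c : Fin 2 → ℤ, height c = max (c 0).natAbs (c 1).natAbs := fun c => by
    apply le_antisymm
    · rw [height_le_iff]
      intro i
      fin_cases i
      · exact le_max_left _ _
      · exact le_max_right _ _
    · exact max_le (height_le_iff.1 le_rfl 0) (height_le_iff.1 le_rfl 1)
  have hsub : (intBoxNeZero m R ×ˢ intBoxNeZero m R).filter (fun p => Parallel p.1 p.2)
      ⊆ T.image φ := by
    rintro ⟨v, w⟩ hp
    simp only [Finset.mem_filter, Finset.mem_product, mem_intBoxNeZero] at hp
    obtain ⟨⟨⟨hv, hv0⟩, hw, hw0⟩, hpar⟩ := hp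
    obtain ⟨a, b, u, rfl, rfl⟩ := hpar.exists_smul hv0
    have hu0 : u ≠ 0 := by rintro rfl; simp at hv0
    have hu1 := one_le_height hu0
    rw [height_smul] at hv hw
    have hc0 : (![a, b] : Fin 2 → ℤ) ≠ 0 := by
      intro h
      have := congrFun h 0
      simp only [cons_val_zero, Pi.zero_apply] at this
      simp [this] at hv0
    have hmax : height (![a, b] : Fin 2 → ℤ) * height u ≤ R := by
      rw [hht]
      rcases max_choice (a.natAbs) (b.natAbs) with h | h <;>
        simp only [cons_val_zero, cons_val_one, h] <;> assumption
    refine Finset.mem_image.2 ⟨⟨![a, b], u⟩, ?_, by simp [hφ]⟩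
    simp only [hT, Finset.mem_sigma, mem_intBoxNeZero]
    refine ⟨⟨(Nat.le_mul_of_pos_right _ hu1).trans hmax, hc0⟩, ?_, hu0⟩
    rw [Nat.le_div_iff_mul_le (one_le_height hc0)]
    linarith
  have hval : ∀ t, t.1 ≠ 0 → t.2 ≠ 0 →
      F (φ t) ≤ ((height t.1 : ℝ)⁻¹) ^ (d - 1) * ((height t.2 : ℝ)⁻¹) ^ (d - 1) := by
    rintro ⟨c, u⟩ hc hu
    simp only [hF, hφ, height_smul, hht]
    push_cast
    rw [← mul_pow, ← mul_inv]
    rcases max_choice ((c 0).natAbs) ((c 1).natAbs) with h | h <;> rw [← Nat.cast_max, h]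
    · exact min_le_left _ _
    · exact min_le_right _ _
  calc _ ≤ ∑ p ∈ T.image φ, F p :=
        Finset.sum_le_sum_of_subset_of_nonneg hsub fun p _ _ => hF0 p
    _ ≤ ∑ t ∈ T, F (φ t) := Finset.sum_image_le_of_nonneg fun p _ => hF0 p
    _ ≤ ∑ t ∈ T, ((height t.1 : ℝ)⁻¹) ^ (d - 1) * ((height t.2 : ℝ)⁻¹) ^ (d - 1) := by
        refine Finset.sum_le_sum fun t ht => ?_
        simp only [hT, Finset.mem_sigma, mem_intBoxNeZero] at ht
        exact hval t ht.1.2 ht.2.2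
    _ = ∑ c ∈ intBoxNeZero 2 R, ((height c : ℝ)⁻¹) ^ (d - 1) *
          ∑ u ∈ intBoxNeZero m (R / height c), ((height u : ℝ)⁻¹) ^ (d - 1) := by
        rw [hT, Finset.sum_sigma]
        simp only [Finset.mul_sum]
    _ ≤ ∑ c ∈ intBoxNeZero 2 R, (2 * m * 3 ^ (m - 1) * (R : ℝ) ^ (m + 1 - d)) *
          ((height c : ℝ)⁻¹) ^ 2 := by
        refine Finset.sum_le_sum fun c hc => ?_
        rw [mem_intBoxNeZero] at hc
        have hc1 := one_le_height hc.2
        have hc1' : (1 : ℝ) ≤ height c := by exact_mod_cast hc1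
        refine (mul_le_mul_of_nonneg_left (sum_height_pow_le (by omega) hdm _)
          (by positivity)).trans ?_
        have h1 : ((R / height c : ℕ) : ℝ) ^ (m + 1 - d) ≤
            (R : ℝ) ^ (m + 1 - d) * ((height c : ℝ)⁻¹) ^ (m + 1 - d) := by
          rw [← mul_pow, ← div_eq_mul_inv]
          gcongr
          exact Nat.cast_div_le
        have h2 : ((height c : ℝ)⁻¹) ^ (d - 1) * ((height c : ℝ)⁻¹) ^ (m + 1 - d)
            ≤ ((height c : ℝ)⁻¹) ^ 2 := by
          rw [← pow_add]
          exact pow_le_pow_of_le_one (by positivity) (inv_le_one_of_one_le₀ hc1') (by omega)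
        calc ((height c : ℝ)⁻¹) ^ (d - 1) *
              (2 * m * 3 ^ (m - 1) * ((R / height c : ℕ) : ℝ) ^ (m + 1 - d))
            ≤ ((height c : ℝ)⁻¹) ^ (d - 1) * (2 * m * 3 ^ (m - 1) *
              ((R : ℝ) ^ (m + 1 - d) * ((height c : ℝ)⁻¹) ^ (m + 1 - d))) := by gcongr
          _ = (2 * m * 3 ^ (m - 1) * (R : ℝ) ^ (m + 1 - d)) *
              (((height c : ℝ)⁻¹) ^ (d - 1) * ((height c : ℝ)⁻¹) ^ (m + 1 - d)) := by ring
          _ ≤ _ := by gcongr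
    _ ≤ (2 * m * 3 ^ (m - 1) * (R : ℝ) ^ (m + 1 - d)) * (12 * (1 + Real.log R)) := by
        rw [← Finset.mul_sum]
        refine mul_le_mul_of_nonneg_left ?_ (by positivity)
        have := sum_height_pow_le_log (m := 2) (d := 2) (by norm_num) le_rfl R
        norm_num at this
        simpa only [inv_pow, intBoxNeZero, ne_eq] using this
    _ = _ := by ring

instance : IsProbabilityMeasure (volume : Measure UnitAddCircle) := ⟨by simp⟩

/-- The character `X ↦ v · X` on the torus. -/
def torusPairing {m : ℕ} (v : Fin m → ℤ) : (Fin m → UnitAddCircle) →+ UnitAddCircle where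
  toFun X := ∑ i, v i • X i
  map_zero' := by simp
  map_add' X Y := by simp [Finset.sum_add_distrib]

lemma torusPairing_apply {m : ℕ} (v : Fin m → ℤ) (X : Fin m → UnitAddCircle) :
    torusPairing v X = ∑ i, v i • X i := rfl

lemma continuous_torusPairing {m : ℕ} (v : Fin m → ℤ) : Continuous (torusPairing v) := by
  show Continuous fun X : Fin m → UnitAddCircle => ∑ i, v i • X i
  fun_prop

lemma exists_zsmul_eq_unitAddCircle {n : ℤ} (hn : n ≠ 0) (a : UnitAddCircle) : ∃ b, n • b = a :=
  ⟨DivisibleBy.div a n, DivisibleBy.div_cancel a hn⟩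

lemma measurePreserving_torusPairing {m : ℕ} {v : Fin m → ℤ} (hv : v ≠ 0) :
    MeasurePreserving (torusPairing v) volume volume := by
  refine AddMonoidHom.measurePreserving (continuous_torusPairing v) (fun a => ?_) (by simp)
  obtain ⟨i, hi⟩ : ∃ i, v i ≠ 0 := by
    by_contra! h0
    exact hv (funext h0)
  obtain ⟨b, hb⟩ := exists_zsmul_eq_unitAddCircle hi a
  refine ⟨Pi.single i b, ?_⟩
  rw [torusPairing_apply, Finset.sum_eq_single i]
  · simpa using hb
  · intro k _ hk
    simp [Pi.single_eq_of_ne hk]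
  · simp

lemma measurePreserving_torusPairing_prod {m : ℕ} {v w : Fin m → ℤ} (h : ¬ Parallel v w) :
    MeasurePreserving (fun X => (torusPairing v X, torusPairing w X)) volume
      ((volume : Measure UnitAddCircle).prod volume) := by
  refine AddMonoidHom.measurePreserving (f := (torusPairing v).prod (torusPairing w))
    ((continuous_torusPairing v).prodMk (continuous_torusPairing w)) ?_ (by simp)
  rintro ⟨a, b⟩
  obtain ⟨i, k, hik⟩ : ∃ i k, v i * w k ≠ v k * w i := by
    simpa [Parallel] using h
  have hne : i ≠ k := by rintro rfl; exact hik rfl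
  obtain ⟨a', ha⟩ := exists_zsmul_eq_unitAddCircle (sub_ne_zero.2 hik) a
  obtain ⟨b', hb⟩ := exists_zsmul_eq_unitAddCircle (sub_ne_zero.2 hik) b
  have key : ∀ u : Fin m → ℤ, torusPairing u (Pi.single i (w k • a' - v k • b')
      + Pi.single k (v i • b' - w i • a')) = u i • (w k • a' - v k • b')
        + u k • (v i • b' - w i • a') := by
    intro u
    have hs : ∀ (j : Fin m) (c : UnitAddCircle), torusPairing u (Pi.single j c) = u j • c := by
      intro j c
      rw [torusPairing_apply, Finset.sum_eq_single j]
      · simp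
      · intro l _ hl
        simp [Pi.single_eq_of_ne hl]
      · simp
    rw [map_add, hs, hs]
  refine ⟨Pi.single i (w k • a' - v k • b') + Pi.single k (v i • b' - w i • a'), ?_⟩
  simp only [AddMonoidHom.prod_apply, key, Prod.mk.injEq]
  rw [← ha, ← hb]
  constructor <;> module

/-- Second moment of a sum of functions of integer linear forms on the torus: only parallel pairs of
linear forms contribute. -/
lemma integral_sq_sum_torusPairing_le {m : ℕ} (S : Finset (Fin m → ℤ)) (hS : ∀ v ∈ S, v ≠ 0)
    (P : (Fin m → ℤ) → UnitAddCircle → ℝ) (hP : ∀ v ∈ S, Measurable (P v))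
    (hP0 : ∀ v ∈ S, ∀ θ, 0 ≤ P v θ) (hP1 : ∀ v ∈ S, ∀ θ, P v θ ≤ 1) :
    ∫ X : Fin m → UnitAddCircle, (∑ v ∈ S, (P v (torusPairing v X) - ∫ θ, P v θ)) ^ 2
      ≤ ∑ p ∈ (S ×ˢ S).filter (fun p => Parallel p.1 p.2), min (∫ θ, P p.1 θ) (∫ θ, P p.2 θ) := by
  set h : (Fin m → ℤ) → ℝ := fun v => ∫ θ, P v θ with hh
  have hInt : ∀ v ∈ S, Integrable (P v) := fun v hv =>
    (integrable_const (1 : ℝ)).mono' (hP v hv).aestronglyMeasurable (ae_of_all _ fun θ => by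
      rw [Real.norm_eq_abs, abs_of_nonneg (hP0 v hv θ)]; exact hP1 v hv θ)
  have hh0 : ∀ v ∈ S, 0 ≤ h v := fun v hv => integral_nonneg (hP0 v hv)
  have hmeas : ∀ v ∈ S, Measurable fun X : Fin m → UnitAddCircle => P v (torusPairing v X) :=
    fun v hv => (hP v hv).comp (continuous_torusPairing v).measurable
  have hint1 : ∀ v ∈ S, Integrable fun X : Fin m → UnitAddCircle => P v (torusPairing v X) :=
    fun v hv => (measurePreserving_torusPairing (hS v hv)).integrable_comp_of_integrable (hInt v hv)
  have hint2 : ∀ v ∈ S, ∀ w ∈ S, Integrable fun X : Fin m → UnitAddCircle =>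
      P v (torusPairing v X) * P w (torusPairing w X) := fun v hv w hw => by
    refine (integrable_const (1 : ℝ)).mono' ((hmeas v hv).mul (hmeas w hw)).aestronglyMeasurable
      (ae_of_all _ fun X => ?_)
    rw [Real.norm_eq_abs, abs_of_nonneg (mul_nonneg (hP0 v hv _) (hP0 w hw _))]
    exact mul_le_one₀ (hP1 v hv _) (hP0 w hw _) (hP1 w hw _)
  have hcomp : ∀ v ∈ S, ∫ X : Fin m → UnitAddCircle, P v (torusPairing v X) = h v := fun v hv => by
    have hmp := measurePreserving_torusPairing (hS v hv)
    rw [hh]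
    simp only
    conv_rhs => rw [← hmp.map_eq]
    rw [integral_map hmp.measurable.aemeasurable (hP v hv).aestronglyMeasurable]
  have hcov : ∀ v ∈ S, ∀ w ∈ S, ∫ X : Fin m → UnitAddCircle,
      (P v (torusPairing v X) - h v) * (P w (torusPairing w X) - h w)
      = (∫ X : Fin m → UnitAddCircle, P v (torusPairing v X) * P w (torusPairing w X))
        - h v * h w := fun v hv w hw => by
    have : ∀ X : Fin m → UnitAddCircle,
        (P v (torusPairing v X) - h v) * (P w (torusPairing w X) - h w)
        = P v (torusPairing v X) * P w (torusPairing w X) - h w * P v (torusPairing v X)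
          - h v * P w (torusPairing w X) + h v * h w := fun X => by ring
    simp only [this]
    rw [integral_add _ (integrable_const _), integral_sub _ ((hint1 w hw).const_mul _),
      integral_sub (hint2 v hv w hw) ((hint1 v hv).const_mul _), integral_const_mul,
      integral_const_mul, hcomp v hv, hcomp w hw]
    · simp
      ring
    · exact (hint2 v hv w hw).sub ((hint1 v hv).const_mul _)
    · exact ((hint2 v hv w hw).sub ((hint1 v hv).const_mul _)).sub ((hint1 w hw).const_mul _)
  have hintc : ∀ v ∈ S, ∀ w ∈ S, Integrable fun X : Fin m → UnitAddCircle =>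
      (P v (torusPairing v X) - h v) * (P w (torusPairing w X) - h w) := fun v hv w hw => by
    have : (fun X : Fin m → UnitAddCircle =>
        (P v (torusPairing v X) - h v) * (P w (torusPairing w X) - h w))
        = fun X => P v (torusPairing v X) * P w (torusPairing w X) - h w * P v (torusPairing v X)
          - h v * P w (torusPairing w X) + h v * h w := by ext X; ring
    rw [this]
    exact (((hint2 v hv w hw).sub ((hint1 v hv).const_mul _)).sub ((hint1 w hw).const_mul _)).add
      (integrable_const _)
  have hexp : ∫ X : Fin m → UnitAddCircle, (∑ v ∈ S, (P v (torusPairing v X) - h v)) ^ 2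
      = ∑ p ∈ S ×ˢ S, ((∫ X : Fin m → UnitAddCircle,
          P p.1 (torusPairing p.1 X) * P p.2 (torusPairing p.2 X)) - h p.1 * h p.2) := by
    simp only [sq, Finset.sum_mul_sum, ← Finset.sum_product']
    rw [integral_finsetSum]
    · refine Finset.sum_congr rfl fun p hp => ?_
      rw [Finset.mem_product] at hp
      exact hcov _ hp.1 _ hp.2
    · intro p hp
      rw [Finset.mem_product] at hp
      exact hintc _ hp.1 _ hp.2
  rw [hexp, ← Finset.sum_filter_add_sum_filter_not (S ×ˢ S) (fun p => Parallel p.1 p.2)]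
  have hzero : ∑ p ∈ (S ×ˢ S).filter (fun p => ¬ Parallel p.1 p.2), ((∫ X : Fin m → UnitAddCircle,
          P p.1 (torusPairing p.1 X) * P p.2 (torusPairing p.2 X)) - h p.1 * h p.2) = 0 := by
    refine Finset.sum_eq_zero fun p hp => ?_
    rw [Finset.mem_filter, Finset.mem_product] at hp
    have hmp := measurePreserving_torusPairing_prod hp.2
    have h1 := integral_map (μ := (volume : Measure (Fin m → UnitAddCircle)))
      hmp.measurable.aemeasurable (f := fun z => P p.1 z.1 * P p.2 z.2)
      (((hP _ hp.1.1).comp measurable_fst).mul ((hP _ hp.1.2).comp measurable_snd)).aestronglyMeasurable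
    rw [hmp.map_eq, integral_prod_mul] at h1
    rw [← h1]
    simp [hh]
  rw [hzero, add_zero]
  refine Finset.sum_le_sum fun p hp => ?_
  rw [Finset.mem_filter, Finset.mem_product] at hp
  obtain ⟨⟨hv, hw⟩, -⟩ := hp
  have h2 : 0 ≤ h p.1 * h p.2 := mul_nonneg (hh0 _ hv) (hh0 _ hw)
  refine le_min ?_ ?_
  · refine (sub_le_self _ h2).trans ?_
    change _ ≤ h p.1
    rw [← hcomp _ hv]
    exact integral_mono (hint2 _ hv _ hw) (hint1 _ hv) fun X =>
      mul_le_of_le_one_right (hP0 _ hv _) (hP1 _ hw _)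
  · refine (sub_le_self _ h2).trans ?_
    change _ ≤ h p.2
    rw [← hcomp _ hw]
    exact integral_mono (hint2 _ hv _ hw) (hint1 _ hw) fun X =>
      mul_le_of_le_one_left (hP0 _ hw _) (hP1 _ hv _)

/-- The representative in `[0, 1)` of a point of the circle. -/
def circleRep (θ : UnitAddCircle) : ℝ := (AddCircle.equivIco 1 0 θ : ℝ)

lemma measurable_circleRep : Measurable circleRep :=
  measurable_subtype_coe.comp (AddCircle.measurableEquivIco (1 : ℝ) 0).measurable

lemma coe_circleRep (θ : UnitAddCircle) : (circleRep θ : UnitAddCircle) = θ :=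
  AddCircle.coe_equivIco

lemma circleRep_coe (x : ℝ) : circleRep (x : UnitAddCircle) = Int.fract x := by
  rw [circleRep, AddCircle.coe_equivIco_mk_apply]
  simp

/-- The periodization of a function on the line. -/
def periodize (f : ℝ → ℝ) (θ : UnitAddCircle) : ℝ := ∑' k : ℤ, f (k + circleRep θ)

lemma periodize_coe (f : ℝ → ℝ) (x : ℝ) : periodize f (x : UnitAddCircle) = ∑' k : ℤ, f (k + x) := by
  rw [periodize, circleRep_coe]
  have : ∀ k : ℤ, (k : ℝ) + Int.fract x = ((Equiv.subRight ⌊x⌋ k : ℤ) : ℝ) + x := fun k => by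
    rw [Equiv.subRight_apply, Int.cast_sub, Int.fract]
    ring
  simp only [this]
  exact (Equiv.subRight ⌊x⌋).tsum_eq fun k : ℤ => f (k + x)

lemma measurable_periodize {f : ℝ → ℝ} (hf : Measurable f) : Measurable (periodize f) := by
  unfold periodize
  exact Measurable.tsum fun k => hf.comp (measurable_const.add measurable_circleRep)

lemma integral_periodize {f : ℝ → ℝ} (hf : Integrable f) :
    ∫ θ, periodize f θ = ∫ x, f x := by
  rw [← UnitAddCircle.integral_preimage 0]
  simp only [periodize_coe, zero_add]
  have h := hasSum_integral_of_summable_integral_norm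
    (μ := (volume : Measure ℝ).restrict (Set.Ioc 0 1)) (F := fun (k : ℤ) (x : ℝ) => f (k + x))
    (fun k => (hf.comp_add_left (k : ℝ)).restrict) ?_
  · rw [← h.tsum_eq, ← hf.hasSum_intervalIntegral_comp_add_int.tsum_eq]
    refine tsum_congr fun k => ?_
    rw [intervalIntegral.integral_of_le zero_le_one]
    simp only [add_comm]
  · have := hf.norm.hasSum_intervalIntegral_comp_add_int.summable
    simpa only [intervalIntegral.integral_of_le (zero_le_one (α := ℝ)), add_comm] using this

lemma tsum_int_eq_of_forall {f : ℤ → ℝ} (hf : ∀ k l, f k ≠ 0 → f l ≠ 0 → k = l) :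
    (∀ k, f k = 0) ∧ ∑' k, f k = 0 ∨ ∃ k, ∑' k, f k = f k := by
  by_cases h : ∃ k, f k ≠ 0
  · obtain ⟨k, hk⟩ := h
    refine Or.inr ⟨k, tsum_eq_single k fun l hl => ?_⟩
    by_contra h'
    exact hl (hf l k h' hk)
  · push Not at h
    exact Or.inl ⟨h, by simp [h]⟩

lemma periodize_mem_Icc {f : ℝ → ℝ} (h0 : ∀ x, 0 ≤ f x) (h1 : ∀ x, f x ≤ 1)
    (hf : ∀ x y, f x ≠ 0 → f y ≠ 0 → |x - y| < 1) (θ : UnitAddCircle) :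
    0 ≤ periodize f θ ∧ periodize f θ ≤ 1 := by
  refine ⟨tsum_nonneg fun k => h0 _, ?_⟩
  unfold periodize
  have hkl : ∀ k l : ℤ, f (k + circleRep θ) ≠ 0 → f (l + circleRep θ) ≠ 0 → k = l := by
    intro k l hk hl
    have := hf _ _ hk hl
    rw [add_sub_add_right_eq_sub] at this
    have h2 : |k - l| < 1 := by exact_mod_cast this
    exact sub_eq_zero.1 (Int.abs_lt_one_iff.1 h2)
  rcases tsum_int_eq_of_forall hkl with h | ⟨k, h⟩
  · rw [h.2]; exact zero_le_one
  · rw [h]; exact h1 _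

lemma volume_le_of_abs_sub_le {s : Set ℝ} {δ : ℝ} (h : ∀ x ∈ s, ∀ y ∈ s, |x - y| ≤ δ) :
    volume s ≤ ENNReal.ofReal δ := by
  refine (Real.volume_le_diam s).trans (Metric.ediam_le fun x hx y hy => ?_)
  rw [edist_dist, Real.dist_eq]
  exact ENNReal.ofReal_le_ofReal (h x hx y hy)

/-- A function bounded by `B` and supported on a set of diameter at most `δ` has integral at most
`B δ`. -/
lemma abs_integral_le_of_support {f : ℝ → ℝ} {s : Set ℝ} {B δ : ℝ} (hδ : 0 ≤ δ)
    (hB : 0 ≤ B) (hs : ∀ x, x ∉ s → f x = 0) (hf : ∀ x ∈ s, |f x| ≤ B)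
    (h : ∀ x ∈ s, ∀ y ∈ s, |x - y| ≤ δ) : |∫ x, f x| ≤ B * δ := by
  rw [← setIntegral_eq_integral_of_forall_compl_eq_zero hs, ← Real.norm_eq_abs]
  have hv := volume_le_of_abs_sub_le h
  refine (norm_setIntegral_le_of_norm_le_const (lt_of_le_of_lt hv ENNReal.ofReal_lt_top)
    (C := B) fun x hx => hf x hx).trans ?_
  gcongr
  exact ENNReal.toReal_le_of_le_ofReal hδ hv

lemma contDiff_of_tsupport_subset {V : Type*} [NormedAddCommGroup V] [NormedSpace ℝ V]
    {f : V → ℝ} {s : Set V} {k : ℕ∞} (hs : tsupport f ⊆ s) (h : ∀ x ∈ s, ContDiffAt ℝ k f x) :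
    ContDiff ℝ k f := by
  rw [contDiff_iff_contDiffAt]
  intro x
  by_cases hx : x ∈ tsupport f
  · exact h x (hs hx)
  · exact contDiffAt_const.congr_of_eventuallyEq (notMem_tsupport_iff_eventuallyEq.1 hx)

/-- Integration by parts along a fibre. -/
lemma abs_integral_fibre_le {φ φu p pu G : ℝ → ℝ} {B δ : ℝ} (hB : 0 ≤ B) (hδ : 0 ≤ δ)
    (hφ : ContDiff ℝ 1 φ) (hφs : HasCompactSupport φ) (hp : ContDiff ℝ 2 p) (hpu : ContDiff ℝ 1 pu)
    (hG : ContDiff ℝ 1 G) (hG1 : ∀ c, |G c| ≤ 1) (hφu : Continuous φu)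
    (hpos : ∀ y ∈ tsupport φ, 0 < deriv p y)
    (hzero : ∀ y, φ y = 0 → φu y = 0 ∧ deriv φ y = 0)
    (hbd : ∀ y, φ y ≠ 0 → |φu y - (deriv φ y * (pu y / deriv p y) + φ y *
      ((deriv pu y * deriv p y - pu y * deriv (deriv p) y) / deriv p y ^ 2))| ≤ B)
    (hdiam : ∀ y, φ y * G (p y) ≠ 0 → ∀ z, φ z * G (p z) ≠ 0 → |y - z| ≤ δ) :
    |∫ y, (φu y * G (p y) + φ y * (deriv G (p y) * pu y))| ≤ B * δ := by
  have hp' : ContDiff ℝ 1 (deriv p) := by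
    have : ContDiff ℝ (1 + 1) p := hp
    exact (contDiff_succ_iff_deriv.1 this).2.2
  set Ψ : ℝ → ℝ := fun y => φ y * (pu y / deriv p y) * G (p y) with hΨ
  have hp1 : ContDiff ℝ 1 p := hp.of_le (by norm_num)
  have hsupp : tsupport Ψ ⊆ tsupport φ := by
    refine closure_mono fun y hy => ?_
    rw [Function.mem_support] at hy ⊢
    intro h0
    exact hy (by simp [hΨ, h0])
  have hΨc : ContDiff ℝ 1 Ψ := by
    refine contDiff_of_tsupport_subset hsupp fun y hy => ?_
    exact (hφ.contDiffAt.mul (hpu.contDiffAt.div hp'.contDiffAt (hpos y hy).ne')).mul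
      (hG.comp hp1).contDiffAt
  have hΨs : HasCompactSupport Ψ := hφs.of_isClosed_subset (isClosed_tsupport _) hsupp
  have hΨ0 : ∫ y, deriv Ψ y = 0 := by
    refine integral_eq_zero_of_hasDerivAt_of_integrable
      (fun y => (hΨc.differentiable (by norm_num) y).hasDerivAt)
      ((hΨc.continuous_deriv le_rfl).integrable_of_hasCompactSupport hΨs.deriv)
      (hΨc.continuous.integrable_of_hasCompactSupport hΨs)
  have hd : ∀ y, φ y ≠ 0 → deriv Ψ y = (deriv φ y * (pu y / deriv p y) + φ y *
      ((deriv pu y * deriv p y - pu y * deriv (deriv p) y) / deriv p y ^ 2)) * G (p y)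
      + φ y * (deriv G (p y) * pu y) := by
    intro y hy
    have hy' : 0 < deriv p y := hpos y (subset_tsupport _ hy)
    have h1 := ((hφ.differentiable (by norm_num) y).hasDerivAt.mul
      ((hpu.differentiable (by norm_num) y).hasDerivAt.div
      (hp'.differentiable (by norm_num) y).hasDerivAt hy'.ne')).mul
      ((hG.differentiable (by norm_num) (p y)).hasDerivAt.comp y
        (hp1.differentiable (by norm_num) y).hasDerivAt)
    have h2 := h1.deriv
    refine Eq.trans (Eq.trans ?_ h2) ?_
    · rfl
    · simp only [Pi.mul_apply, Pi.div_apply, Function.comp]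
      field_simp
  have hd0 : ∀ y, φ y = 0 → deriv Ψ y = 0 := by
    intro y hy
    by_cases hys : y ∈ tsupport φ
    · have hy' : 0 < deriv p y := hpos y hys
      have h1 := ((hφ.differentiable (by norm_num) y).hasDerivAt.mul
        ((hpu.differentiable (by norm_num) y).hasDerivAt.div
        (hp'.differentiable (by norm_num) y).hasDerivAt hy'.ne')).mul
        ((hG.differentiable (by norm_num) (p y)).hasDerivAt.comp y
          (hp1.differentiable (by norm_num) y).hasDerivAt)
      refine Eq.trans (Eq.trans ?_ h1.deriv) ?_
      · rfl
      · simp [hy, (hzero y hy).2]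
    · have : Ψ =ᶠ[nhds y] 0 := notMem_tsupport_iff_eventuallyEq.1 fun h => hys (hsupp h)
      rw [this.deriv_eq]
      simp
  have hI : Integrable fun y => φu y * G (p y) + φ y * (deriv G (p y) * pu y) := by
    refine Continuous.integrable_of_hasCompactSupport ?_ ?_
    · exact (hφu.mul (hG.continuous.comp hp1.continuous)).add (hφ.continuous.mul
        (((hG.continuous_deriv le_rfl).comp hp1.continuous).mul hpu.continuous))
    · refine hφs.mono fun y hy => ?_
      rw [Function.mem_support] at hy ⊢
      intro h0
      exact hy (by simp [h0, (hzero y h0).1])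
  have hsub : ∫ y, (φu y * G (p y) + φ y * (deriv G (p y) * pu y))
      = ∫ y, (φu y * G (p y) + φ y * (deriv G (p y) * pu y) - deriv Ψ y) := by
    rw [integral_sub hI ((hΨc.continuous_deriv le_rfl).integrable_of_hasCompactSupport hΨs.deriv),
      hΨ0, sub_zero]
  rw [hsub]
  refine abs_integral_le_of_support (s := {y | φ y * G (p y) ≠ 0}) hδ hB (fun y hy => ?_)
    (fun y hy => ?_) (fun y hy z hz => hdiam y hy z hz)
  · simp only [Set.mem_ofPred_eq, not_not, mul_eq_zero] at hy
    by_cases h0 : φ y = 0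
    · rw [hd0 y h0, h0, (hzero y h0).1]
      ring
    · rw [hd y h0, hy.resolve_left h0]
      ring
  · have h0 : φ y ≠ 0 := left_ne_zero_of_mul hy
    rw [hd y h0, show ∀ a b c G : ℝ, a * G + b - (c * G + b) = (a - c) * G by intros; ring, abs_mul]
    exact (mul_le_of_le_one_right (abs_nonneg _) (hG1 _)).trans (hbd y h0)

/-- A weight `φ · G ∘ P` on `ℝᵐ × ℝ`, with the bounds needed to count integer points with it. -/
structure FibreWeight {m : ℕ} (d R : ℕ) (c C₁ Λ ℓ : ℝ) (P φ : (Fin m → ℝ) × ℝ → ℝ)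
    (G : ℝ → ℝ) : Prop where
  two_le : 2 ≤ d
  c_pos : 0 < c
  c_le : c ≤ C₁
  ℓ_pos : 0 < ℓ
  ℓ_lt : ℓ < c
  one_le_Λ : 1 ≤ Λ
  contDiff_P : ContDiff ℝ 2 P
  norm_fderiv_P_le : ∀ w, ‖fderiv ℝ P w‖ ≤ C₁ * ‖w‖ ^ (d - 1)
  norm_fderiv_fderiv_P_le : ∀ w, ‖fderiv ℝ (fderiv ℝ P) w‖ ≤ C₁ * ‖w‖ ^ (d - 2)
  contDiff_φ : ContDiff ℝ 1 φ
  φ_nonneg : ∀ w, 0 ≤ φ w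
  φ_le_one : ∀ w, φ w ≤ 1
  norm_le_of_φ : ∀ w, φ w ≠ 0 → ‖w‖ ≤ R
  le_norm_of_φ : ∃ ρ > 0, ∀ w, φ w ≠ 0 → ρ ≤ ‖w‖
  norm_fderiv_φ_le : ∀ w, ‖w‖ * ‖fderiv ℝ φ w‖ ≤ Λ
  contDiff_G : ContDiff ℝ 1 G
  G_nonneg : ∀ x, 0 ≤ G x
  G_le_one : ∀ x, G x ≤ 1
  G_supp : ∀ x y, G x ≠ 0 → G y ≠ 0 → |x - y| ≤ ℓ
  le_fderiv_P : ∀ w w', φ w ≠ 0 → φ w' ≠ 0 → ∀ z ∈ segment ℝ w w',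
    c * ‖z‖ ^ (d - 1) ≤ fderiv ℝ P z (0, 1)

namespace FibreWeight

variable {m d R : ℕ} {c C₁ Λ ℓ : ℝ} {P φ : (Fin m → ℝ) × ℝ → ℝ} {G : ℝ → ℝ}

lemma hasDerivAt_fibre {V : Type*} [NormedAddCommGroup V] [NormedSpace ℝ V]
    {f : (Fin m → ℝ) × ℝ → V} (hf : Differentiable ℝ f) (x : Fin m → ℝ) (y : ℝ) :
    HasDerivAt (fun y => f (x, y)) (fderiv ℝ f (x, y) (0, 1)) y :=
  (hf (x, y)).hasFDerivAt.comp_hasDerivAt y ((hasDerivAt_const y x).prodMk (hasDerivAt_id y))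

lemma deriv_fibre {V : Type*} [NormedAddCommGroup V] [NormedSpace ℝ V]
    {f : (Fin m → ℝ) × ℝ → V} (hf : Differentiable ℝ f) (x : Fin m → ℝ) :
    deriv (fun y => f (x, y)) = fun y => fderiv ℝ f (x, y) (0, 1) :=
  funext fun y => (hasDerivAt_fibre hf x y).deriv

lemma differentiable_P (H : FibreWeight d R c C₁ Λ ℓ P φ G) : Differentiable ℝ P :=
  H.contDiff_P.differentiable (by norm_num)

lemma contDiff_weight (H : FibreWeight d R c C₁ Λ ℓ P φ G) :
    ContDiff ℝ 1 fun w => φ w * G (P w) :=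
  H.contDiff_φ.mul (H.contDiff_G.comp (H.contDiff_P.of_le (by norm_num)))

lemma hasCompactSupport_φ (H : FibreWeight d R c C₁ Λ ℓ P φ G) : HasCompactSupport φ :=
  HasCompactSupport.intro (isCompact_closedBall (0 : (Fin m → ℝ) × ℝ) R) fun w hw => by
    by_contra h
    exact hw (mem_closedBall_zero_iff.2 (H.norm_le_of_φ w h))

lemma hasCompactSupport_weight (H : FibreWeight d R c C₁ Λ ℓ P φ G) :
    HasCompactSupport fun w => φ w * G (P w) := H.hasCompactSupport_φ.mul_right

lemma hasCompactSupport_fibre {f : (Fin m → ℝ) × ℝ → ℝ} (hf : HasCompactSupport f)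
    (x : Fin m → ℝ) : HasCompactSupport fun y => f (x, y) := by
  obtain ⟨r, hr⟩ := hf.isCompact.isBounded.exists_norm_le
  refine HasCompactSupport.intro (isCompact_closedBall (0 : ℝ) r) fun y hy => ?_
  by_contra h
  refine hy (mem_closedBall_zero_iff.2 ((norm_snd_le (x, y)).trans (hr _ (subset_tsupport _ h))))

/-- The mean value inequality along a fibre. -/
lemma mul_sub_le (H : FibreWeight d R c C₁ Λ ℓ P φ G) {x : Fin m → ℝ} {y z : ℝ}
    (hy : φ (x, y) * G (P (x, y)) ≠ 0) (hz : φ (x, z) * G (P (x, z)) ≠ 0)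
    {a b κ : ℝ} (hya : y ≤ a) (hab : a ≤ b) (hbz : b ≤ z) (hκ : ∀ ξ ∈ Set.Icc a b, κ ≤ ‖(x, ξ)‖)
    (hκ0 : 0 ≤ κ) : c * κ ^ (d - 1) * (b - a) ≤ ℓ := by
  have hy0 := left_ne_zero_of_mul hy
  have hz0 := left_ne_zero_of_mul hz
  have hseg : ∀ ξ ∈ Set.Icc y z, c * ‖((x, ξ) : (Fin m → ℝ) × ℝ)‖ ^ (d - 1)
      ≤ fderiv ℝ P (x, ξ) (0, 1) := by
    intro ξ hξ
    refine H.le_fderiv_P _ _ hy0 hz0 _ ?_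
    rw [← segment_eq_Icc (hξ.1.trans hξ.2)] at hξ
    obtain ⟨s, t, hs, ht, hst, rfl⟩ := hξ
    refine ⟨s, t, hs, ht, hst, ?_⟩
    ext i
    · simp [← add_mul, hst]
    · simp
  have hdiff : Differentiable ℝ fun y => P (x, y) := fun y =>
    (hasDerivAt_fibre H.differentiable_P x y).differentiableAt
  have hmono : ∀ a' b', y ≤ a' → a' ≤ b' → b' ≤ z → P (x, a') ≤ P (x, b') := by
    intro a' b' h1 h2 h3
    have := (convex_Icc a' b').mul_sub_le_image_sub_of_le_deriv (f := fun y => P (x, y)) (C := 0)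
      hdiff.continuous.continuousOn hdiff.differentiableOn (fun ξ hξ => by
        rw [deriv_fibre H.differentiable_P]
        have hξ' := interior_subset hξ
        exact le_trans (mul_nonneg H.c_pos.le (by positivity))
          (hseg ξ ⟨h1.trans hξ'.1, hξ'.2.trans h3⟩)) a' (Set.left_mem_Icc.2 h2) b'
          (Set.right_mem_Icc.2 h2) h2
    linarith
  have h1 := (convex_Icc a b).mul_sub_le_image_sub_of_le_deriv (f := fun y => P (x, y))
    (C := c * κ ^ (d - 1)) hdiff.continuous.continuousOn hdiff.differentiableOn (fun ξ hξ => by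
        rw [deriv_fibre H.differentiable_P]
        have hξ' := interior_subset hξ
        refine le_trans ?_ (hseg ξ ⟨hya.trans hξ'.1, hξ'.2.trans hbz⟩)
        have := hκ ξ hξ'
        have := H.c_pos
        gcongr) a (Set.left_mem_Icc.2 hab) b (Set.right_mem_Icc.2 hab) hab
  have h2 := hmono y a le_rfl hya (hab.trans hbz)
  have h3 := hmono b z (hya.trans hab) hbz le_rfl
  have h4 := H.G_supp _ _ (right_ne_zero_of_mul hz) (right_ne_zero_of_mul hy)
  have h5 := le_abs_self (P (x, z) - P (x, y))
  linarith

lemma abs_sub_le (H : FibreWeight d R c C₁ Λ ℓ P φ G) {x : Fin m → ℝ} (hx : x ≠ 0) {y z : ℝ}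
    (hy : φ (x, y) * G (P (x, y)) ≠ 0) (hz : φ (x, z) * G (P (x, z)) ≠ 0) :
    |y - z| ≤ ℓ / c * (‖x‖⁻¹) ^ (d - 1) := by
  wlog h : y ≤ z generalizing y z
  · rw [abs_sub_comm]
    exact this hz hy (le_of_not_ge h)
  have h1 := H.mul_sub_le hy hz le_rfl h le_rfl (κ := ‖x‖) (fun ξ _ => norm_fst_le (x, ξ))
    (norm_nonneg _)
  have h2 : 0 < ‖x‖ := norm_pos_iff.2 hx
  have h3 := H.c_pos
  rw [abs_sub_comm, abs_of_nonneg (sub_nonneg.2 h), inv_pow, ← div_eq_mul_inv, div_div,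
    le_div_iff₀ (by positivity)]
  linarith

lemma abs_sub_le_four (H : FibreWeight d R c C₁ Λ ℓ P φ G) {x : Fin m → ℝ} {y z : ℝ}
    (hy : φ (x, y) * G (P (x, y)) ≠ 0) (hz : φ (x, z) * G (P (x, z)) ≠ 0) : |y - z| ≤ 4 := by
  wlog h : y ≤ z generalizing y z
  · rw [abs_sub_comm]
    exact this hz hy (le_of_not_ge h)
  rw [abs_sub_comm, abs_of_nonneg (sub_nonneg.2 h)]
  by_contra! hlt
  have hn : ∀ ξ : ℝ, |ξ| ≤ ‖(x, ξ)‖ := fun ξ => norm_snd_le (x, ξ)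
  have key : c * 1 ^ (d - 1) * 1 ≤ ℓ := by
    rcases le_total 0 (y + z) with h0 | h0
    · have := H.mul_sub_le hy hz (a := z - 1) (b := z) (κ := 1) (by linarith) (by linarith) le_rfl
        (fun ξ hξ => le_trans ((by linarith [hξ.1] : (1 : ℝ) ≤ ξ).trans (le_abs_self _)) (hn ξ))
        zero_le_one
      simpa using this
    · have := H.mul_sub_le hy hz (a := y) (b := y + 1) (κ := 1) le_rfl (by linarith) (by linarith)
        (fun ξ hξ => le_trans ((by linarith [hξ.2] : (1 : ℝ) ≤ -ξ).trans (neg_le_abs _)) (hn ξ))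
        zero_le_one
      simpa using this
  have := H.ℓ_lt
  simp only [one_pow, mul_one] at key
  linarith

lemma weight_nonneg (H : FibreWeight d R c C₁ Λ ℓ P φ G) (w) : 0 ≤ φ w * G (P w) :=
  mul_nonneg (H.φ_nonneg _) (H.G_nonneg _)

lemma weight_le_one (H : FibreWeight d R c C₁ Λ ℓ P φ G) (w) : φ w * G (P w) ≤ 1 :=
  mul_le_one₀ (H.φ_le_one _) (H.G_nonneg _) (H.G_le_one _)

/-- The integral of the weight along a fibre. -/
def fibreIntegral (P φ : (Fin m → ℝ) × ℝ → ℝ) (G : ℝ → ℝ) (x : Fin m → ℝ) : ℝ :=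
  ∫ y, φ (x, y) * G (P (x, y))

lemma fibreIntegral_nonneg (H : FibreWeight d R c C₁ Λ ℓ P φ G) (x) : 0 ≤ fibreIntegral P φ G x :=
  integral_nonneg fun y => H.weight_nonneg (x, y)

lemma fibreIntegral_le_four (H : FibreWeight d R c C₁ Λ ℓ P φ G) (x) :
    fibreIntegral P φ G x ≤ 4 := by
  refine (le_abs_self _).trans ?_
  have := abs_integral_le_of_support (f := fun y => φ (x, y) * G (P (x, y)))
    (s := {y | φ (x, y) * G (P (x, y)) ≠ 0}) (B := 1) (δ := 4) (by norm_num) zero_le_one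
    (fun y hy => not_not.1 hy)
    (fun y _ => by rw [abs_of_nonneg (H.weight_nonneg _)]; exact H.weight_le_one _)
    (fun y hy z hz => H.abs_sub_le_four hy hz)
  rwa [one_mul] at this

lemma fibreIntegral_le (H : FibreWeight d R c C₁ Λ ℓ P φ G) {x : Fin m → ℝ} (hx : x ≠ 0) :
    fibreIntegral P φ G x ≤ ℓ / c * (‖x‖⁻¹) ^ (d - 1) := by
  refine (le_abs_self _).trans ?_
  have := H.ℓ_pos
  have := H.c_pos
  have := abs_integral_le_of_support (f := fun y => φ (x, y) * G (P (x, y)))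
    (s := {y | φ (x, y) * G (P (x, y)) ≠ 0}) (B := 1) (δ := ℓ / c * (‖x‖⁻¹) ^ (d - 1))
    (by positivity) zero_le_one
    (fun y hy => not_not.1 hy)
    (fun y _ => by rw [abs_of_nonneg (H.weight_nonneg _)]; exact H.weight_le_one _)
    (fun y hy z hz => H.abs_sub_le hx hy hz)
  rwa [one_mul] at this

lemma weight_eq_zero (H : FibreWeight d R c C₁ Λ ℓ P φ G) {x : Fin m → ℝ} (hx : R < ‖x‖) (y : ℝ) :
    φ (x, y) * G (P (x, y)) = 0 := by
  have : φ (x, y) = 0 := by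
    by_contra h
    exact absurd (H.norm_le_of_φ _ h) (not_le.2 (hx.trans_le (norm_fst_le (x, y))))
  rw [this, zero_mul]

lemma fibreIntegral_eq_zero (H : FibreWeight d R c C₁ Λ ℓ P φ G) {x : Fin m → ℝ} (hx : R < ‖x‖) :
    fibreIntegral P φ G x = 0 := by
  simp [fibreIntegral, H.weight_eq_zero hx]

end FibreWeight

namespace FibreWeight

variable {m d R : ℕ} {c C₁ Λ ℓ : ℝ} {P φ : (Fin m → ℝ) × ℝ → ℝ} {G : ℝ → ℝ}

lemma le_fderiv_P_of_mem_tsupport (H : FibreWeight d R c C₁ Λ ℓ P φ G) {w : (Fin m → ℝ) × ℝ}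
    (hw : w ∈ tsupport φ) : c * ‖w‖ ^ (d - 1) ≤ fderiv ℝ P w (0, 1) ∧ 0 < ‖w‖ := by
  obtain ⟨ρ, hρ, hρφ⟩ := H.le_norm_of_φ
  have hcl : IsClosed {w | c * ‖w‖ ^ (d - 1) ≤ fderiv ℝ P w (0, 1) ∧ ρ ≤ ‖w‖} := by
    have h1 : Continuous fun w => fderiv ℝ P w (0, 1) :=
      (H.contDiff_P.continuous_fderiv (by norm_num)).clm_apply continuous_const
    exact (isClosed_le (by fun_prop) h1).inter (isClosed_le continuous_const continuous_norm)
  have hsub : Function.support φ ⊆ {w | c * ‖w‖ ^ (d - 1) ≤ fderiv ℝ P w (0, 1) ∧ ρ ≤ ‖w‖} :=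
    fun w hw => ⟨H.le_fderiv_P w w hw hw w (left_mem_segment ℝ w w), hρφ w hw⟩
  have := closure_minimal hsub hcl hw
  exact ⟨this.1, hρ.trans_le this.2⟩

lemma fderiv_φ_eq_zero (H : FibreWeight d R c C₁ Λ ℓ P φ G) {w : (Fin m → ℝ) × ℝ}
    (hw : φ w = 0) : fderiv ℝ φ w = 0 :=
  IsLocalMin.fderiv_eq_zero (Eventually.of_forall fun z => by rw [hw]; exact H.φ_nonneg z)

lemma fderiv_weight (H : FibreWeight d R c C₁ Λ ℓ P φ G) (w u : (Fin m → ℝ) × ℝ) :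
    fderiv ℝ (fun w => φ w * G (P w)) w u
      = fderiv ℝ φ w u * G (P w) + φ w * (deriv G (P w) * fderiv ℝ P w u) := by
  have h1 := (H.contDiff_φ.differentiable (by norm_num) w).hasFDerivAt
  have h2 := (H.contDiff_G.differentiable (by norm_num) (P w)).hasDerivAt.comp_hasFDerivAt w
    (H.differentiable_P w).hasFDerivAt
  have := (h1.mul h2).fderiv
  simp only [Function.comp_def] at this
  rw [show (fun w => φ w * G (P w)) = φ * fun w => G (P w) from rfl, this]
  simp
  ring

/-- The derivative of the fibre integral, after integration by parts. -/
lemma abs_integral_fderiv_weight_le (H : FibreWeight d R c C₁ Λ ℓ P φ G) {x u : Fin m → ℝ}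
    (hx : x ≠ 0) (hu : ‖u‖ ≤ 1) :
    |∫ y, fderiv ℝ (fun w => φ w * G (P w)) (x, y) (u, 0)|
      ≤ 4 * (C₁ / c) ^ 2 * Λ / c * ℓ * (‖x‖⁻¹) ^ d := by
  have hc := H.c_pos
  have hℓ := H.ℓ_pos
  have hΛ := H.one_le_Λ
  have hd := H.two_le
  have hx0 : 0 < ‖x‖ := norm_pos_iff.2 hx
  have hA1 : 1 ≤ C₁ / c := (one_le_div hc).2 H.c_le
  have hφd := H.contDiff_φ.differentiable (by norm_num)
  have hPf : ContDiff ℝ 1 (fderiv ℝ P) := H.contDiff_P.fderiv_right (by norm_num)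
  have hPfd := hPf.differentiable (by norm_num)
  have hlin : ContDiff ℝ 2 fun y : ℝ => (x, y) := contDiff_const.prodMk contDiff_id
  have hlin1 : ContDiff ℝ 1 fun y : ℝ => (x, y) := contDiff_const.prodMk contDiff_id
  have hun : ‖((u, 0) : (Fin m → ℝ) × ℝ)‖ ≤ 1 := by simpa [Prod.norm_def] using hu
  have hen : ‖((0, 1) : (Fin m → ℝ) × ℝ)‖ ≤ 1 := by simp [Prod.norm_def]
  have hPv : ∀ v : (Fin m → ℝ) × ℝ, ContDiff ℝ 1 fun w => fderiv ℝ P w v := fun v =>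
    hPf.clm_apply contDiff_const
  have hPvd : ∀ (v : (Fin m → ℝ) × ℝ) (y : ℝ), HasDerivAt (fun y => fderiv ℝ P (x, y) v)
      (fderiv ℝ (fderiv ℝ P) (x, y) (0, 1) v) y := fun v y => by
    have := (hasDerivAt_fibre hPfd x y).clm_apply (hasDerivAt_const y v)
    simpa using this
  have key := abs_integral_fibre_le (φ := fun y => φ (x, y)) (φu := fun y => fderiv ℝ φ (x, y) (u, 0))
    (p := fun y => P (x, y)) (pu := fun y => fderiv ℝ P (x, y) (u, 0)) (G := G)
    (B := 4 * (C₁ / c) ^ 2 * Λ / ‖x‖) (δ := ℓ / c * (‖x‖⁻¹) ^ (d - 1)) (by positivity)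
    (by positivity) (H.contDiff_φ.comp hlin1) (hasCompactSupport_fibre H.hasCompactSupport_φ x)
    (H.contDiff_P.comp hlin) ((hPv _).comp hlin1) H.contDiff_G
    (fun y => by rw [abs_of_nonneg (H.G_nonneg y)]; exact H.G_le_one y)
    (((H.contDiff_φ.continuous_fderiv (by norm_num)).comp hlin.continuous).clm_apply
      continuous_const)
    ?_ ?_ ?_ (fun y hy z hz => H.abs_sub_le hx hy hz)
  · simp only [fderiv_weight H]
    refine key.trans (le_of_eq ?_)
    obtain ⟨k, rfl⟩ : ∃ k, d = k + 1 := ⟨d - 1, by omega⟩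
    rw [Nat.add_sub_cancel, pow_succ]
    ring
  · intro y hy
    rw [deriv_fibre H.differentiable_P]
    have hy' : (x, y) ∈ tsupport φ :=
      closure_minimal (s := Function.support fun y => φ (x, y))
        (t := (fun y : ℝ => (x, y)) ⁻¹' tsupport φ) (fun z hz => subset_tsupport φ hz)
        ((isClosed_tsupport φ).preimage hlin.continuous) hy
    obtain ⟨h1, h2⟩ := H.le_fderiv_P_of_mem_tsupport hy'
    exact lt_of_lt_of_le (by positivity) h1
  · intro y hy
    rw [deriv_fibre hφd]
    simp [H.fderiv_φ_eq_zero hy]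
  · intro y hy
    rw [deriv_fibre H.differentiable_P, deriv_fibre hφd]
    simp only [(hPvd _ y).deriv]
    obtain ⟨h1, h2⟩ := H.le_fderiv_P_of_mem_tsupport (subset_tsupport φ hy)
    set w : (Fin m → ℝ) × ℝ := (x, y) with hw
    have hxw : ‖x‖ ≤ ‖w‖ := norm_fst_le w
    set pe := fderiv ℝ P w (0, 1)
    set pu := fderiv ℝ P w (u, 0)
    have hpe : 0 < pe := lt_of_lt_of_le (by positivity) h1
    have hC₁ : 0 ≤ C₁ := hc.le.trans H.c_le
    have b1 : ∀ v : (Fin m → ℝ) × ℝ, ‖v‖ ≤ 1 → |fderiv ℝ P w v| ≤ C₁ * ‖w‖ ^ (d - 1) := by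
      intro v hv
      exact ((fderiv ℝ P w).le_opNorm v).trans
        ((mul_le_of_le_one_right (norm_nonneg _) hv).trans (H.norm_fderiv_P_le w))
    have b2 : ∀ v : (Fin m → ℝ) × ℝ, ‖v‖ ≤ 1 → |fderiv ℝ (fderiv ℝ P) w (0, 1) v|
        ≤ C₁ * ‖w‖ ^ (d - 2) := by
      intro v hv
      refine ((fderiv ℝ (fderiv ℝ P) w (0, 1)).le_opNorm v).trans
        ((mul_le_of_le_one_right (norm_nonneg _) hv).trans ?_)
      exact ((fderiv ℝ (fderiv ℝ P) w).le_opNorm _).trans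
        ((mul_le_of_le_one_right (norm_nonneg _) hen).trans (H.norm_fderiv_fderiv_P_le w))
    have b3 : ∀ v : (Fin m → ℝ) × ℝ, ‖v‖ ≤ 1 → |fderiv ℝ φ w v| ≤ Λ / ‖w‖ := by
      intro v hv
      rw [le_div_iff₀ h2]
      refine le_trans ?_ (H.norm_fderiv_φ_le w)
      rw [mul_comm]
      gcongr
      exact ((fderiv ℝ φ w).le_opNorm v).trans (mul_le_of_le_one_right (norm_nonneg _) hv)
    have hpinv : 1 / pe ≤ 1 / (c * ‖w‖ ^ (d - 1)) := one_div_le_one_div_of_le (by positivity) h1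
    have q1 : ∀ v : (Fin m → ℝ) × ℝ, ‖v‖ ≤ 1 → |fderiv ℝ P w v| / pe ≤ C₁ / c := by
      intro v hv
      rw [div_le_div_iff₀ hpe hc]
      calc |fderiv ℝ P w v| * c ≤ (C₁ * ‖w‖ ^ (d - 1)) * c := by gcongr; exact b1 v hv
        _ = C₁ * (c * ‖w‖ ^ (d - 1)) := by ring
        _ ≤ C₁ * pe := by gcongr
    have q2 : ∀ v : (Fin m → ℝ) × ℝ, ‖v‖ ≤ 1 → |fderiv ℝ (fderiv ℝ P) w (0, 1) v| / pe
        ≤ C₁ / c / ‖w‖ := by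
      intro v hv
      rw [div_div, div_le_div_iff₀ hpe (by positivity)]
      calc |fderiv ℝ (fderiv ℝ P) w (0, 1) v| * (c * ‖w‖)
          ≤ (C₁ * ‖w‖ ^ (d - 2)) * (c * ‖w‖) := by gcongr; exact b2 v hv
        _ = C₁ * (c * ‖w‖ ^ (d - 1)) := by
          rw [show d - 1 = (d - 2) + 1 by omega, pow_succ]; ring
        _ ≤ C₁ * pe := by gcongr
    have hquot : ∀ a b : ℝ, (a * pe - pu * b) / pe ^ 2 = a / pe - pu / pe * (b / pe) := by
      intro a b
      field_simp
    rw [hquot]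
    have e1 : |pu / pe| ≤ C₁ / c := by
      rw [abs_div, abs_of_pos hpe]; exact q1 _ hun
    have e2 := q2 _ hun
    have e3 := q2 _ hen
    rw [← abs_of_pos hpe, ← abs_div] at e2 e3
    have hφ1 : |φ w| ≤ 1 := by rw [abs_of_nonneg (H.φ_nonneg w)]; exact H.φ_le_one w
    set A := C₁ / c
    set a := fderiv ℝ (fderiv ℝ P) w (0, 1) (u, 0) / pe
    set b := fderiv ℝ (fderiv ℝ P) w (0, 1) (0, 1) / pe
    have t1 := b3 _ hun
    have t2 : |fderiv ℝ φ w (0, 1) * (pu / pe)| ≤ Λ / ‖w‖ * A := by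
      rw [abs_mul]
      gcongr
      exact b3 _ hen
    have t3 : |φ w * (a - pu / pe * b)| ≤ A / ‖w‖ + A * (A / ‖w‖) := by
      rw [abs_mul]
      refine (mul_le_of_le_one_left (abs_nonneg _) hφ1).trans ((abs_sub _ _).trans ?_)
      rw [abs_mul]
      gcongr
    have t4 := abs_sub (fderiv ℝ φ w (u, 0)) (fderiv ℝ φ w (0, 1) * (pu / pe)
      + φ w * (a - pu / pe * b))
    have t5 := abs_add_le (fderiv ℝ φ w (0, 1) * (pu / pe)) (φ w * (a - pu / pe * b))
    refine le_trans (b := (Λ + Λ * A + A + A * A) / ‖w‖) ?_ ?_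
    · have : (Λ + Λ * A + A + A * A) / ‖w‖ = Λ / ‖w‖ + Λ / ‖w‖ * A + (A / ‖w‖ + A * (A / ‖w‖)) := by
        ring
      linarith
    · have hnum : Λ + Λ * A + A + A * A ≤ 4 * A ^ 2 * Λ := by
        have f1 : A ≤ A ^ 2 := by nlinarith
        have f2 : 1 ≤ A ^ 2 := by nlinarith
        have f3 : Λ * 1 ≤ Λ * A ^ 2 := by gcongr
        have f4 : Λ * A ≤ Λ * A ^ 2 := by gcongr
        have f5 : 1 * A ^ 2 ≤ Λ * A ^ 2 := by gcongr
        nlinarith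
      gcongr
end FibreWeight

lemma norm_intVec {m : ℕ} (v : Fin m → ℤ) : ‖intVec v‖ = height v := by
  apply le_antisymm
  · rw [pi_norm_le_iff_of_nonneg (by positivity)]
    intro i
    rw [intVec, Real.norm_eq_abs, ← Int.cast_abs, ← Nat.cast_natAbs]
    exact_mod_cast height_le_iff.1 le_rfl i
  · have : height v ≤ ⌊‖intVec v‖⌋₊ := by
      rw [height_le_iff]
      intro i
      rw [Nat.le_floor_iff (norm_nonneg _)]
      refine le_trans (le_of_eq ?_) (norm_le_pi_norm (intVec v) i)
      rw [intVec, Real.norm_eq_abs, ← Int.cast_abs, Nat.cast_natAbs]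
    exact (Nat.le_floor_iff (norm_nonneg _)).1 this

lemma hasDerivAt_integral_fibre {m : ℕ} {f : (Fin m → ℝ) × ℝ → ℝ} (hf : ContDiff ℝ 1 f)
    (hs : HasCompactSupport f) (v u : Fin m → ℝ) (t : ℝ) :
    HasDerivAt (fun t : ℝ => ∫ y, f (v + t • u, y))
      (∫ y, fderiv ℝ f (v + t • u, y) (u, 0)) t := by
  have hfc : Continuous (fderiv ℝ f) := hf.continuous_fderiv (by norm_num)
  obtain ⟨C, hC⟩ := (hs.fderiv (𝕜 := ℝ)).exists_bound_of_continuous hfc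
  obtain ⟨r, hr⟩ := (hs.fderiv (𝕜 := ℝ)).isCompact.isBounded.exists_norm_le
  have hC0 : 0 ≤ C := (norm_nonneg _).trans (hC 0)
  refine (hasDerivAt_integral_of_dominated_loc_of_deriv_le (s := Set.univ)
    (F := fun (t : ℝ) (y : ℝ) => f (v + t • u, y))
    (F' := fun t y => fderiv ℝ f (v + t • u, y) (u, 0))
    (bound := (Set.Icc (-r) r).indicator fun _ => C * ‖u‖) univ_mem ?_ ?_ ?_ ?_ ?_ ?_).2
  · exact Eventually.of_forall fun t => (hf.continuous.comp (by fun_prop)).aestronglyMeasurable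
  · exact (hf.continuous.comp (by fun_prop)).integrable_of_hasCompactSupport
      (FibreWeight.hasCompactSupport_fibre hs _)
  · exact ((hfc.comp (by fun_prop)).clm_apply continuous_const).aestronglyMeasurable
  · refine ae_of_all _ fun y t _ => ?_
    by_cases hy : y ∈ Set.Icc (-r) r
    · rw [Set.indicator_of_mem hy]
      refine ((fderiv ℝ f (v + t • u, y)).le_opNorm _).trans ?_
      have : ‖((u, 0) : (Fin m → ℝ) × ℝ)‖ = ‖u‖ := by simp [Prod.norm_def]
      rw [this]
      exact mul_le_mul_of_nonneg_right (hC _) (norm_nonneg _)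
    · rw [Set.indicator_of_notMem hy]
      have : fderiv ℝ f (v + t • u, y) = 0 := by
        by_contra h
        refine hy (abs_le.1 ((norm_snd_le (v + t • u, y)).trans (hr _ (subset_tsupport _ h))))
      simp [this]
  · rw [integrable_indicator_iff measurableSet_Icc]
    exact integrableOn_const (by simp)
  · refine ae_of_all _ fun y t _ => ?_
    have h1 : HasDerivAt (fun t : ℝ => (v + t • u, y)) (u, 0) t := by
      have h2 : HasDerivAt (fun t : ℝ => v + t • u) u t := by
        simpa using ((hasDerivAt_id t).smul_const u).const_add v
      exact h2.prodMk (hasDerivAt_const t y)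
    exact (hf.differentiable (by norm_num) _).hasFDerivAt.comp_hasDerivAt t h1

/-- The unit cube centred at `v`. -/
def cube {m : ℕ} (v : Fin m → ℤ) : Set (Fin m → ℝ) :=
  Set.univ.pi fun i => Set.Ico ((v i : ℝ) - 1 / 2) (v i + 1 / 2)

lemma measurableSet_cube {m : ℕ} (v : Fin m → ℤ) : MeasurableSet (cube v) :=
  MeasurableSet.univ_pi fun _ => measurableSet_Ico

lemma volume_cube {m : ℕ} (v : Fin m → ℤ) : volume (cube v) = 1 := by
  rw [cube, volume_pi_pi]
  simp
  norm_num

lemma norm_sub_le_of_mem_cube {m : ℕ} {v : Fin m → ℤ} {x : Fin m → ℝ} (hx : x ∈ cube v) :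
    ‖x - intVec v‖ ≤ 1 / 2 := by
  rw [pi_norm_le_iff_of_nonneg (by norm_num)]
  intro i
  have := hx i (Set.mem_univ i)
  rw [Set.mem_Ico] at this
  rw [Pi.sub_apply, intVec, Real.norm_eq_abs, abs_le]
  constructor <;> linarith

lemma mem_cube_iff {m : ℕ} {v : Fin m → ℤ} {x : Fin m → ℝ} :
    x ∈ cube v ↔ v = fun i => ⌊x i + 1 / 2⌋ := by
  rw [funext_iff, cube, Set.mem_univ_pi]
  refine forall_congr' fun i => ?_
  rw [eq_comm, Int.floor_eq_iff, Set.mem_Ico]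
  constructor <;> rintro ⟨h1, h2⟩ <;> constructor <;> linarith

lemma pairwise_disjoint_cube {m : ℕ} :
    Pairwise (Function.onFun Disjoint (cube : (Fin m → ℤ) → Set (Fin m → ℝ))) := by
  intro v w hvw
  rw [Function.onFun, Set.disjoint_left]
  intro x hx hx'
  rw [mem_cube_iff] at hx hx'
  exact hvw (hx.trans hx'.symm)

lemma exists_mem_cube {m R : ℕ} {x : Fin m → ℝ} (hx : ‖x‖ ≤ R) :
    ∃ v ∈ intBox m (R + 1), x ∈ cube v := by
  refine ⟨fun i => ⌊x i + 1 / 2⌋, ?_, mem_cube_iff.2 rfl⟩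
  rw [mem_intBox, height_le_iff]
  intro i
  have h := abs_le.1 ((norm_le_pi_norm x i).trans hx)
  have h1 := Int.floor_le (x i + 1 / 2)
  have h2 := Int.lt_floor_add_one (x i + 1 / 2)
  have h3 : (⌊x i + 1 / 2⌋ : ℝ) ≤ (R + 1 : ℤ) := by push_cast; linarith
  have h4 : (-(R + 1 + 1) : ℤ) < (⌊x i + 1 / 2⌋ : ℝ) := by push_cast; linarith
  have h5 := Int.cast_le.1 h3
  have h6 := Int.cast_lt.1 h4
  omega

namespace FibreWeight

variable {m d R : ℕ} {c C₁ Λ ℓ : ℝ} {P φ : (Fin m → ℝ) × ℝ → ℝ} {G : ℝ → ℝ}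

lemma abs_fibreIntegral_sub_le (H : FibreWeight d R c C₁ Λ ℓ P φ G) {x v : Fin m → ℝ}
    (hv : 1 ≤ ‖v‖) (hx : ‖x - v‖ ≤ 1 / 2) :
    |fibreIntegral P φ G x - fibreIntegral P φ G v|
      ≤ 4 * (C₁ / c) ^ 2 * Λ / c * ℓ * 2 ^ d * (‖v‖⁻¹) ^ d := by
  have hc := H.c_pos
  have hℓ := H.ℓ_pos
  have hΛ := H.one_le_Λ
  have hlow : ∀ t ∈ Set.Icc (0 : ℝ) 1, ‖v‖ / 2 ≤ ‖v + t • (x - v)‖ := fun t ht => by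
    have h1 : ‖t • (x - v)‖ ≤ 1 / 2 := by
      rw [norm_smul, Real.norm_eq_abs, abs_of_nonneg ht.1]
      exact (mul_le_of_le_one_left (norm_nonneg _) ht.2).trans hx
    have h2 := norm_sub_le (v + t • (x - v)) (t • (x - v))
    rw [add_sub_cancel_right] at h2
    linarith
  have := norm_image_sub_le_of_norm_deriv_le_segment_01'
    (f := fun t : ℝ => fibreIntegral P φ G (v + t • (x - v)))
    (C := 4 * (C₁ / c) ^ 2 * Λ / c * ℓ * 2 ^ d * (‖v‖⁻¹) ^ d)
    (fun t _ => (hasDerivAt_integral_fibre H.contDiff_weight H.hasCompactSupport_weight v (x - v)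
      t).hasDerivWithinAt) (fun t ht => ?_)
  · simpa using this
  · have h1 := hlow t (Set.Ico_subset_Icc_self ht)
    have h2 : 0 < ‖v + t • (x - v)‖ := by linarith
    refine (H.abs_integral_fderiv_weight_le (norm_pos_iff.1 h2) (by linarith)).trans ?_
    rw [mul_assoc _ (2 ^ d), ← mul_pow]
    gcongr
    rw [inv_le_iff_one_le_mul₀ h2]
    calc (1 : ℝ) = 2 * ‖v‖⁻¹ * (‖v‖ / 2) := by
          field_simp
      _ ≤ _ := by gcongr

lemma integrable_fibreIntegral (H : FibreWeight d R c C₁ Λ ℓ P φ G) :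
    Integrable (fibreIntegral P φ G) := by
  have := (H.contDiff_weight.continuous.integrable_of_hasCompactSupport (μ := volume.prod volume)
    H.hasCompactSupport_weight).integral_prod_left
  exact this

lemma integral_fibreIntegral (H : FibreWeight d R c C₁ Λ ℓ P φ G) :
    ∫ x, fibreIntegral P φ G x = ∫ w, φ w * G (P w) := by
  have := integral_prod _ (H.contDiff_weight.continuous.integrable_of_hasCompactSupport
    (μ := volume.prod volume) H.hasCompactSupport_weight)
  exact this.symm

lemma abs_sum_fibreIntegral_sub_le (H : FibreWeight d R c C₁ Λ ℓ P φ G) (hdm : d ≤ m) :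
    |∑ v ∈ intBoxNeZero m (R + 1), fibreIntegral P φ G (intVec v) - ∫ w, φ w * G (P w)|
      ≤ 4 + 4 * (C₁ / c) ^ 2 * Λ / c * ℓ * 2 ^ d * (2 * m * 3 ^ (m - 1)) *
        ((R + 1 : ℕ) : ℝ) ^ (m - d) * (1 + Real.log (R + 1 : ℕ)) := by
  have hc := H.c_pos
  have hℓ := H.ℓ_pos
  have hΛ := H.one_le_Λ
  have h1 : ∫ w, φ w * G (P w) = ∑ v ∈ intBox m (R + 1), ∫ x in cube v, fibreIntegral P φ G x := by
    rw [← H.integral_fibreIntegral, ← integral_biUnion_finset _ (fun v _ => measurableSet_cube v)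
      (fun v _ w _ h => pairwise_disjoint_cube h)
      (fun v _ => H.integrable_fibreIntegral.integrableOn)]
    refine (setIntegral_eq_integral_of_forall_compl_eq_zero fun x hx => ?_).symm
    refine H.fibreIntegral_eq_zero (not_le.1 fun hxR => hx ?_)
    obtain ⟨v, hv, hxv⟩ := exists_mem_cube hxR
    exact Set.mem_biUnion hv hxv
  have hsplit : intBox m (R + 1) = insert 0 (intBoxNeZero m (R + 1)) := by
    ext v
    rw [Finset.mem_insert, mem_intBox, mem_intBoxNeZero]
    by_cases hv : v = 0
    · simp [hv, height_eq_zero_iff.2]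
    · simp [hv]
  have h0 : (0 : Fin m → ℤ) ∉ intBoxNeZero m (R + 1) := by simp [mem_intBoxNeZero]
  have hvr : ∀ v : Fin m → ℤ, volume.real (cube v) = 1 := fun v => by
    rw [Measure.real, volume_cube]; rfl
  have hcube0 : |∫ x in cube (0 : Fin m → ℤ), fibreIntegral P φ G x| ≤ 4 := by
    have := norm_setIntegral_le_of_norm_le_const (μ := volume) (s := cube (0 : Fin m → ℤ))
      (f := fibreIntegral P φ G) (C := 4) (by rw [volume_cube]; exact ENNReal.one_lt_top)
      (fun x _ => by
        rw [Real.norm_eq_abs, abs_of_nonneg (H.fibreIntegral_nonneg x)]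
        exact H.fibreIntegral_le_four x)
    rwa [hvr, mul_one] at this
  have hcube : ∀ v ∈ intBoxNeZero m (R + 1), |fibreIntegral P φ G (intVec v)
      - ∫ x in cube v, fibreIntegral P φ G x|
      ≤ 4 * (C₁ / c) ^ 2 * Λ / c * ℓ * 2 ^ d * ((height v : ℝ)⁻¹) ^ d := by
    intro v hv
    rw [mem_intBoxNeZero] at hv
    have h2 : ∫ x in cube v, (fibreIntegral P φ G (intVec v) - fibreIntegral P φ G x)
        = fibreIntegral P φ G (intVec v) - ∫ x in cube v, fibreIntegral P φ G x := by
      have hci : IntegrableOn (fun _ : Fin m → ℝ => fibreIntegral P φ G (intVec v)) (cube v) :=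
        integrableOn_const (by rw [volume_cube]; exact ENNReal.one_ne_top)
      rw [integral_sub hci
        H.integrable_fibreIntegral.integrableOn, setIntegral_const, hvr, one_smul]
    rw [← h2]
    have := norm_setIntegral_le_of_norm_le_const (μ := volume) (s := cube v)
      (f := fun x => fibreIntegral P φ G (intVec v) - fibreIntegral P φ G x)
      (C := 4 * (C₁ / c) ^ 2 * Λ / c * ℓ * 2 ^ d * ((height v : ℝ)⁻¹) ^ d)
      (by rw [volume_cube]; exact ENNReal.one_lt_top)
      (fun x hx => by
        rw [Real.norm_eq_abs, abs_sub_comm, ← norm_intVec]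
        refine H.abs_fibreIntegral_sub_le ?_ (norm_sub_le_of_mem_cube hx)
        rw [norm_intVec]
        exact_mod_cast one_le_height hv.2)
    rwa [hvr, mul_one] at this
  rw [h1, hsplit, Finset.sum_insert h0, sub_add_eq_sub_sub_swap, ← Finset.sum_sub_distrib]
  refine (abs_sub _ _).trans ?_
  rw [add_comm (4 : ℝ)]
  refine add_le_add ?_ hcube0
  refine (Finset.abs_sum_le_sum_abs _ _).trans ((Finset.sum_le_sum hcube).trans ?_)
  rw [← Finset.mul_sum, mul_assoc (_ * 2 ^ d), mul_assoc (_ * 2 ^ d)]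
  exact mul_le_mul_of_nonneg_left
    (sum_height_pow_le_log (by linarith [H.two_le]) hdm (R + 1)) (by positivity)

end FibreWeight

/-- The sum of `W` over the lattice obtained from `ℤᵐ × ℤ` by the shear with parameter `X`. -/
def shearSum {m : ℕ} (W : (Fin m → ℝ) × ℝ → ℝ) (X : Fin m → UnitAddCircle) : ℝ :=
  ∑' p : (Fin m → ℤ) × ℤ, W (intVec p.1, p.2 + ∑ i, (p.1 i : ℝ) * circleRep (X i))

lemma coe_sum_mul_circleRep {m : ℕ} (v : Fin m → ℤ) (X : Fin m → UnitAddCircle) :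
    ((∑ i, (v i : ℝ) * circleRep (X i) : ℝ) : UnitAddCircle) = torusPairing v X := by
  rw [torusPairing_apply]
  have : ∀ x : ℝ, (x : UnitAddCircle) = QuotientAddGroup.mk' (AddSubgroup.zmultiples (1 : ℝ)) x :=
    fun x => rfl
  rw [this, map_sum]
  refine Finset.sum_congr rfl fun i _ => ?_
  rw [← zsmul_eq_mul, map_zsmul, ← this, coe_circleRep]

lemma tsum_int_le_nine {f : ℤ → ℝ} (h0 : ∀ k, 0 ≤ f k) (h1 : ∀ k, f k ≤ 1)
    (hf : ∀ k l, f k ≠ 0 → f l ≠ 0 → |k - l| ≤ 4) : 0 ≤ ∑' k, f k ∧ ∑' k, f k ≤ 9 := by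
  refine ⟨tsum_nonneg h0, ?_⟩
  by_cases h : ∃ k, f k ≠ 0
  · obtain ⟨k, hk⟩ := h
    rw [tsum_eq_sum (s := Finset.Icc (k - 4) (k + 4)) fun l hl => ?_]
    · refine (Finset.sum_le_card_nsmul _ _ 1 fun l _ => h1 l).trans (le_of_eq ?_)
      rw [Int.card_Icc]
      have : (k + 4 + 1 - (k - 4)).toNat = 9 := by omega
      rw [this]
      norm_num
    · by_contra hl'
      have := hf k l hk hl'
      rw [abs_le] at this
      exact hl (Finset.mem_Icc.2 ⟨by omega, by omega⟩)
  · push Not at h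
    simp [h]

namespace FibreWeight

variable {m d R : ℕ} {c C₁ Λ ℓ : ℝ} {P φ : (Fin m → ℝ) × ℝ → ℝ} {G : ℝ → ℝ}

lemma norm_snd_le_of_weight (H : FibreWeight d R c C₁ Λ ℓ P φ G) {x : Fin m → ℝ} {y : ℝ}
    (h : φ (x, y) * G (P (x, y)) ≠ 0) : ‖x‖ ≤ R ∧ |y| ≤ R := by
  have := H.norm_le_of_φ _ (left_ne_zero_of_mul h)
  exact ⟨(norm_fst_le (x, y)).trans this, (norm_snd_le (x, y)).trans this⟩

lemma finite_int_abs_add_le (a : ℝ) (R : ℕ) : {k : ℤ | |k + a| ≤ R}.Finite := by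
  refine (Set.finite_Icc ⌊-R - a⌋ ⌈R - a⌉).subset fun k hk => ?_
  rw [Set.mem_ofPred_eq] at hk
  have := abs_le.1 hk
  constructor
  · exact Int.floor_le_iff.2 (by linarith)
  · exact Int.le_ceil_iff.2 (by linarith)

lemma shearSum_eq (H : FibreWeight d R c C₁ Λ ℓ P φ G) (X : Fin m → UnitAddCircle) :
    shearSum (fun w => φ w * G (P w)) X = ∑ v ∈ intBox m (R + 1),
      periodize (fun y => φ (intVec v, y) * G (P (intVec v, y))) (torusPairing v X) := by
  have hfin : (Function.support fun p : (Fin m → ℤ) × ℤ =>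
      φ (intVec p.1, p.2 + ∑ i, (p.1 i : ℝ) * circleRep (X i)) *
      G (P (intVec p.1, p.2 + ∑ i, (p.1 i : ℝ) * circleRep (X i)))).Finite := by
    refine ((intBox m R).finite_toSet.biUnion (t := fun v => (fun k => (v, k)) ''
      {k : ℤ | |k + ∑ i, (v i : ℝ) * circleRep (X i)| ≤ R})
      fun v _ => (finite_int_abs_add_le _ R).image _).subset ?_
    rintro ⟨v, k⟩ hp
    obtain ⟨h1, h2⟩ := H.norm_snd_le_of_weight hp
    rw [norm_intVec] at h1
    exact Set.mem_biUnion (mem_intBox.2 (by exact_mod_cast h1)) ⟨k, h2, rfl⟩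
  rw [shearSum, (summable_of_hasFiniteSupport hfin).tsum_prod, tsum_eq_sum (s := intBox m (R + 1))]
  · refine Finset.sum_congr rfl fun v _ => ?_
    rw [← coe_sum_mul_circleRep, periodize_coe]
  · intro v hv
    rw [mem_intBox, not_le] at hv
    have : (R : ℝ) < ‖intVec v‖ := by
      rw [norm_intVec]
      exact_mod_cast (Nat.lt_succ_self R).trans hv
    simp [H.weight_eq_zero this]

lemma measurable_periodize_weight (H : FibreWeight d R c C₁ Λ ℓ P φ G) (x : Fin m → ℝ) :
    Measurable (periodize fun y => φ (x, y) * G (P (x, y))) :=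
  measurable_periodize (H.contDiff_weight.continuous.comp (Continuous.prodMk_right x)).measurable

lemma integral_periodize_weight (H : FibreWeight d R c C₁ Λ ℓ P φ G) (x : Fin m → ℝ) :
    ∫ θ, periodize (fun y => φ (x, y) * G (P (x, y))) θ = fibreIntegral P φ G x :=
  integral_periodize ((H.contDiff_weight.continuous.comp
    (Continuous.prodMk_right x)).integrable_of_hasCompactSupport
      (hasCompactSupport_fibre H.hasCompactSupport_weight x))

lemma periodize_weight_mem_Icc (H : FibreWeight d R c C₁ Λ ℓ P φ G) {v : Fin m → ℤ}
    (hv : v ≠ 0) (θ) : 0 ≤ periodize (fun y => φ (intVec v, y) * G (P (intVec v, y))) θ ∧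
      periodize (fun y => φ (intVec v, y) * G (P (intVec v, y))) θ ≤ 1 := by
  have h1 : (1 : ℝ) ≤ ‖intVec v‖ := by
    rw [norm_intVec]
    exact_mod_cast one_le_height hv
  refine periodize_mem_Icc (fun y => H.weight_nonneg _) (fun y => H.weight_le_one _)
    (fun y z hy hz => ?_) θ
  have h2 := H.abs_sub_le (norm_pos_iff.1 (zero_lt_one.trans_le h1)) hy hz
  refine h2.trans_lt ?_
  have h3 : ℓ / c < 1 := (div_lt_one H.c_pos).2 H.ℓ_lt
  have h4 : (‖intVec v‖⁻¹) ^ (d - 1) ≤ 1 := pow_le_one₀ (by positivity) (inv_le_one_of_one_le₀ h1)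
  have h5 : 0 ≤ ℓ / c := div_nonneg H.ℓ_pos.le H.c_pos.le
  nlinarith

lemma periodize_weight_zero (H : FibreWeight d R c C₁ Λ ℓ P φ G) (X : Fin m → UnitAddCircle) :
    |periodize (fun y => φ (intVec 0, y) * G (P (intVec 0, y))) (torusPairing 0 X)| ≤ 9 := by
  rw [← coe_sum_mul_circleRep, periodize_coe]
  obtain ⟨h0, h1⟩ := tsum_int_le_nine (f := fun k : ℤ => φ (intVec 0, k + ∑ i,
    (((0 : Fin m → ℤ) i : ℤ) : ℝ) * circleRep (X i)) * G (P (intVec 0, k + ∑ i,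
    (((0 : Fin m → ℤ) i : ℤ) : ℝ) * circleRep (X i)))) (fun k => H.weight_nonneg _)
    (fun k => H.weight_le_one _) (fun k l hk hl => by
      have := H.abs_sub_le_four hk hl
      rw [add_sub_add_right_eq_sub] at this
      exact_mod_cast this)
  rw [abs_of_nonneg h0]
  exact h1

/-- Second moment of the discrepancy of the lattice sum, away from the fibre over `0`. -/
lemma integral_sq_sum_periodize_le (H : FibreWeight d R c C₁ Λ ℓ P φ G) (hdm : d ≤ m) :
    ∫ X, (∑ v ∈ intBoxNeZero m (R + 1),
      (periodize (fun y => φ (intVec v, y) * G (P (intVec v, y))) (torusPairing v X)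
        - fibreIntegral P φ G (intVec v))) ^ 2
      ≤ ℓ / c * (24 * m * 3 ^ (m - 1) * ((R + 1 : ℕ) : ℝ) ^ (m + 1 - d) *
        (1 + Real.log (R + 1 : ℕ))) := by
  have h := integral_sq_sum_torusPairing_le (intBoxNeZero m (R + 1))
    (fun v hv => (mem_intBoxNeZero.1 hv).2)
    (fun v => periodize (fun y => φ (intVec v, y) * G (P (intVec v, y))))
    (fun v _ => H.measurable_periodize_weight _)
    (fun v hv θ => (H.periodize_weight_mem_Icc (mem_intBoxNeZero.1 hv).2 θ).1)
    (fun v hv θ => (H.periodize_weight_mem_Icc (mem_intBoxNeZero.1 hv).2 θ).2)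
  simp only [H.integral_periodize_weight] at h
  refine h.trans ?_
  have h0 : 0 ≤ ℓ / c := div_nonneg H.ℓ_pos.le H.c_pos.le
  refine le_trans ?_ (mul_le_mul_of_nonneg_left (sum_parallel_le H.two_le hdm (R + 1)) h0)
  rw [Finset.mul_sum]
  refine Finset.sum_le_sum fun p hp => ?_
  rw [Finset.mem_filter, Finset.mem_product, mem_intBoxNeZero, mem_intBoxNeZero] at hp
  have hb : ∀ v : Fin m → ℤ, v ≠ 0 →
      fibreIntegral P φ G (intVec v) ≤ ℓ / c * ((height v : ℝ)⁻¹) ^ (d - 1) := by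
    intro v hv
    rw [← norm_intVec]
    refine H.fibreIntegral_le (norm_pos_iff.1 ?_)
    rw [norm_intVec]
    exact_mod_cast one_le_height hv
  rw [mul_min_of_nonneg _ _ h0]
  exact min_le_min (hb _ hp.1.1.2) (hb _ hp.1.2.2)

/-- Chebyshev bound for the discrepancy of the lattice sum. -/
theorem measure_le_abs_shearSum_sub (H : FibreWeight d R c C₁ Λ ℓ P φ G) (hdm : d ≤ m) {t : ℝ}
    (ht : 13 + 4 * (C₁ / c) ^ 2 * Λ / c * ℓ * 2 ^ d * (2 * m * 3 ^ (m - 1)) *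
        ((R + 1 : ℕ) : ℝ) ^ (m - d) * (1 + Real.log (R + 1 : ℕ)) ≤ t) :
    volume {X | 2 * t ≤ |shearSum (fun w => φ w * G (P w)) X - ∫ w, φ w * G (P w)|}
      ≤ ENNReal.ofReal (ℓ / c * (24 * m * 3 ^ (m - 1) * ((R + 1 : ℕ) : ℝ) ^ (m + 1 - d) *
        (1 + Real.log (R + 1 : ℕ))) / t ^ 2) := by
  have hc := H.c_pos
  have hℓ := H.ℓ_pos
  have hΛ := H.one_le_Λ
  have hlog : 0 ≤ Real.log (R + 1 : ℕ) := Real.log_natCast_nonneg _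
  have ht0 : 0 < t := lt_of_lt_of_le (by positivity) ht
  set Y : (Fin m → UnitAddCircle) → ℝ := fun X => ∑ v ∈ intBoxNeZero m (R + 1),
      (periodize (fun y => φ (intVec v, y) * G (P (intVec v, y))) (torusPairing v X)
        - fibreIntegral P φ G (intVec v)) with hY
  have hYm : Measurable Y := Finset.measurable_sum _ fun v _ =>
    ((H.measurable_periodize_weight _).comp (continuous_torusPairing v).measurable).sub_const _
  have hYb : ∀ X, |Y X| ≤ (intBoxNeZero m (R + 1)).card * 5 := by
    intro X
    refine (Finset.abs_sum_le_sum_abs _ _).trans ?_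
    rw [← nsmul_eq_mul]
    refine Finset.sum_le_card_nsmul _ _ _ fun v hv => ?_
    have h1 := H.periodize_weight_mem_Icc (mem_intBoxNeZero.1 hv).2 (torusPairing v X)
    have h2 := H.fibreIntegral_nonneg (intVec v)
    have h3 := H.fibreIntegral_le_four (intVec v)
    exact abs_le.2 ⟨by linarith, by linarith⟩
  have hsub : {X | 2 * t ≤ |shearSum (fun w => φ w * G (P w)) X - ∫ w, φ w * G (P w)|}
      ⊆ {X | t ^ 2 ≤ Y X ^ 2} := by
    intro X hX
    have hsplit : intBox m (R + 1) = insert 0 (intBoxNeZero m (R + 1)) := by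
      ext v
      rw [Finset.mem_insert, mem_intBox, mem_intBoxNeZero]
      by_cases hv : v = 0
      · simp [hv, height_eq_zero_iff.2]
      · simp [hv]
    have h0 : (0 : Fin m → ℤ) ∉ intBoxNeZero m (R + 1) := by simp [mem_intBoxNeZero]
    have h1 := H.abs_sum_fibreIntegral_sub_le hdm
    have h2 := H.periodize_weight_zero X
    have h3 : shearSum (fun w => φ w * G (P w)) X - ∫ w, φ w * G (P w)
        = periodize (fun y => φ (intVec 0, y) * G (P (intVec 0, y))) (torusPairing 0 X) + Y X
          + (∑ v ∈ intBoxNeZero m (R + 1), fibreIntegral P φ G (intVec v)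
            - ∫ w, φ w * G (P w)) := by
      rw [H.shearSum_eq, hsplit, Finset.sum_insert h0, hY]
      simp only [Finset.sum_sub_distrib]
      ring
    rw [Set.mem_ofPred_eq, h3] at hX
    have h4 := abs_add_three (periodize (fun y => φ (intVec 0, y) * G (P (intVec 0, y)))
      (torusPairing 0 X)) (Y X) (∑ v ∈ intBoxNeZero m (R + 1), fibreIntegral P φ G (intVec v)
            - ∫ w, φ w * G (P w))
    rw [Set.mem_ofPred_eq, ← sq_abs (Y X)]
    exact pow_le_pow_left₀ ht0.le (by linarith) 2
  refine (measure_mono hsub).trans ?_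
  have hInt : Integrable fun X => Y X ^ 2 := by
    refine Integrable.of_bound (hYm.pow_const 2).aestronglyMeasurable
      (((intBoxNeZero m (R + 1)).card * 5) ^ 2) (Eventually.of_forall fun X => ?_)
    rw [Real.norm_eq_abs, abs_pow]
    exact pow_le_pow_left₀ (abs_nonneg _) (hYb X) 2
  have := mul_meas_ge_le_integral_of_nonneg (μ := volume)
    (Eventually.of_forall fun X => sq_nonneg (Y X)) hInt (t ^ 2)
  rw [← ENNReal.ofReal_toReal (measure_ne_top volume {X | t ^ 2 ≤ Y X ^ 2})]
  refine ENNReal.ofReal_le_ofReal ?_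
  rw [le_div_iff₀ (by positivity), mul_comm]
  exact this.trans (H.integral_sq_sum_periodize_le hdm)

end FibreWeight

instance (n : ℕ) : IsTopologicalGroup (SLR n) := Matrix.SpecialLinearGroup.topologicalGroup

instance (n : ℕ) : BorelSpace (SLR n) := ⟨rfl⟩

lemma isClosedEmbedding_coe_SLR (n : ℕ) :
    Topology.IsClosedEmbedding fun g : SLR n => (g : Matrix (Fin n) (Fin n) ℝ) :=
  Matrix.SpecialLinearGroup.isClosedEmbedding_val

instance (n : ℕ) : SecondCountableTopology (SLR n) := by
  have : SecondCountableTopology (Matrix (Fin n) (Fin n) ℝ) :=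
    inferInstanceAs (SecondCountableTopology (Fin n → Fin n → ℝ))
  exact (isClosedEmbedding_coe_SLR n).isEmbedding.secondCountableTopology

instance (n : ℕ) : SigmaCompactSpace (SLR n) := by
  have : SigmaCompactSpace (Matrix (Fin n) (Fin n) ℝ) :=
    inferInstanceAs (SigmaCompactSpace (Fin n → Fin n → ℝ))
  exact (isClosedEmbedding_coe_SLR n).sigmaCompactSpace

lemma continuous_coe_SLR (n : ℕ) : Continuous fun g : SLR n => (g : Matrix (Fin n) (Fin n) ℝ) :=
  (isClosedEmbedding_coe_SLR n).continuous

lemma continuous_vecMul_SLR {n : ℕ} (v : Fin n → ℝ) :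
    Continuous fun g : SLR n => v ᵥ* (g : Matrix (Fin n) (Fin n) ℝ) :=
  Continuous.matrix_vecMul continuous_const (continuous_coe_SLR n)

lemma measurable_SLR_of_entries {Ω : Type*} [MeasurableSpace Ω] {n : ℕ} {u : Ω → SLR n}
    (hu : ∀ i k, Measurable fun ω => u ω i k) : Measurable u := by
  have h1 : instMeasurableSpaceSLR n =
      MeasurableSpace.comap (fun (g : SLR n) (i k : Fin n) => g i k) MeasurableSpace.pi := by
    have : (MeasurableSpace.pi : MeasurableSpace (Fin n → Fin n → ℝ)) = borel _ :=
      BorelSpace.measurable_eq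
    rw [this]
    exact borel_comap
  rw [measurable_iff_comap_le, h1, MeasurableSpace.comap_comp, ← measurable_iff_comap_le]
  exact measurable_pi_iff.2 fun i => measurable_pi_iff.2 fun k => hu i k

/-- The unipotent element adding to the `j`-th coordinate the combination, with coefficients `X`,
of the other ones. -/
def shear {m : ℕ} (j : Fin (m + 1)) (X : Fin m → UnitAddCircle) : SLR (m + 1) :=
  ⟨1 + vecMulVec (j.insertNth 0 fun i => circleRep (X i)) (Pi.single j 1), by
    rw [vecMulVec_eq Unit, det_one_add_replicateCol_mul_replicateRow]
    simp⟩

lemma vecMul_shear {m : ℕ} (j : Fin (m + 1)) (X : Fin m → UnitAddCircle) (v : Fin m → ℝ) (y : ℝ) :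
    (j.insertNth y v : Fin (m + 1) → ℝ) ᵥ* (shear j X : Matrix (Fin (m + 1)) (Fin (m + 1)) ℝ)
      = j.insertNth (y + ∑ i, v i * circleRep (X i)) v := by
  change _ ᵥ* (1 + vecMulVec _ _) = _
  rw [vecMul_add, vecMul_one, vecMul_vecMulVec]
  have : (j.insertNth y v : Fin (m + 1) → ℝ) ⬝ᵥ (j.insertNth 0 fun i => circleRep (X i))
      = ∑ i, v i * circleRep (X i) := by
    rw [dotProduct, Fin.sum_univ_succAbove _ j]
    simp
  rw [this]
  ext k
  refine Fin.succAboveCases j ?_ (fun i => ?_) k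
  · simp
  · simp [Fin.succAbove_ne]

lemma shear_mul_row {m : ℕ} (j : Fin (m + 1)) (X : Fin m → UnitAddCircle) (g : SLR (m + 1)) :
    (shear j X * g) j = g j := by
  have h := vecMul_shear j X 0 1
  have h1 : (j.insertNth 1 (0 : Fin m → ℝ) : Fin (m + 1) → ℝ) = Pi.single j 1 := by
    ext k
    refine Fin.succAboveCases j ?_ (fun i => ?_) k
    · simp
    · simp [Fin.succAbove_ne]
  simp only [Pi.zero_apply, zero_mul, Finset.sum_const_zero, add_zero, h1] at h
  have h2 : (Pi.single j 1 : Fin (m + 1) → ℝ) ᵥ* ((shear j X * g : SLR (m + 1)) :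
      Matrix (Fin (m + 1)) (Fin (m + 1)) ℝ) = Pi.single j 1 ᵥ* (g : Matrix _ _ ℝ) := by
    rw [Matrix.SpecialLinearGroup.coe_mul, ← vecMul_vecMul, h]
  rw [single_one_vecMul, single_one_vecMul] at h2
  exact h2

lemma measurable_shear {m : ℕ} (j : Fin (m + 1)) : Measurable (shear (m := m) j) := by
  refine measurable_SLR_of_entries fun i k => ?_
  change Measurable fun X : Fin m → UnitAddCircle => (1 : Matrix (Fin (m + 1)) (Fin (m + 1)) ℝ) i k +
    vecMulVec (j.insertNth 0 fun i => circleRep (X i)) (Pi.single j 1) i k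
  simp only [vecMulVec_apply]
  refine measurable_const.add (Measurable.mul_const ?_ _)
  refine Fin.succAboveCases j ?_ (fun i => ?_) i
  · simp
  · simpa [Function.comp_def] using measurable_circleRep.comp (measurable_pi_apply i)

lemma measure_eq_zero_of_shear {m : ℕ} (μ : Measure (SLR (m + 1))) [μ.IsHaarMeasure]
    (j : Fin (m + 1)) {s : Set (SLR (m + 1))} (hs : MeasurableSet s)
    (h : ∀ g, volume {X | shear j X * g ∈ s} = 0) : μ s = 0 := by
  have hm : Measurable fun p : (Fin m → UnitAddCircle) × SLR (m + 1) => shear j p.1 * p.2 :=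
    ((measurable_shear j).comp measurable_fst).mul measurable_snd
  have hind : Measurable fun p : (Fin m → UnitAddCircle) × SLR (m + 1) =>
      s.indicator (1 : SLR (m + 1) → ENNReal) (shear j p.1 * p.2) :=
    (measurable_one.indicator hs).comp hm
  calc μ s = ∫⁻ _ : Fin m → UnitAddCircle, μ s := by simp
    _ = ∫⁻ X : Fin m → UnitAddCircle, ∫⁻ g, s.indicator 1 (shear j X * g) ∂μ := by
        refine lintegral_congr fun X => ?_
        rw [lintegral_mul_left_eq_self, lintegral_indicator_one hs]
    _ = ∫⁻ g, ∫⁻ X : Fin m → UnitAddCircle, s.indicator 1 (shear j X * g) ∂volume ∂μ :=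
        lintegral_lintegral_swap hind.aemeasurable
    _ = ∫⁻ g, 0 ∂μ := by
        refine lintegral_congr fun g => ?_
        have : (fun X => s.indicator (1 : SLR (m + 1) → ENNReal) (shear j X * g)) =
            {X | shear j X * g ∈ s}.indicator 1 := by
          ext X
          simp [Set.indicator]
        have hsm : MeasurableSet {X | shear j X * g ∈ s} :=
          hm.comp (measurable_id.prodMk measurable_const) hs
        rw [this, lintegral_indicator_one hsm, h g]
    _ = 0 := lintegral_zero

/-- The linear map `(x, y) ↦ v g`, where `v` is obtained by inserting `y` as the `j`-th coordinate
of `x`. -/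
def rowMap {m : ℕ} (j : Fin (m + 1)) (g : SLR (m + 1)) (w : (Fin m → ℝ) × ℝ) : Fin (m + 1) → ℝ :=
  (j.insertNth w.2 w.1 : Fin (m + 1) → ℝ) ᵥ* (g : Matrix (Fin (m + 1)) (Fin (m + 1)) ℝ)

lemma tsum_shear {m : ℕ} (j : Fin (m + 1)) (X : Fin m → UnitAddCircle) (g : SLR (m + 1))
    (f : (Fin (m + 1) → ℝ) → ℝ) :
    ∑' v : Fin (m + 1) → ℤ, f (intVec v ᵥ* ((shear j X * g : SLR (m + 1)) :
      Matrix (Fin (m + 1)) (Fin (m + 1)) ℝ)) = shearSum (fun w => f (rowMap j g w)) X := by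
  rw [shearSum, ← ((Equiv.prodComm _ _).trans
    (Fin.insertNthEquiv (fun _ => ℤ) j)).tsum_eq]
  refine tsum_congr fun p => ?_
  have : intVec ((Equiv.prodComm _ _).trans (Fin.insertNthEquiv (fun _ => ℤ) j) p)
      = (j.insertNth (p.2 : ℝ) (intVec p.1) : Fin (m + 1) → ℝ) := by
    ext k
    refine Fin.succAboveCases j ?_ (fun i => ?_) k
    · simp [intVec]
    · simp [intVec]
  rw [this, Matrix.SpecialLinearGroup.coe_mul, ← vecMul_vecMul, vecMul_shear]
  rfl

lemma measurePreserving_vecMul {n : ℕ} (g : SLR n) :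
    MeasurePreserving (fun v : Fin n → ℝ => v ᵥ* (g : Matrix (Fin n) (Fin n) ℝ)) := by
  have hdet : ((g : Matrix (Fin n) (Fin n) ℝ)ᵀ).det = 1 := by rw [det_transpose]; exact g.2
  have h := Real.map_matrix_volume_pi_eq_smul_volume_pi (M := (g : Matrix (Fin n) (Fin n) ℝ)ᵀ)
    (by rw [hdet]; exact one_ne_zero)
  rw [hdet] at h
  have h2 : (fun v : Fin n → ℝ => v ᵥ* (g : Matrix (Fin n) (Fin n) ℝ))
      = toLin' ((g : Matrix (Fin n) (Fin n) ℝ)ᵀ) := by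
    ext v i
    rw [toLin'_apply, mulVec_transpose]
  refine ⟨(Continuous.matrix_vecMul continuous_id continuous_const).measurable, ?_⟩
  rw [h2, h]
  simp

lemma integral_vecMul {n : ℕ} (g : SLR n) (f : (Fin n → ℝ) → ℝ) :
    ∫ v, f (v ᵥ* (g : Matrix (Fin n) (Fin n) ℝ)) = ∫ x, f x := by
  have hemb : MeasurableEmbedding (fun v : Fin n → ℝ => v ᵥ* (g : Matrix (Fin n) (Fin n) ℝ)) := by
    refine (Continuous.measurableEmbedding
      (Continuous.matrix_vecMul continuous_id continuous_const) fun v w h => ?_)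
    have := congrArg (· ᵥ* ((g⁻¹ : SLR n) : Matrix (Fin n) (Fin n) ℝ)) h
    simp only [vecMul_vecMul, ← Matrix.SpecialLinearGroup.coe_mul, mul_inv_cancel,
      Matrix.SpecialLinearGroup.coe_one, vecMul_one] at this
    exact this
  exact (measurePreserving_vecMul g).integral_comp hemb f

lemma integral_rowMap {m : ℕ} (j : Fin (m + 1)) (g : SLR (m + 1)) (f : (Fin (m + 1) → ℝ) → ℝ) :
    ∫ w, f (rowMap j g w) = ∫ x, f x := by
  rw [← integral_vecMul g f]
  have h := (volume_preserving_piFinSuccAbove (fun _ : Fin (m + 1) => ℝ) j).symm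
  have h2 := (Measure.measurePreserving_swap (μ := (volume : Measure (Fin m → ℝ)))
    (ν := (volume : Measure ℝ)))
  rw [← h.integral_comp (MeasurableEquiv.measurableEmbedding _)
    (fun v => f (v ᵥ* (g : Matrix _ _ ℝ)))]
  exact h2.integral_comp MeasurableEquiv.prodComm.measurableEmbedding
    (fun p : ℝ × (Fin m → ℝ) => f ((j.insertNth p.1 p.2 : Fin (m + 1) → ℝ) ᵥ* (g : Matrix _ _ ℝ)))

section PowerSum

variable {E : Type*} [NormedAddCommGroup E] [NormedSpace ℝ E] {ι : Type*} [Fintype ι]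

lemma hasFDerivAt_powerSum (s : ι → ℝ) (L : ι → E →L[ℝ] ℝ) (d : ℕ) (w : E) :
    HasFDerivAt (fun w => ∑ i, s i * L i w ^ d)
      (∑ i, (s i * (d * L i w ^ (d - 1))) • L i) w := by
  refine HasFDerivAt.fun_sum fun i _ => ?_
  have := (((L i).hasFDerivAt (x := w)).pow d).const_mul (s i)
  refine this.congr_fderiv ?_
  ext v
  simp
  ring

lemma fderiv_powerSum (s : ι → ℝ) (L : ι → E →L[ℝ] ℝ) (d : ℕ) :
    fderiv ℝ (fun w => ∑ i, s i * L i w ^ d)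
      = fun w => ∑ i, (s i * (d * L i w ^ (d - 1))) • L i :=
  funext fun w => (hasFDerivAt_powerSum s L d w).fderiv

lemma contDiff_powerSum (s : ι → ℝ) (L : ι → E →L[ℝ] ℝ) (d : ℕ) (n : WithTop ℕ∞) :
    ContDiff ℝ n fun w => ∑ i, s i * L i w ^ d :=
  ContDiff.sum fun i _ => contDiff_const.mul ((L i).contDiff.pow d)

lemma norm_fderiv_powerSum_le {s : ι → ℝ} (hs : ∀ i, |s i| ≤ 1) {L : ι → E →L[ℝ] ℝ} {a : ℝ}
    (ha : 0 ≤ a) (hL : ∀ i, ‖L i‖ ≤ a) {d : ℕ} (hd : 1 ≤ d) (w : E) :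
    ‖fderiv ℝ (fun w => ∑ i, s i * L i w ^ d) w‖
      ≤ Fintype.card ι * (d * a ^ d) * ‖w‖ ^ (d - 1) := by
  rw [fderiv_powerSum]
  refine (norm_sum_le _ _).trans ((Finset.sum_le_card_nsmul _ _ (d * a ^ d * ‖w‖ ^ (d - 1))
    fun i _ => ?_).trans (le_of_eq ?_))
  · have h1 : |L i w| ≤ a * ‖w‖ := (L i).le_of_opNorm_le (hL i) w
    rw [norm_smul, Real.norm_eq_abs, abs_mul, abs_mul, abs_pow, Nat.abs_cast]
    calc |s i| * (d * |L i w| ^ (d - 1)) * ‖L i‖ ≤ 1 * (d * (a * ‖w‖) ^ (d - 1)) * a := by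
          gcongr
          · exact hs i
          · exact hL i
      _ = d * a ^ d * ‖w‖ ^ (d - 1) := by
          obtain ⟨e, rfl⟩ := Nat.exists_eq_add_of_le' hd
          simp only [Nat.add_sub_cancel]
          ring
  · rw [nsmul_eq_mul, Finset.card_univ]
    ring

lemma norm_fderiv_fderiv_powerSum_le {s : ι → ℝ} (hs : ∀ i, |s i| ≤ 1) {L : ι → E →L[ℝ] ℝ} {a : ℝ}
    (ha : 0 ≤ a) (hL : ∀ i, ‖L i‖ ≤ a) {d : ℕ} (hd : 2 ≤ d) (w : E) :
    ‖fderiv ℝ (fderiv ℝ (fun w => ∑ i, s i * L i w ^ d)) w‖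
      ≤ Fintype.card ι * (d * d * a ^ d) * ‖w‖ ^ (d - 2) := by
  rw [fderiv_powerSum]
  have h : HasFDerivAt (fun w => ∑ i, (s i * (d * L i w ^ (d - 1))) • L i)
      (∑ i, ((s i * (d * ((d - 1 : ℕ) * L i w ^ (d - 2)))) • L i).smulRight (L i)) w := by
    refine HasFDerivAt.fun_sum fun i _ => ?_
    have := (((((L i).hasFDerivAt (x := w)).pow (d - 1)).const_mul (d : ℝ)).const_mul
      (s i)).smul_const (L i)
    refine this.congr_fderiv ?_
    ext v u
    simp only [Nat.sub_sub, Nat.reduceAdd, ContinuousLinearMap.smulRight_apply, nsmul_eq_mul,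
      _root_.smul_apply, smul_eq_mul]
    ring
  rw [h.fderiv]
  have hn := norm_sum_le (E := E →L[ℝ] E →L[ℝ] ℝ) (Finset.univ : Finset ι)
    fun i => ((s i * (d * ((d - 1 : ℕ) * L i w ^ (d - 2)))) • L i).smulRight (L i)
  refine hn.trans ?_
  refine (Finset.sum_le_card_nsmul (Finset.univ : Finset ι) _ (d * d * a ^ d * ‖w‖ ^ (d - 2))
    fun i _ => ?_).trans (le_of_eq ?_)
  · have h1 : |L i w| ≤ a * ‖w‖ := (L i).le_of_opNorm_le (hL i) w
    have h2 : ((d - 1 : ℕ) : ℝ) ≤ d := by exact_mod_cast Nat.sub_le d 1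
    rw [ContinuousLinearMap.norm_smulRight_apply, norm_smul, Real.norm_eq_abs, abs_mul, abs_mul,
      abs_mul, abs_pow, Nat.abs_cast, Nat.abs_cast]
    calc |s i| * (d * ((d - 1 : ℕ) * |L i w| ^ (d - 2))) * ‖L i‖ * ‖L i‖
        ≤ 1 * (d * (d * (a * ‖w‖) ^ (d - 2))) * a * a := by
          gcongr
          · exact hs i
          · exact hL i
          · exact hL i
      _ = d * d * a ^ d * ‖w‖ ^ (d - 2) := by
          obtain ⟨e, rfl⟩ := Nat.exists_eq_add_of_le' hd
          simp only [Nat.add_sub_cancel]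
          ring
  · rw [nsmul_eq_mul, Finset.card_univ]
    ring

end PowerSum

section Transition

open Real in
lemma exists_deriv_smoothTransition_le :
    ∃ B : ℝ, 0 ≤ B ∧ ∀ x, |deriv smoothTransition x| ≤ B ∧
      (deriv smoothTransition x ≠ 0 → 0 ≤ x ∧ x ≤ 1) := by
  have hz : ∀ x, deriv smoothTransition x ≠ 0 → 0 ≤ x ∧ x ≤ 1 := by
    intro x hx
    constructor
    · by_contra! h
      refine hx ?_
      have : smoothTransition =ᶠ[nhds x] fun _ => 0 := by
        filter_upwards [eventually_lt_nhds h] with y hy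
        exact smoothTransition.zero_of_nonpos hy.le
      rw [this.deriv_eq, deriv_const]
    · by_contra! h
      refine hx ?_
      have : smoothTransition =ᶠ[nhds x] fun _ => 1 := by
        filter_upwards [eventually_gt_nhds h] with y hy
        exact smoothTransition.one_of_one_le hy.le
      rw [this.deriv_eq, deriv_const]
  have hc : Continuous (deriv smoothTransition) :=
    (smoothTransition.contDiff (n := 1)).continuous_deriv le_rfl
  obtain ⟨B, hB⟩ := (isCompact_Icc (a := (0 : ℝ)) (b := 1)).exists_bound_of_continuousOn
    hc.continuousOn
  refine ⟨max B 0, le_max_right _ _, fun x => ⟨?_, hz x⟩⟩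
  by_cases h : deriv smoothTransition x = 0
  · rw [h, abs_zero]
    exact le_max_right _ _
  · exact (hB x (hz x h)).trans (le_max_left _ _)

/-- A smooth function with values in `[0, 1]`, positive exactly on `(A, B)` and equal to `1` on
`[A + s, B - s]`. -/
def ramp (A B s x : ℝ) : ℝ :=
  Real.smoothTransition ((x - A) / s) * Real.smoothTransition ((B - x) / s)

lemma contDiff_ramp (A B s : ℝ) : ContDiff ℝ 1 (ramp A B s) :=
  (Real.smoothTransition.contDiff.comp ((contDiff_id.sub contDiff_const).div_const s)).mul
    (Real.smoothTransition.contDiff.comp ((contDiff_const.sub contDiff_id).div_const s))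

lemma ramp_nonneg (A B s x : ℝ) : 0 ≤ ramp A B s x :=
  mul_nonneg (Real.smoothTransition.nonneg _) (Real.smoothTransition.nonneg _)

lemma ramp_le_one (A B s x : ℝ) : ramp A B s x ≤ 1 :=
  mul_le_one₀ (Real.smoothTransition.le_one _) (Real.smoothTransition.nonneg _)
    (Real.smoothTransition.le_one _)

lemma ramp_ne_zero {A B s x : ℝ} (hs : 0 < s) (h : ramp A B s x ≠ 0) : A < x ∧ x < B := by
  have h1 := left_ne_zero_of_mul h
  have h2 := right_ne_zero_of_mul h
  constructor
  · by_contra! hx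
    exact h1 (Real.smoothTransition.zero_of_nonpos (div_nonpos_of_nonpos_of_nonneg
      (by linarith) hs.le))
  · by_contra! hx
    exact h2 (Real.smoothTransition.zero_of_nonpos (div_nonpos_of_nonpos_of_nonneg
      (by linarith) hs.le))

lemma ramp_eq_one {A B s x : ℝ} (hs : 0 < s) (hA : A + s ≤ x) (hB : x ≤ B - s) :
    ramp A B s x = 1 := by
  rw [ramp, Real.smoothTransition.one_of_one_le ((one_le_div hs).2 (by linarith)),
    Real.smoothTransition.one_of_one_le ((one_le_div hs).2 (by linarith)), one_mul]

/-- The integer translates of this bump function form a partition of unity. -/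
def bump (u : ℝ) : ℝ := Real.smoothTransition (u + 1) - Real.smoothTransition u

lemma contDiff_bump : ContDiff ℝ 1 bump :=
  (Real.smoothTransition.contDiff.comp (contDiff_id.add contDiff_const)).sub
    Real.smoothTransition.contDiff

lemma bump_nonneg (u : ℝ) : 0 ≤ bump u := by
  rw [bump]
  rcases le_total u 0 with h | h
  · rw [Real.smoothTransition.zero_of_nonpos h, sub_zero]
    exact Real.smoothTransition.nonneg _
  · rw [Real.smoothTransition.one_of_one_le (by linarith : 1 ≤ u + 1)]
    linarith [Real.smoothTransition.le_one u]

lemma bump_le_one (u : ℝ) : bump u ≤ 1 := by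
  rw [bump]
  linarith [Real.smoothTransition.le_one (u + 1), Real.smoothTransition.nonneg u]

lemma bump_ne_zero {u : ℝ} (h : bump u ≠ 0) : |u| ≤ 1 := by
  rw [abs_le]
  constructor
  · by_contra! hu
    refine h ?_
    rw [bump, Real.smoothTransition.zero_of_nonpos (by linarith),
      Real.smoothTransition.zero_of_nonpos (by linarith), sub_zero]
  · by_contra! hu
    refine h ?_
    rw [bump, Real.smoothTransition.one_of_one_le (by linarith),
      Real.smoothTransition.one_of_one_le (by linarith), sub_self]

lemma sum_bump (N : ℕ) {u : ℝ} (hu : |u| ≤ N) :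
    ∑ k ∈ Finset.Icc (-N : ℤ) N, bump (u - k) = 1 := by
  rw [abs_le] at hu
  have h : ∀ n : ℕ, ∑ k ∈ Finset.range n, bump (u - ((k : ℤ) - N : ℤ))
      = Real.smoothTransition (u + N + 1) - Real.smoothTransition (u + N + 1 - n) := by
    intro n
    induction n with
    | zero => simp
    | succ n ih =>
      rw [Finset.sum_range_succ, ih, bump]
      push_cast
      ring_nf
  have h2 := h (2 * N + 1)
  have h3 : ∑ k ∈ Finset.Icc (-N : ℤ) N, bump (u - k)
      = ∑ k ∈ Finset.range (2 * N + 1), bump (u - ((k : ℤ) - N : ℤ)) := by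
    symm
    refine Finset.sum_bij (fun (k : ℕ) _ => (k : ℤ) - N) ?_ ?_ ?_ ?_
    · intro k hk
      rw [Finset.mem_range] at hk
      rw [Finset.mem_Icc]
      omega
    · intro k _ l _ hkl
      omega
    · intro k hk
      rw [Finset.mem_Icc] at hk
      refine ⟨(k + N).toNat, ?_, ?_⟩
      · rw [Finset.mem_range]
        omega
      · omega
    · intro k _
      rfl
  rw [h3, h2, Real.smoothTransition.one_of_one_le (by linarith),
    Real.smoothTransition.zero_of_nonpos (by push_cast; linarith), sub_zero]

end Transition

section ConeSmooth

variable {E : Type*} [NormedAddCommGroup E] [NormedSpace ℝ E]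

/-- A function with values in `[0, 1]` which is `C¹` away from the origin, with derivative
`O(‖x‖⁻¹)`. -/
structure ConeSmooth (f : E → ℝ) (B : ℝ) : Prop where
  contDiffAt : ∀ x ≠ 0, ContDiffAt ℝ 1 f x
  nonneg : ∀ x, 0 ≤ f x
  le_one : ∀ x, f x ≤ 1
  bound : ∀ x ≠ 0, ‖x‖ * ‖fderiv ℝ f x‖ ≤ B

lemma ConeSmooth.mul {f g : E → ℝ} {B B' : ℝ} (hf : ConeSmooth f B) (hg : ConeSmooth g B') :
    ConeSmooth (fun x => f x * g x) (B + B') where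
  contDiffAt x hx := (hf.contDiffAt x hx).mul (hg.contDiffAt x hx)
  nonneg x := mul_nonneg (hf.nonneg x) (hg.nonneg x)
  le_one x := mul_le_one₀ (hf.le_one x) (hg.nonneg x) (hg.le_one x)
  bound x hx := by
    rw [fderiv_fun_mul ((hf.contDiffAt x hx).differentiableAt (by norm_num))
      ((hg.contDiffAt x hx).differentiableAt (by norm_num))]
    have h1 := norm_add_le (f x • fderiv ℝ g x) (g x • fderiv ℝ f x)
    rw [norm_smul, norm_smul, Real.norm_of_nonneg (hf.nonneg x),
      Real.norm_of_nonneg (hg.nonneg x)] at h1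
    have h2 := mul_le_of_le_one_left (norm_nonneg (fderiv ℝ g x)) (hf.le_one x)
    have h3 := mul_le_of_le_one_left (norm_nonneg (fderiv ℝ f x)) (hg.le_one x)
    have h4 := mul_le_mul_of_nonneg_left (h1.trans (add_le_add h2 h3)) (norm_nonneg x)
    have h5 := hf.bound x hx
    have h6 := hg.bound x hx
    linarith

lemma exists_coneSmooth_of_homogeneous [FiniteDimensional ℝ E] {f : E → ℝ}
    (h1 : ∀ x ≠ 0, ContDiffAt ℝ 1 f x) (h0 : ∀ x, 0 ≤ f x) (h2 : ∀ x, f x ≤ 1)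
    (hf : ∀ (a : ℝ) (x : E), 0 < a → f (a • x) = f x) : ∃ B, ConeSmooth f B := by
  have hcont : ContinuousOn (fderiv ℝ f) (Metric.sphere 0 1) := by
    intro x hx
    have hx0 : x ≠ 0 := ne_zero_of_mem_unit_sphere ⟨x, hx⟩
    exact ((h1 x hx0).fderiv_right (m := 0) (by norm_num)).continuousAt.continuousWithinAt
  have : ProperSpace E := FiniteDimensional.proper ℝ E
  obtain ⟨B, hB⟩ := (isCompact_sphere (0 : E) 1).exists_bound_of_continuousOn hcont
  refine ⟨B, h1, h0, h2, fun x hx => ?_⟩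
  have hx' : 0 < ‖x‖ := norm_pos_iff.2 hx
  have h3 := hB (‖x‖⁻¹ • x) (by simp [norm_smul, hx'.ne'])
  have h4 : f = fun y => f (‖x‖⁻¹ • y) := funext fun y => (hf _ y (inv_pos.2 hx')).symm
  have h5 : fderiv ℝ f x = ‖x‖⁻¹ • fderiv ℝ f (‖x‖⁻¹ • x) := by
    conv_lhs => rw [h4]
    exact fderiv_comp_smul _
  rw [h5, norm_smul, norm_inv, norm_norm, ← mul_assoc, mul_inv_cancel₀ hx'.ne', one_mul]
  exact h3

lemma ConeSmooth.smoothTransition {u : E → ℝ} (hu : ContDiff ℝ 1 u) {D B : ℝ}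
    (hB : 0 ≤ B) (hD : ∀ x, |deriv Real.smoothTransition x| ≤ D)
    (h : ∀ x, 0 ≤ u x → u x ≤ 1 → ‖x‖ * ‖fderiv ℝ u x‖ ≤ B) :
    ConeSmooth (fun x => Real.smoothTransition (u x)) (D * B) where
  contDiffAt x _ := Real.smoothTransition.contDiff.contDiffAt.comp x hu.contDiffAt
  nonneg x := Real.smoothTransition.nonneg _
  le_one x := Real.smoothTransition.le_one _
  bound x _ := by
    have h1 : fderiv ℝ (fun x => Real.smoothTransition (u x)) x
        = deriv Real.smoothTransition (u x) • fderiv ℝ u x :=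
      ((Real.smoothTransition.contDiff (n := 1)).differentiable (by norm_num)
        (u x)).hasDerivAt.comp_hasFDerivAt x
        (hu.differentiable (by norm_num) x).hasFDerivAt |>.fderiv
    have hD0 : 0 ≤ D := (abs_nonneg _).trans (hD 0)
    rw [h1, norm_smul, Real.norm_eq_abs]
    by_cases h2 : deriv Real.smoothTransition (u x) = 0
    · rw [h2, abs_zero, zero_mul, mul_zero]
      positivity
    · obtain ⟨_, _, h3⟩ := exists_deriv_smoothTransition_le
      obtain ⟨h4, h5⟩ := (h3 _).2 h2
      calc ‖x‖ * (|deriv Real.smoothTransition (u x)| * ‖fderiv ℝ u x‖)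
          = |deriv Real.smoothTransition (u x)| * (‖x‖ * ‖fderiv ℝ u x‖) := by ring
        _ ≤ D * B := mul_le_mul (hD _) (h x h4 h5) (by positivity) hD0

end ConeSmooth

/-- The square of the Euclidean norm. -/
def sqNorm {n : ℕ} (x : Fin n → ℝ) : ℝ := ∑ i, x i ^ 2

lemma sqNorm_nonneg {n : ℕ} (x : Fin n → ℝ) : 0 ≤ sqNorm x :=
  Finset.sum_nonneg fun _ _ => sq_nonneg _

lemma sq_le_sqNorm {n : ℕ} (x : Fin n → ℝ) (i : Fin n) : x i ^ 2 ≤ sqNorm x :=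
  Finset.single_le_sum (f := fun i => x i ^ 2) (fun _ _ => sq_nonneg _) (Finset.mem_univ i)

lemma abs_le_sqrt_sqNorm {n : ℕ} (x : Fin n → ℝ) (i : Fin n) : |x i| ≤ √(sqNorm x) :=
  Real.abs_le_sqrt (sq_le_sqNorm x i)

lemma norm_le_sqrt_sqNorm {n : ℕ} (x : Fin n → ℝ) : ‖x‖ ≤ √(sqNorm x) :=
  (pi_norm_le_iff_of_nonneg (Real.sqrt_nonneg _)).2 fun i => abs_le_sqrt_sqNorm x i

lemma sq_norm_le_sqNorm {n : ℕ} (x : Fin n → ℝ) : ‖x‖ ^ 2 ≤ sqNorm x := by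
  rw [← Real.sq_sqrt (sqNorm_nonneg x)]
  exact pow_le_pow_left₀ (norm_nonneg _) (norm_le_sqrt_sqNorm x) 2

lemma sqNorm_le {n : ℕ} (x : Fin n → ℝ) : sqNorm x ≤ n * ‖x‖ ^ 2 := by
  refine (Finset.sum_le_card_nsmul Finset.univ _ (‖x‖ ^ 2) fun i _ => ?_).trans (le_of_eq (by simp))
  rw [← sq_abs]
  exact pow_le_pow_left₀ (abs_nonneg _) (norm_le_pi_norm x i) 2

lemma sqNorm_pos {n : ℕ} {x : Fin n → ℝ} (hx : x ≠ 0) : 0 < sqNorm x :=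
  lt_of_lt_of_le (pow_pos (norm_pos_iff.2 hx) 2) (sq_norm_le_sqNorm x)

lemma sqNorm_smul {n : ℕ} (a : ℝ) (x : Fin n → ℝ) : sqNorm (a • x) = a ^ 2 * sqNorm x := by
  simp [sqNorm, mul_pow, Finset.mul_sum]

lemma sqNorm_eq_powerSum {n : ℕ} : (sqNorm : (Fin n → ℝ) → ℝ) = fun x =>
    ∑ i, (1 : ℝ) * ContinuousLinearMap.proj (R := ℝ) (φ := fun _ : Fin n => ℝ) i x ^ 2 := by
  ext x
  simp [sqNorm]

lemma contDiff_sqNorm {n : ℕ} : ContDiff ℝ 1 (sqNorm : (Fin n → ℝ) → ℝ) := by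
  rw [sqNorm_eq_powerSum]
  exact contDiff_powerSum _ _ _ _

lemma norm_proj_le (n : ℕ) (i : Fin n) :
    ‖ContinuousLinearMap.proj (R := ℝ) (φ := fun _ : Fin n => ℝ) i‖ ≤ 1 :=
  ContinuousLinearMap.opNorm_le_bound _ zero_le_one fun x => by
    rw [one_mul]
    exact norm_le_pi_norm x i

lemma norm_fderiv_sqNorm_le {n : ℕ} (x : Fin n → ℝ) :
    ‖fderiv ℝ sqNorm x‖ ≤ 2 * n * ‖x‖ := by
  rw [sqNorm_eq_powerSum]
  refine (norm_fderiv_powerSum_le (fun _ => by norm_num) zero_le_one (norm_proj_le n)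
    (by norm_num) x).trans (le_of_eq ?_)
  rw [Fintype.card_fin, show 2 - 1 = 1 from rfl]
  push_cast
  ring

/-- Matrices with entries bounded by `r` that contract Euclidean norms by at most `r`. -/
def BoundedMatrix {n : ℕ} (r : ℝ) (h : Matrix (Fin n) (Fin n) ℝ) : Prop :=
  (∀ a b, |h a b| ≤ r) ∧ ∀ x, sqNorm x ≤ r ^ 2 * sqNorm (x ᵥ* h)

lemma sqNorm_vecMul_eq_powerSum {n : ℕ} (h : Matrix (Fin n) (Fin n) ℝ) :
    (fun x => sqNorm (x ᵥ* h)) = fun x => ∑ i, (1 : ℝ) *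
      (∑ a, h a i • ContinuousLinearMap.proj (R := ℝ) (φ := fun _ : Fin n => ℝ) a) x ^ 2 := by
  ext x
  simp [sqNorm, vecMul, dotProduct, mul_comm]

lemma contDiff_sqNorm_vecMul {n : ℕ} (h : Matrix (Fin n) (Fin n) ℝ) :
    ContDiff ℝ 1 fun x => sqNorm (x ᵥ* h) := by
  rw [sqNorm_vecMul_eq_powerSum]
  exact contDiff_powerSum _ _ _ _

lemma norm_fderiv_sqNorm_vecMul_le {n : ℕ} {r : ℝ} (hr : 0 ≤ r) {h : Matrix (Fin n) (Fin n) ℝ}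
    (hh : ∀ a b, |h a b| ≤ r) (x : Fin n → ℝ) :
    ‖fderiv ℝ (fun x => sqNorm (x ᵥ* h)) x‖ ≤ 2 * n * (n * r) ^ 2 * ‖x‖ := by
  rw [sqNorm_vecMul_eq_powerSum]
  refine (norm_fderiv_powerSum_le (a := n * r) (fun _ => by norm_num) (by positivity)
    (fun i => ?_) (by norm_num) x).trans (le_of_eq ?_)
  · refine (norm_sum_le _ _).trans ((Finset.sum_le_card_nsmul _ _ r fun a _ => ?_).trans
      (le_of_eq (by simp)))
    rw [norm_smul, Real.norm_eq_abs]
    exact (mul_le_of_le_one_right (abs_nonneg _) (norm_proj_le n a)).trans (hh a i)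
  · rw [Fintype.card_fin, show 2 - 1 = 1 from rfl]
    push_cast
    ring

/-- A smooth cutoff to the cone over a small box centred at `k / N`. -/
def coneCutoff {n : ℕ} (N : ℕ) (k : Fin n → ℤ) (x : Fin n → ℝ) : ℝ :=
  ∏ i, bump (N * (x i / √(sqNorm x)) - k i)

lemma coneCutoff_nonneg {n : ℕ} (N : ℕ) (k : Fin n → ℤ) (x : Fin n → ℝ) : 0 ≤ coneCutoff N k x :=
  Finset.prod_nonneg fun _ _ => bump_nonneg _

lemma coneCutoff_le_one {n : ℕ} (N : ℕ) (k : Fin n → ℤ) (x : Fin n → ℝ) : coneCutoff N k x ≤ 1 :=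
  Finset.prod_le_one (fun _ _ => bump_nonneg _) fun _ _ => bump_le_one _

lemma abs_div_sqrt_sqNorm_le {n : ℕ} (x : Fin n → ℝ) (i : Fin n) : |x i / √(sqNorm x)| ≤ 1 := by
  rw [abs_div, abs_of_nonneg (Real.sqrt_nonneg _)]
  exact div_le_one_of_le₀ (abs_le_sqrt_sqNorm x i) (Real.sqrt_nonneg _)

/-- Index set of the cones covering the sphere. -/
def coneIndex (n N : ℕ) : Finset (Fin n → ℤ) := Fintype.piFinset fun _ => Finset.Icc (-N : ℤ) N

lemma sum_coneCutoff {n : ℕ} (N : ℕ) (x : Fin n → ℝ) :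
    ∑ k ∈ coneIndex n N, coneCutoff N k x = 1 := by
  simp only [coneCutoff, coneIndex]
  rw [← Finset.prod_univ_sum (fun _ : Fin n => Finset.Icc (-N : ℤ) N)
    fun (i : Fin n) (k : ℤ) => bump (N * (x i / √(sqNorm x)) - k)]
  refine Finset.prod_eq_one fun i _ => sum_bump N ?_
  rw [abs_mul, Nat.abs_cast]
  exact mul_le_of_le_one_right (Nat.cast_nonneg _) (abs_div_sqrt_sqNorm_le x i)

lemma exists_coneSmooth_coneCutoff {n : ℕ} (N : ℕ) (k : Fin n → ℤ) :
    ∃ B, ConeSmooth (coneCutoff N k) B := by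
  refine exists_coneSmooth_of_homogeneous (fun x hx => ?_) (coneCutoff_nonneg N k)
    (coneCutoff_le_one N k) fun a x ha => ?_
  · have h1 : ContDiffAt ℝ 1 (fun x : Fin n → ℝ => √(sqNorm x)) x :=
      contDiff_sqNorm.contDiffAt.sqrt (sqNorm_pos hx).ne'
    refine contDiffAt_prod fun i _ => contDiff_bump.contDiffAt.comp x ?_
    refine (contDiffAt_const.mul (ContDiffAt.div ?_ h1 ?_)).sub contDiffAt_const
    · exact (contDiff_apply ℝ ℝ i).contDiffAt
    · exact (Real.sqrt_pos.2 (sqNorm_pos hx)).ne'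
  · unfold coneCutoff
    refine Finset.prod_congr rfl fun i _ => ?_
    rw [sqNorm_smul, Real.sqrt_mul (sq_nonneg a), Real.sqrt_sq ha.le, Pi.smul_apply, smul_eq_mul,
      mul_div_mul_left _ _ ha.ne']

/-- The part of the counting weight not depending on the form. -/
def coneWeight {n : ℕ} (N : ℕ) (k : Fin n → ℤ) (h : Matrix (Fin n) (Fin n) ℝ) (K T e : ℝ)
    (x : Fin n → ℝ) : ℝ :=
  coneCutoff N k x * (Real.smoothTransition (sqNorm x - 1) *
    Real.smoothTransition (K * (1 - sqNorm (x ᵥ* h) / T ^ 2) + e))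

lemma coneWeight_ne_zero {n : ℕ} {N : ℕ} {k : Fin n → ℤ} {h : Matrix (Fin n) (Fin n) ℝ}
    {K T e : ℝ} (hT : 0 < T) {x : Fin n → ℝ} (hx : coneWeight N k h K T e x ≠ 0) :
    (∀ i, |N * (x i / √(sqNorm x)) - k i| ≤ 1) ∧ 1 < sqNorm x ∧
      K * sqNorm (x ᵥ* h) < T ^ 2 * (K + e) := by
  have h1 := left_ne_zero_of_mul hx
  have h2 := left_ne_zero_of_mul (right_ne_zero_of_mul hx)
  have h3 := right_ne_zero_of_mul (right_ne_zero_of_mul hx)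
  refine ⟨fun i => bump_ne_zero (Finset.prod_ne_zero_iff.1 h1 i (Finset.mem_univ i)), ?_, ?_⟩
  · by_contra! h
    exact h2 (Real.smoothTransition.zero_of_nonpos (by linarith))
  · by_contra! h4
    refine h3 (Real.smoothTransition.zero_of_nonpos ?_)
    have : K * (1 - sqNorm (x ᵥ* h) / T ^ 2) + e = (T ^ 2 * (K + e) - K * sqNorm (x ᵥ* h)) / T ^ 2 := by
      field_simp
      ring
    rw [this]
    exact div_nonpos_of_nonpos_of_nonneg (by linarith) (by positivity)

lemma exists_coneSmooth_coneWeight {n : ℕ} (N : ℕ) (k : Fin n → ℤ) {r : ℝ} (hr : 0 ≤ r) (e : ℝ) :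
    ∃ C, 1 ≤ C ∧ ∀ K T h, 1 ≤ K → 0 < T → BoundedMatrix r h →
      ConeSmooth (coneWeight N k h K T e) (C * K) := by
  obtain ⟨B, hB⟩ := exists_coneSmooth_coneCutoff N k
  obtain ⟨D, hD0, hD⟩ := exists_deriv_smoothTransition_le
  refine ⟨max 1 (|B| + (D * (4 * n) + D * (2 * n * (n * r) ^ 2 * (r ^ 2 * (1 + |e|))))),
    le_max_left _ _, fun K T h hK hT hh => ?_⟩
  have h1 : ConeSmooth (fun x : Fin n → ℝ => Real.smoothTransition (sqNorm x - 1)) (D * (4 * n)) := by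
    refine ConeSmooth.smoothTransition (contDiff_sqNorm.sub contDiff_const) (by positivity)
      (fun x => (hD x).1) fun x _ hx => ?_
    rw [fderiv_sub_const]
    have h2 := sq_norm_le_sqNorm x
    calc ‖x‖ * ‖fderiv ℝ sqNorm x‖ ≤ ‖x‖ * (2 * n * ‖x‖) := by
          gcongr
          exact norm_fderiv_sqNorm_le x
      _ = 2 * n * ‖x‖ ^ 2 := by ring
      _ ≤ 2 * n * 2 := by
          gcongr
          linarith
      _ = 4 * n := by ring
  have h2 : ConeSmooth (fun x : Fin n → ℝ => Real.smoothTransition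
      (K * (1 - sqNorm (x ᵥ* h) / T ^ 2) + e))
      (D * (K * (2 * n * (n * r) ^ 2 * (r ^ 2 * (1 + |e|))))) := by
    have hK0 : 0 < K := by linarith
    have hcd := contDiff_sqNorm_vecMul h
    refine ConeSmooth.smoothTransition ((contDiff_const.mul
      (contDiff_const.sub (hcd.div_const _))).add contDiff_const) (by positivity)
      (fun x => (hD x).1) fun x hx _ => ?_
    have h3 : fderiv ℝ (fun x => K * (1 - sqNorm (x ᵥ* h) / T ^ 2) + e) x
        = (-(K / T ^ 2)) • fderiv ℝ (fun x => sqNorm (x ᵥ* h)) x := by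
      have : (fun x => K * (1 - sqNorm (x ᵥ* h) / T ^ 2) + e)
          = fun x => (-(K / T ^ 2)) • sqNorm (x ᵥ* h) + (K + e) := by
        ext x
        rw [smul_eq_mul]
        ring
      rw [this, fderiv_add_const, fderiv_fun_const_smul (hcd.differentiable (by norm_num) x)]
    have h4 := norm_fderiv_sqNorm_vecMul_le hr hh.1 x
    have h5 : ‖x‖ ^ 2 ≤ r ^ 2 * (T ^ 2 * (1 + |e|)) := by
      refine (sq_norm_le_sqNorm x).trans ((hh.2 x).trans ?_)
      gcongr
      have h6 : e ≤ K * |e| := (le_abs_self e).trans (le_mul_of_one_le_left (abs_nonneg _) hK)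
      have h7 : 0 ≤ K * (1 - sqNorm (x ᵥ* h) / T ^ 2 + |e|) := by linarith
      have h8 := nonneg_of_mul_nonneg_right h7 hK0
      have h9 : sqNorm (x ᵥ* h) / T ^ 2 ≤ 1 + |e| := by linarith
      rw [div_le_iff₀ (by positivity)] at h9
      linarith
    rw [h3, norm_smul, norm_neg, Real.norm_of_nonneg (by positivity)]
    calc ‖x‖ * (K / T ^ 2 * ‖fderiv ℝ (fun x => sqNorm (x ᵥ* h)) x‖)
        ≤ ‖x‖ * (K / T ^ 2 * (2 * n * (n * r) ^ 2 * ‖x‖)) := by gcongr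
      _ = K / T ^ 2 * (2 * n * (n * r) ^ 2) * ‖x‖ ^ 2 := by ring
      _ ≤ K / T ^ 2 * (2 * n * (n * r) ^ 2) * (r ^ 2 * (T ^ 2 * (1 + |e|))) := by gcongr
      _ = K * (2 * n * (n * r) ^ 2 * (r ^ 2 * (1 + |e|))) := by
          field_simp
  have h3 := hB.mul (h1.mul h2)
  refine ⟨h3.contDiffAt, h3.nonneg, h3.le_one, fun x hx => (h3.bound x hx).trans ?_⟩
  have h4 : B ≤ |B| * K := (le_abs_self B).trans (le_mul_of_one_le_right (abs_nonneg _) hK)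
  have h5 : D * (4 * n) ≤ D * (4 * n) * K := le_mul_of_one_le_right (by positivity) hK
  have h6 := mul_le_mul_of_nonneg_right (le_max_right 1 (|B| + (D * (4 * n) +
    D * (2 * n * (n * r) ^ 2 * (r ^ 2 * (1 + |e|)))))) (by linarith : 0 ≤ K)
  linarith

lemma contDiff_coneWeight {n : ℕ} {N : ℕ} {k : Fin n → ℤ} {h : Matrix (Fin n) (Fin n) ℝ}
    {K T e B : ℝ} (H : ConeSmooth (coneWeight N k h K T e) B) :
    ContDiff ℝ 1 (coneWeight N k h K T e) := by
  rw [contDiff_iff_contDiffAt]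
  intro x
  by_cases hx : x = 0
  · have : coneWeight N k h K T e =ᶠ[nhds x] fun _ => 0 := by
      have h1 : ∀ᶠ y in nhds x, sqNorm y < 1 := by
        refine contDiff_sqNorm.continuous.continuousAt.eventually_lt continuousAt_const ?_
        simp [hx, sqNorm]
      filter_upwards [h1] with y hy
      rw [coneWeight, Real.smoothTransition.zero_of_nonpos (x := sqNorm y - 1) (by linarith),
        zero_mul, mul_zero]
    exact contDiffAt_const.congr_of_eventuallyEq this
  · exact H.contDiffAt x hx

/-- The diagonal form `∑ s_i x_i^d`. -/
def signForm {n : ℕ} (s : Fin n → ℝ) (d : ℕ) (x : Fin n → ℝ) : ℝ := ∑ i, s i * x i ^ d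

/-- The derivative of `signForm s d` in the direction `a` is, up to the sign `ε`, at least `1 / r`
on the box of points `b` with `N b` close to `k`. -/
def GoodRow {n : ℕ} (s : Fin n → ℝ) (d N : ℕ) (k : Fin n → ℤ) (ε r : ℝ) (a : Fin n → ℝ) : Prop :=
  ∀ b : Fin n → ℝ, (∀ i, |N * b i - k i| ≤ 1) →
    1 ≤ r * (ε * ∑ i, s i * (d * b i ^ (d - 1)) * a i)

lemma exists_rowMap_equiv {m : ℕ} (j : Fin (m + 1)) (g : SLR (m + 1)) :
    ∃ L : ((Fin m → ℝ) × ℝ) ≃L[ℝ] (Fin (m + 1) → ℝ), (∀ w, L w = rowMap j g w) ∧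
      L (0, 1) = g j := by
  let L₀ : ((Fin m → ℝ) × ℝ) →ₗ[ℝ] (Fin (m + 1) → ℝ) :=
    { toFun := rowMap j g
      map_add' := fun w w' => by
        rw [rowMap, rowMap, rowMap, ← add_vecMul]
        congr 1
        ext i
        refine Fin.succAboveCases j ?_ (fun i => ?_) i <;> simp
      map_smul' := fun a w => by
        rw [rowMap, rowMap, RingHom.id_apply, ← smul_vecMul]
        congr 1
        ext i
        refine Fin.succAboveCases j ?_ (fun i => ?_) i <;> simp }
  have hinj : Function.Injective L₀ := by
    intro w w' h
    have hu : IsUnit (g : Matrix (Fin (m + 1)) (Fin (m + 1)) ℝ) := by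
      rw [Matrix.isUnit_iff_isUnit_det, g.det_coe]
      exact isUnit_one
    have h1 := Matrix.vecMul_injective_of_isUnit hu h
    ext i
    · simpa using congrFun h1 (j.succAbove i)
    · simpa using congrFun h1 j
  refine ⟨(LinearMap.linearEquivOfInjective L₀ hinj (by simp)).toContinuousLinearEquiv,
    fun w => rfl, ?_⟩
  change rowMap j g (0, 1) = g j
  have : (j.insertNth (1 : ℝ) (0 : Fin m → ℝ) : Fin (m + 1) → ℝ) = Pi.single j 1 := by
    ext i
    refine Fin.succAboveCases j ?_ (fun i => ?_) i <;> simp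
  rw [rowMap, this, single_one_vecMul]
  rfl

/-- The smooth approximation to the indicator of `{x | A < F x < B, |x h⁻¹| ≤ T}` in a cone. -/
def countWeight {n : ℕ} (s : Fin n → ℝ) (d N : ℕ) (k : Fin n → ℤ) (h : Matrix (Fin n) (Fin n) ℝ)
    (K T e A B τ : ℝ) (x : Fin n → ℝ) : ℝ :=
  coneWeight N k h K T e x * ramp A B τ (signForm s d x)

lemma le_fderiv_of_goodRow {m : ℕ} {s : Fin (m + 1) → ℝ} {d N : ℕ}
    {k : Fin (m + 1) → ℤ} {ε r : ℝ} (hr : 0 < r) {j : Fin (m + 1)} {g : SLR (m + 1)}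
    (hg : GoodRow s d N k ε r (g j)) {L : ((Fin m → ℝ) × ℝ) ≃L[ℝ] (Fin (m + 1) → ℝ)}
    (hL1 : L (0, 1) = g j) {a : ℝ} (ha : 0 < a)
    (hLa : ∀ w, ‖w‖ ≤ a * ‖L w‖) {w w' : (Fin m → ℝ) × ℝ}
    (hw0 : L w ≠ 0) (hw : ∀ i, |N * (L w i / √(sqNorm (L w))) - k i| ≤ 1)
    (hw0' : L w' ≠ 0) (hw' : ∀ i, |N * (L w' i / √(sqNorm (L w'))) - k i| ≤ 1)
    {z : (Fin m → ℝ) × ℝ} (hz : z ∈ segment ℝ w w') :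
    1 / (r * a ^ (d - 1)) * ‖z‖ ^ (d - 1)
      ≤ ∑ i, (ε * s i) * (d * L z i ^ (d - 1)) * L (0, 1) i := by
  obtain ⟨t, t', ht, ht', htt, rfl⟩ := hz
  set ρ := √(sqNorm (L w)) with hρ
  set ρ' := √(sqNorm (L w')) with hρ'
  have hρ0 : 0 < ρ := Real.sqrt_pos.2 (sqNorm_pos hw0)
  have hρ0' : 0 < ρ' := Real.sqrt_pos.2 (sqNorm_pos hw0')
  set σ := t * ρ + t' * ρ' with hσ
  have hσ0 : 0 < σ := by
    rcases ht.eq_or_lt with h | h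
    · have : t' = 1 := by linarith
      rw [hσ, ← h, this]
      linarith
    · have := mul_pos h hρ0
      have := mul_nonneg ht' hρ0'.le
      linarith
  set b : Fin (m + 1) → ℝ := fun i => L (t • w + t' • w') i / σ with hb
  have hbσ : ∀ i, L (t • w + t' • w') i = σ * b i := fun i => by
    rw [hb]
    field_simp
  have hbc : ∀ i, b i = t * ρ / σ * (L w i / ρ) + t' * ρ' / σ * (L w' i / ρ') := fun i => by
    rw [hb]
    simp only [map_add, map_smul, Pi.add_apply, Pi.smul_apply, smul_eq_mul]
    field_simp
  have hα : 0 ≤ t * ρ / σ := by positivity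
  have hα' : 0 ≤ t' * ρ' / σ := by positivity
  have hαα : t * ρ / σ + t' * ρ' / σ = 1 := by
    rw [← add_div]
    exact div_self hσ0.ne'
  have hcomb : ∀ {x y u : ℝ}, |x - u| ≤ 1 → |y - u| ≤ 1 →
      |t * ρ / σ * x + t' * ρ' / σ * y - u| ≤ 1 := by
    intro x y u hx hy
    have : t * ρ / σ * x + t' * ρ' / σ * y - u
        = t * ρ / σ * (x - u) + t' * ρ' / σ * (y - u) := by
      linear_combination (u : ℝ) * hαα
    rw [this]
    refine (abs_add_le _ _).trans ?_
    rw [abs_mul, abs_mul, abs_of_nonneg hα, abs_of_nonneg hα']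
    nlinarith
  have hbox := hg b fun i => by
    rw [hbc i, mul_add, mul_left_comm, mul_left_comm (N : ℝ)]
    exact hcomb (hw i) (hw' i)
  have hb1 : ‖b‖ ≤ 1 := (pi_norm_le_iff_of_nonneg zero_le_one).2 fun i => by
    rw [hbc i, Real.norm_eq_abs]
    have h1 := abs_div_sqrt_sqNorm_le (L w) i
    have h2 := abs_div_sqrt_sqNorm_le (L w') i
    have := hcomb (x := L w i / ρ) (y := L w' i / ρ') (u := 0) (by rwa [sub_zero])
      (by rwa [sub_zero])
    rwa [sub_zero] at this
  have hzn : ‖t • w + t' • w'‖ ≤ a * σ := by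
    refine (hLa _).trans ?_
    have : L (t • w + t' • w') = σ • b := by
      ext i
      rw [hbσ]
      rfl
    rw [this, norm_smul, Real.norm_of_nonneg hσ0.le]
    gcongr
    exact mul_le_of_le_one_right hσ0.le hb1
  have hsum : ∑ i, (ε * s i) * (d * L (t • w + t' • w') i ^ (d - 1)) * L (0, 1) i
      = σ ^ (d - 1) * (ε * ∑ i, s i * (d * b i ^ (d - 1)) * g j i) := by
    rw [Finset.mul_sum, Finset.mul_sum, hL1]
    refine Finset.sum_congr rfl fun i _ => ?_
    rw [hbσ, mul_pow]
    ring
  rw [hsum]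
  have h3 : 1 / r ≤ ε * ∑ i, s i * (d * b i ^ (d - 1)) * g j i := by
    rwa [div_le_iff₀' hr]
  calc 1 / (r * a ^ (d - 1)) * ‖t • w + t' • w'‖ ^ (d - 1)
      ≤ 1 / (r * a ^ (d - 1)) * (a * σ) ^ (d - 1) := by gcongr
    _ = σ ^ (d - 1) * (1 / r) := by
        rw [mul_pow]
        field_simp
    _ ≤ _ := by gcongr

/-- The weights `countWeight` are fibre weights, with uniform constants. -/
theorem exists_fibreWeight {m : ℕ} {s : Fin (m + 1) → ℝ} (hs : ∀ i, |s i| ≤ 1) {d : ℕ}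
    (hd : 2 ≤ d) {N : ℕ} {k : Fin (m + 1) → ℤ} {ε r : ℝ} (hε : |ε| = 1) (hr : 1 ≤ r)
    {j : Fin (m + 1)} {g : SLR (m + 1)} (hg : GoodRow s d N k ε r (g j)) (e : ℝ) :
    ∃ c > 0, ∃ C₁, ∃ C, 1 ≤ C ∧ ∀ K T h A B τ, 1 ≤ K → 0 < T → BoundedMatrix r h → A < B →
      0 < τ → B - A < c →
      FibreWeight d ⌈C * T⌉₊ c C₁ (C * K) (B - A) (fun w => ε * signForm s d (rowMap j g w))
        (fun w => coneWeight N k h K T e (rowMap j g w)) fun y => ramp A B τ (ε * y) := by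
  obtain ⟨L, hL, hL1⟩ := exists_rowMap_equiv j g
  obtain ⟨C₀, hC₀, hcw⟩ := exists_coneSmooth_coneWeight N k (by linarith : 0 ≤ r) e
  set a : ℝ := max 1 (max ‖(L : ((Fin m → ℝ) × ℝ) →L[ℝ] (Fin (m + 1) → ℝ))‖
    ‖(L.symm : (Fin (m + 1) → ℝ) →L[ℝ] ((Fin m → ℝ) × ℝ))‖) with ha_def
  have ha1 : 1 ≤ a := le_max_left _ _
  have haL : ‖(L : ((Fin m → ℝ) × ℝ) →L[ℝ] (Fin (m + 1) → ℝ))‖ ≤ a :=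
    (le_max_left _ _).trans (le_max_right _ _)
  have haL' : ‖(L.symm : (Fin (m + 1) → ℝ) →L[ℝ] ((Fin m → ℝ) × ℝ))‖ ≤ a :=
    (le_max_right _ _).trans (le_max_right _ _)
  have hLa : ∀ w, ‖w‖ ≤ a * ‖L w‖ := fun w => by
    have := (L.symm : (Fin (m + 1) → ℝ) →L[ℝ] ((Fin m → ℝ) × ℝ)).le_of_opNorm_le haL' (L w)
    simpa using this
  have ha0 : 0 < a := by linarith
  have hr0 : 0 < r := by linarith
  set Li : Fin (m + 1) → ((Fin m → ℝ) × ℝ) →L[ℝ] ℝ := fun i =>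
    (ContinuousLinearMap.proj (R := ℝ) (φ := fun _ : Fin (m + 1) => ℝ) i).comp
      (L : ((Fin m → ℝ) × ℝ) →L[ℝ] (Fin (m + 1) → ℝ)) with hLi
  have hLia : ∀ i, ‖Li i‖ ≤ a := fun i => by
    refine (ContinuousLinearMap.opNorm_comp_le _ _).trans ?_
    exact (mul_le_of_le_one_left (norm_nonneg _) (norm_proj_le _ i)).trans haL
  have hP : (fun w => ε * signForm s d (rowMap j g w))
      = fun w => ∑ i, (ε * s i) * Li i w ^ d := by
    ext w
    rw [← hL, signForm, Finset.mul_sum]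
    refine Finset.sum_congr rfl fun i _ => ?_
    rw [mul_assoc]
    rfl
  have hs' : ∀ i, |ε * s i| ≤ 1 := fun i => by
    rw [abs_mul, hε, one_mul]
    exact hs i
  have hd0 : (1 : ℝ) ≤ d := by exact_mod_cast (by omega : 1 ≤ d)
  have had : 1 ≤ a ^ d := one_le_pow₀ ha1
  have hc1 : 1 / (r * a ^ (d - 1)) ≤ 1 := by
    rw [div_le_one (by positivity)]
    exact one_le_mul_of_one_le_of_one_le hr (one_le_pow₀ ha1)
  refine ⟨1 / (r * a ^ (d - 1)), by positivity, Fintype.card (Fin (m + 1)) * (d * d * a ^ d),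
    max (a ^ 2 * C₀) (a * (r * (1 + |e|))), ?_, fun K T h A B τ hK hT hh hAB hτ hBA => ?_⟩
  · exact le_max_of_le_left (one_le_mul_of_one_le_of_one_le (one_le_pow₀ ha1) hC₀)
  have hCS := hcw K T h hK hT hh
  have hcd := contDiff_coneWeight hCS
  have hφ : (fun w => coneWeight N k h K T e (rowMap j g w))
      = coneWeight N k h K T e ∘ L := by
    ext w
    rw [Function.comp, hL]
  have hL0 : ∀ w, coneWeight N k h K T e (L w) ≠ 0 → L w ≠ 0 := fun w hw h0 => by
    have := (coneWeight_ne_zero hT hw).2.1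
    rw [h0] at this
    simp [sqNorm] at this
    linarith
  rw [hP, hφ]
  refine
    { two_le := hd
      c_pos := by positivity
      c_le := ?_
      ℓ_pos := by linarith
      ℓ_lt := hBA
      one_le_Λ := ?_
      contDiff_P := contDiff_powerSum _ _ _ _
      norm_fderiv_P_le := fun w => (norm_fderiv_powerSum_le hs' ha0.le hLia (by omega) w).trans ?_
      norm_fderiv_fderiv_P_le := norm_fderiv_fderiv_powerSum_le hs' ha0.le hLia hd
      contDiff_φ := hcd.comp L.contDiff
      φ_nonneg := fun w => hCS.nonneg _
      φ_le_one := fun w => hCS.le_one _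
      norm_le_of_φ := fun w hw => ?_
      le_norm_of_φ := ⟨1 / ((m + 1 : ℕ) * a), by positivity, fun w hw => ?_⟩
      norm_fderiv_φ_le := fun w => ?_
      contDiff_G := (contDiff_ramp A B τ).comp (contDiff_const.mul contDiff_id)
      G_nonneg := fun _ => ramp_nonneg _ _ _ _
      G_le_one := fun _ => ramp_le_one _ _ _ _
      G_supp := fun x y hx hy => ?_
      le_fderiv_P := fun w w' hw hw' z hz => ?_ }
  · refine hc1.trans ?_
    rw [Fintype.card_fin]
    have : (1 : ℝ) ≤ (m + 1 : ℕ) := by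
      push_cast
      linarith [(Nat.cast_nonneg m : (0 : ℝ) ≤ m)]
    exact one_le_mul_of_one_le_of_one_le this
      (one_le_mul_of_one_le_of_one_le (one_le_mul_of_one_le_of_one_le hd0 hd0) had)
  · refine one_le_mul_of_one_le_of_one_le (le_max_of_le_left ?_) hK
    exact one_le_mul_of_one_le_of_one_le (one_le_pow₀ ha1) hC₀
  · gcongr
    exact le_mul_of_one_le_left (by linarith) hd0
  · obtain ⟨-, -, h3⟩ := coneWeight_ne_zero hT hw
    have hK0 : 0 < K := by linarith
    have h4 : sqNorm (L w ᵥ* h) ≤ T ^ 2 * (1 + |e|) := by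
      have h6 : e ≤ K * |e| := (le_abs_self e).trans (le_mul_of_one_le_left (abs_nonneg _) hK)
      refine le_of_mul_le_mul_left (h3.le.trans ?_) hK0
      have : T ^ 2 * (K + e) ≤ T ^ 2 * (K + K * |e|) := by gcongr
      linarith
    have h5 : ‖L w‖ ^ 2 ≤ (r * (1 + |e|) * T) ^ 2 := by
      refine (sq_norm_le_sqNorm _).trans ((hh.2 _).trans ?_)
      have h7 : 1 + |e| ≤ (1 + |e|) ^ 2 := by nlinarith [abs_nonneg e]
      calc r ^ 2 * sqNorm (L w ᵥ* h) ≤ r ^ 2 * (T ^ 2 * (1 + |e|)) := by gcongr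
        _ ≤ r ^ 2 * (T ^ 2 * (1 + |e|) ^ 2) := by gcongr
        _ = _ := by ring
    have h8 := (pow_le_pow_iff_left₀ (norm_nonneg _) (by positivity) two_ne_zero).1 h5
    refine ((hLa w).trans ?_).trans (Nat.le_ceil _)
    calc a * ‖L w‖ ≤ a * (r * (1 + |e|) * T) := by gcongr
      _ = a * (r * (1 + |e|)) * T := by ring
      _ ≤ _ := by
        gcongr
        exact le_max_right _ _
  · obtain ⟨-, h2, -⟩ := coneWeight_ne_zero hT hw
    have h3 := sqNorm_le (L w)
    have h4 : ‖L w‖ ≤ a * ‖w‖ :=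
      (L : ((Fin m → ℝ) × ℝ) →L[ℝ] (Fin (m + 1) → ℝ)).le_of_opNorm_le haL w
    have hn1 : (1 : ℝ) ≤ (m + 1 : ℕ) := by exact_mod_cast (by omega : 1 ≤ m + 1)
    rw [div_le_iff₀ (by positivity)]
    by_contra! h5
    have h6 : ((m + 1 : ℕ) : ℝ) * ‖L w‖ ^ 2 ≤ (‖w‖ * ((m + 1 : ℕ) * a)) ^ 2 := by
      calc ((m + 1 : ℕ) : ℝ) * ‖L w‖ ^ 2 ≤ (m + 1 : ℕ) * (a * ‖w‖) ^ 2 := by gcongr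
        _ ≤ ((m + 1 : ℕ) : ℝ) ^ 2 * (a * ‖w‖) ^ 2 := by
          gcongr
          nlinarith
        _ = _ := by ring
    have h7 : (‖w‖ * ((m + 1 : ℕ) * a)) ^ 2 ≤ 1 := pow_le_one₀ (by positivity) h5.le
    linarith
  · by_cases hw : w = 0
    · rw [hw, norm_zero, zero_mul]
      positivity
    · have hLw : L w ≠ 0 := fun h => hw (L.map_eq_zero_iff.1 h)
      rw [ContinuousLinearEquiv.comp_right_fderiv]
      have h1 := hCS.bound (L w) hLw
      calc ‖w‖ * ‖(fderiv ℝ (coneWeight N k h K T e) (L w)).comp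
            (L : ((Fin m → ℝ) × ℝ) →L[ℝ] (Fin (m + 1) → ℝ))‖
          ≤ (a * ‖L w‖) * (‖fderiv ℝ (coneWeight N k h K T e) (L w)‖ * a) := by
            refine mul_le_mul (hLa w) ((ContinuousLinearMap.opNorm_comp_le _ _).trans ?_)
              (norm_nonneg _) (by positivity)
            gcongr
        _ = a ^ 2 * (‖L w‖ * ‖fderiv ℝ (coneWeight N k h K T e) (L w)‖) := by ring
        _ ≤ a ^ 2 * (C₀ * K) := by gcongr
        _ = a ^ 2 * C₀ * K := by ring
        _ ≤ _ := by
          gcongr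
          exact le_max_left _ _
  · obtain ⟨h1, h2⟩ := ramp_ne_zero hτ hx
    obtain ⟨h3, h4⟩ := ramp_ne_zero hτ hy
    have : |x - y| = |ε * x - ε * y| := by rw [← mul_sub, abs_mul, hε, one_mul]
    rw [this, abs_le]
    constructor <;> linarith
  · have h1 : fderiv ℝ (fun w => ∑ i, (ε * s i) * Li i w ^ d) z (0, 1)
        = ∑ i, (ε * s i) * (d * L z i ^ (d - 1)) * L (0, 1) i := by
      rw [fderiv_powerSum]
      simp only [_root_.sum_apply, _root_.smul_apply, smul_eq_mul]
      rfl
    rw [h1]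
    exact le_fderiv_of_goodRow hr0 hg hL1 ha0 hLa (hL0 w hw) (coneWeight_ne_zero hT hw).1
      (hL0 w' hw') (coneWeight_ne_zero hT hw').1 hz

/-- The lattice sum of `countWeight` minus the integral of `countWeight`. -/
def countError {n : ℕ} (s : Fin n → ℝ) (d N : ℕ) (k : Fin n → ℤ) (h : Matrix (Fin n) (Fin n) ℝ)
    (K T e A B τ : ℝ) (g : SLR n) : ℝ :=
  ∑' v : Fin n → ℤ, countWeight s d N k h K T e A B τ
      (intVec v ᵥ* (g : Matrix (Fin n) (Fin n) ℝ)) - ∫ x, countWeight s d N k h K T e A B τ x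

theorem exists_measure_countError_le {m : ℕ} {s : Fin (m + 1) → ℝ} (hs : ∀ i, |s i| ≤ 1) {d : ℕ}
    (hd : 2 ≤ d) (hdm : d ≤ m) {N : ℕ} {k : Fin (m + 1) → ℤ} {ε r : ℝ} (hε : |ε| = 1) (hr : 1 ≤ r)
    {j : Fin (m + 1)} {g : SLR (m + 1)} (hg : GoodRow s d N k ε r (g j)) (e : ℝ) :
    ∃ c > 0, ∃ C, 1 ≤ C ∧ ∀ K T h A B τ t, 1 ≤ K → 1 ≤ T → BoundedMatrix r h → A < B →
      0 < τ → B - A < c → C * (1 + K * (B - A) * T ^ (m - d) * (1 + Real.log T)) ≤ t →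
      volume {X | 2 * t ≤ |countError s d N k h K T e A B τ (shear j X * g)|}
        ≤ ENNReal.ofReal (C * (B - A) * T ^ (m + 1 - d) * (1 + Real.log T) / t ^ 2) := by
  obtain ⟨c, hc, C₁, C₂, hC₂, H⟩ := exists_fibreWeight hs hd hε hr hg e
  have hC3 : 0 < C₂ + 2 := by linarith
  have hl3 : 0 ≤ Real.log (C₂ + 2) := Real.log_nonneg (by linarith)
  set D₁ := 4 * (C₁ / c) ^ 2 * C₂ / c * 2 ^ d * (2 * m * 3 ^ (m - 1)) * (C₂ + 2) ^ (m - d)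
    * (1 + Real.log (C₂ + 2)) with hD₁
  set D₂ := 1 / c * (24 * m * 3 ^ (m - 1) * (C₂ + 2) ^ (m + 1 - d)
    * (1 + Real.log (C₂ + 2))) with hD₂
  have hD₁0 : 0 ≤ D₁ := by positivity
  have hD₂0 : 0 ≤ D₂ := by positivity
  refine ⟨c, hc, 13 + D₁ + D₂, by linarith, fun K T h A B τ t hK hT hh hAB hτ hBA ht => ?_⟩
  have HW := H K T h A B τ hK (by linarith) hh hAB hτ hBA
  have hT0 : 0 < T := by linarith
  have hlT : 0 ≤ Real.log T := Real.log_nonneg hT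
  set R := ⌈C₂ * T⌉₊ with hR
  have hR1 : ((R + 1 : ℕ) : ℝ) ≤ (C₂ + 2) * T := by
    have := (Nat.ceil_lt_add_one (by positivity : 0 ≤ C₂ * T)).le
    push_cast
    linarith
  have hR0 : (0 : ℝ) < (R + 1 : ℕ) := by positivity
  have hlog : 1 + Real.log (R + 1 : ℕ) ≤ (1 + Real.log (C₂ + 2)) * (1 + Real.log T) := by
    have := Real.log_le_log hR0 hR1
    rw [Real.log_mul hC3.ne' hT0.ne'] at this
    nlinarith
  have hlR : 0 ≤ 1 + Real.log (R + 1 : ℕ) := by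
    have : 0 ≤ Real.log (R + 1 : ℕ) := Real.log_natCast_nonneg _
    linarith
  have hBA0 : 0 < B - A := by linarith
  have hK0 : 0 < K := by linarith
  have hX : 0 ≤ K * (B - A) * T ^ (m - d) * (1 + Real.log T) := by positivity
  have ht' : 13 + D₁ * (K * (B - A) * T ^ (m - d) * (1 + Real.log T)) ≤ t := by
    refine le_trans ?_ ht
    nlinarith
  have ht0 : 0 < t := by
    have := mul_nonneg hD₁0 hX
    linarith
  have hmain := HW.measure_le_abs_shearSum_sub hdm (t := t) (by
    refine le_trans ?_ ht'
    gcongr 13 + ?_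
    calc 4 * (C₁ / c) ^ 2 * (C₂ * K) / c * (B - A) * 2 ^ d * (2 * m * 3 ^ (m - 1))
          * ((R + 1 : ℕ) : ℝ) ^ (m - d) * (1 + Real.log (R + 1 : ℕ))
        ≤ 4 * (C₁ / c) ^ 2 * (C₂ * K) / c * (B - A) * 2 ^ d * (2 * m * 3 ^ (m - 1))
          * ((C₂ + 2) * T) ^ (m - d) * ((1 + Real.log (C₂ + 2)) * (1 + Real.log T)) := by
          gcongr
      _ = D₁ * (K * (B - A) * T ^ (m - d) * (1 + Real.log T)) := by
          rw [hD₁, mul_pow]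
          ring)
  have hε2 : ∀ y : ℝ, ε * (ε * y) = y := fun y => by
    rw [← mul_assoc, ← abs_mul_abs_self, hε, one_mul, one_mul]
  have hfun : (fun w : (Fin m → ℝ) × ℝ => coneWeight N k h K T e (rowMap j g w)
      * ramp A B τ (ε * (ε * signForm s d (rowMap j g w))))
      = fun w => countWeight s d N k h K T e A B τ (rowMap j g w) := by
    ext w
    rw [hε2, countWeight]
  have hset : {X : Fin m → UnitAddCircle |
        2 * t ≤ |countError s d N k h K T e A B τ (shear j X * g)|}
      = {X | 2 * t ≤ |shearSum (fun w => countWeight s d N k h K T e A B τ (rowMap j g w)) X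
        - ∫ w, countWeight s d N k h K T e A B τ (rowMap j g w)|} := by
    have h2 := integral_rowMap j g (countWeight s d N k h K T e A B τ)
    refine congrArg _ (funext fun X => ?_)
    rw [countError, tsum_shear j X g (countWeight s d N k h K T e A B τ), ← h2]
  simp only [hfun] at hmain
  rw [hset]
  refine hmain.trans (ENNReal.ofReal_le_ofReal ?_)
  gcongr ?_ / t ^ 2
  calc (B - A) / c * (24 * m * 3 ^ (m - 1) * ((R + 1 : ℕ) : ℝ) ^ (m + 1 - d)
          * (1 + Real.log (R + 1 : ℕ)))
      ≤ (B - A) / c * (24 * m * 3 ^ (m - 1) * ((C₂ + 2) * T) ^ (m + 1 - d)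
          * ((1 + Real.log (C₂ + 2)) * (1 + Real.log T))) := by gcongr
    _ = D₂ * ((B - A) * T ^ (m + 1 - d) * (1 + Real.log T)) := by
        rw [hD₂, mul_pow]
        ring
    _ ≤ (13 + D₁ + D₂) * ((B - A) * T ^ (m + 1 - d) * (1 + Real.log T)) := by
        gcongr
        linarith
    _ = _ := by ring

/-- Rational matrices with common denominator `K`. -/
def ratMatrix {n : ℕ} (H : Fin n → Fin n → ℤ) (K : ℕ) : Matrix (Fin n) (Fin n) ℝ :=
  Matrix.of fun a b => (H a b : ℝ) / K

/-- The parameters `(l, H)` for which the lattice point count has to be controlled. -/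
def paramSet (n r M : ℕ) (θ : ℝ) (K : ℕ) : Finset (ℤ × (Fin n → Fin n → ℤ)) :=
  Finset.Icc (-(⌊(K : ℝ) ^ 2 * ((K : ℝ) ^ M) ^ θ⌋₊ : ℤ)) (⌊(K : ℝ) ^ 2 * ((K : ℝ) ^ M) ^ θ⌋₊ : ℤ) ×ˢ
    Fintype.piFinset fun _ => Fintype.piFinset fun _ => Finset.Icc (-(r * K : ℕ) : ℤ) (r * K : ℕ)

lemma card_paramSet_le (n r M : ℕ) {θ : ℝ} (hθ : 0 ≤ θ) {K : ℕ} (hK : 1 ≤ K) :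
    ((paramSet n r M θ K).card : ℝ)
      ≤ 3 * (2 * r + 1) ^ (n * n) * ((K : ℝ) ^ (n * n + 2) * ((K : ℝ) ^ M) ^ θ) := by
  have hK1 : (1 : ℝ) ≤ K := by exact_mod_cast hK
  have hcard : ∀ B : ℕ, (Finset.Icc (-(B : ℤ)) B).card = 2 * B + 1 := fun B => by
    rw [Int.card_Icc]
    omega
  rw [paramSet, Finset.card_product, hcard, Fintype.card_piFinset]
  simp only [Fintype.card_piFinset, hcard, Finset.prod_const, Finset.card_univ, Fintype.card_fin]
  push_cast
  have h1 : (1 : ℝ) ≤ (K : ℝ) ^ 2 * ((K : ℝ) ^ M) ^ θ :=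
    one_le_mul_of_one_le_of_one_le (one_le_pow₀ hK1) (Real.one_le_rpow (one_le_pow₀ hK1) hθ)
  have h2 := Nat.floor_le (zero_le_one.trans h1)
  rw [← pow_mul]
  have h3 : (2 * (r * K : ℝ) + 1) ≤ (2 * r + 1) * K := by
    nlinarith
  calc (2 * (⌊(K : ℝ) ^ 2 * ((K : ℝ) ^ M) ^ θ⌋₊ : ℝ) + 1) * (2 * (r * K : ℝ) + 1) ^ (n * n)
      ≤ (3 * ((K : ℝ) ^ 2 * ((K : ℝ) ^ M) ^ θ)) * ((2 * r + 1) * K) ^ (n * n) := by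
        gcongr
        linarith
    _ = _ := by
        rw [mul_pow]
        ring

/-- The set of `g` for which one of the lattice point counts at level `K` deviates by at least
`(K ^ M) ^ lam`. -/
def countBad {n : ℕ} (s : Fin n → ℝ) (d N : ℕ) (k : Fin n → ℤ) (r M : ℕ) (η κ lam e e' : ℝ)
    (K : ℕ) : Set (SLR n) :=
  {g | ∃ p ∈ paramSet n r M (η + κ) K, BoundedMatrix r (ratMatrix p.2 K) ∧
    ((K : ℝ) ^ M) ^ lam ≤ |countError s d N k (ratMatrix p.2 K) K ((K : ℝ) ^ M) e'
      (p.1 * (((K : ℝ) ^ M) ^ (-κ) / K))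
      (p.1 * (((K : ℝ) ^ M) ^ (-κ) / K) + (K + e) * (((K : ℝ) ^ M) ^ (-κ) / K))
      (((K : ℝ) ^ M) ^ (-κ) / K) g|}

lemma measurable_coneWeight {n : ℕ} (N : ℕ) (k : Fin n → ℤ) (h : Matrix (Fin n) (Fin n) ℝ)
    (K T e : ℝ) : Measurable (coneWeight N k h K T e) := by
  have h1 : Measurable (sqNorm : (Fin n → ℝ) → ℝ) := contDiff_sqNorm.continuous.measurable
  have h2 : Measurable fun x : Fin n → ℝ => sqNorm (x ᵥ* h) :=
    (contDiff_sqNorm_vecMul h).continuous.measurable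
  have h3 : Measurable Real.smoothTransition := Real.smoothTransition.continuous.measurable
  have h4 : Measurable bump := contDiff_bump.continuous.measurable
  refine Measurable.mul ?_ (Measurable.mul ?_ ?_)
  · refine Finset.measurable_fun_prod _ fun i _ => h4.comp ?_
    exact (((measurable_pi_apply i).div h1.sqrt).const_mul _).sub_const _
  · exact h3.comp (h1.sub_const _)
  · exact h3.comp (((h2.div_const _).const_sub _).const_mul _ |>.add_const _)

lemma continuous_signForm {n : ℕ} (s : Fin n → ℝ) (d : ℕ) : Continuous (signForm s d) := by
  unfold signForm
  fun_prop

lemma measurable_countWeight {n : ℕ} (s : Fin n → ℝ) (d N : ℕ) (k : Fin n → ℤ)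
    (h : Matrix (Fin n) (Fin n) ℝ) (K T e A B τ : ℝ) :
    Measurable (countWeight s d N k h K T e A B τ) :=
  (measurable_coneWeight N k h K T e).mul
    ((contDiff_ramp A B τ).continuous.comp (continuous_signForm s d)).measurable

lemma measurable_countError {n : ℕ} (s : Fin n → ℝ) (d N : ℕ) (k : Fin n → ℤ)
    (h : Matrix (Fin n) (Fin n) ℝ) (K T e A B τ : ℝ) :
    Measurable (countError s d N k h K T e A B τ) :=
  (Measurable.tsum fun v => (measurable_countWeight s d N k h K T e A B τ).comp
    (continuous_vecMul_SLR (intVec v)).measurable).sub_const _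

lemma measurableSet_countBad {n : ℕ} (s : Fin n → ℝ) (d N : ℕ) (k : Fin n → ℤ) (r M : ℕ)
    (η κ lam e e' : ℝ) (K : ℕ) : MeasurableSet (countBad s d N k r M η κ lam e e' K) := by
  have : countBad s d N k r M η κ lam e e' K = ⋃ p ∈ paramSet n r M (η + κ) K,
      {g | BoundedMatrix r (ratMatrix p.2 K) ∧
    ((K : ℝ) ^ M) ^ lam ≤ |countError s d N k (ratMatrix p.2 K) K ((K : ℝ) ^ M) e'
      (p.1 * (((K : ℝ) ^ M) ^ (-κ) / K))
      (p.1 * (((K : ℝ) ^ M) ^ (-κ) / K) + (K + e) * (((K : ℝ) ^ M) ^ (-κ) / K))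
      (((K : ℝ) ^ M) ^ (-κ) / K) g|} := by
    ext g
    simp only [Set.mem_iUnion, exists_prop]
    exact Iff.rfl
  rw [this]
  refine Finset.measurableSet_biUnion _ fun p _ => ?_
  by_cases hb : BoundedMatrix r (ratMatrix p.2 K)
  · simp only [hb, true_and]
    exact measurableSet_le measurable_const (measurable_countError _ _ _ _ _ _ _ _ _ _ _).abs
  · simp only [hb, false_and]
    exact MeasurableSet.const _

lemma isClosed_setOf_goodRow {n : ℕ} (s : Fin n → ℝ) (d N : ℕ) (k : Fin n → ℤ) (ε r : ℝ)
    (j : Fin n) : IsClosed {g : SLR n | GoodRow s d N k ε r (g j)} := by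
  simp only [GoodRow, Set.ofPred_forall]
  refine isClosed_iInter fun b => isClosed_iInter fun _ => isClosed_le continuous_const ?_
  have : ∀ i, Continuous fun g : SLR n => (g : Matrix (Fin n) (Fin n) ℝ) j i := fun i =>
    (continuous_apply_apply j i).comp (continuous_coe_SLR n)
  fun_prop

/-- An upper bound for the measure of `countBad` along the shear orbit of a single `g`. -/
theorem exists_measure_countBad_le {m : ℕ} {s : Fin (m + 1) → ℝ} (hs : ∀ i, |s i| ≤ 1) {d : ℕ}
    (hd : 2 ≤ d) (hdm : d ≤ m) {N : ℕ} {k : Fin (m + 1) → ℤ} {ε : ℝ} (hε : |ε| = 1) {r : ℕ}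
    (hr : 1 ≤ r) {j : Fin (m + 1)} {g : SLR (m + 1)} (hg : GoodRow s d N k ε r (g j))
    {M : ℕ} (hM : 1 ≤ M) {η κ lam : ℝ} (hη : 0 ≤ η) (hκ : 0 < κ) (h1 : 1 ≤ M * lam)
    (h2 : 3 ≤ M * (lam - (m - d - κ)))
    (h3 : ((m + 1) * (m + 1) + 5 : ℝ) ≤ M * (2 * lam - η - (m + 1 - d))) (e e' : ℝ) :
    ∃ C : ℝ, ∀ᶠ K : ℕ in atTop,
      volume {X | shear j X * g ∈ countBad s d N k r M η κ lam e e' K}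
        ≤ ENNReal.ofReal (C * (1 / (K : ℝ) ^ 2)) := by
  classical
  obtain ⟨c, hc, C₀, hC₀, H⟩ := exists_measure_countError_le hs hd hdm hε
    (by exact_mod_cast hr : (1 : ℝ) ≤ r) hg e'
  set D := 2 * C₀ * (1 + (1 + |e|) * (1 + M)) with hD
  have hD1 : 0 < D := by positivity
  have hw0 : Tendsto (fun K : ℕ => (1 + |e|) * ((K : ℝ) ^ M) ^ (-κ)) atTop
      (nhds ((1 + |e|) * 0)) := by
    refine Tendsto.const_mul _ ((tendsto_rpow_neg_atTop hκ).comp ?_)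
    exact (tendsto_pow_atTop (by omega)).comp tendsto_natCast_atTop_atTop
  rw [mul_zero] at hw0
  refine ⟨3 * (2 * r + 1) ^ ((m + 1) * (m + 1)) * (4 * C₀ * (1 + |e|) * (1 + M)), ?_⟩
  filter_upwards [hw0.eventually_lt_const hc, eventually_ge_atTop 1,
    eventually_ge_atTop (⌈2 * D⌉₊), eventually_gt_atTop ⌈|e|⌉₊] with K hKc hK1' hKD hKe
  have hK1 : (1 : ℝ) ≤ K := by exact_mod_cast hK1'
  have hK0 : (0 : ℝ) < K := by linarith
  replace hKD : 2 * D ≤ K := Nat.ceil_le.1 hKD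
  replace hKe : |e| < K := Nat.lt_of_ceil_lt hKe
  have hKe' : 0 < K + e := by linarith [neg_abs_le e]
  set T : ℝ := (K : ℝ) ^ M with hT
  have hT1 : 1 ≤ T := one_le_pow₀ hK1
  have hT0 : 0 < T := by linarith
  have hTx : ∀ x : ℝ, T ^ x = (K : ℝ) ^ (M * x) := fun x => by
    rw [hT, ← Real.rpow_natCast_mul hK0.le]
  have hlog : 1 + Real.log T ≤ (1 + M) * K := by
    rw [hT, Real.log_pow]
    have := Real.log_le_self hK0.le
    have : (M : ℝ) * Real.log K ≤ M * K := by gcongr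
    linarith
  have hlT : 0 ≤ Real.log T := Real.log_nonneg hT1
  set w : ℝ := T ^ (-κ) with hw
  have hw0 : 0 < w := Real.rpow_pos_of_pos hT0 _
  have hwidth : (K + e) * (w / K) ≤ (1 + |e|) * w := by
    have h4 : (K + e) ≤ (1 + |e|) * K := by
      nlinarith [le_abs_self e, abs_nonneg e]
    calc (K + e) * (w / K) ≤ (1 + |e|) * K * (w / K) := by gcongr
      _ = (1 + |e|) * w := by field_simp
  have hwidth0 : 0 < (K + e) * (w / K) := by positivity
  set t : ℝ := T ^ lam / 2 with ht
  have ht0 : 0 < t := by positivity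
  have hTmd : T ^ (m - d) = T ^ ((m : ℝ) - d) := by
    rw [← Real.rpow_natCast, Nat.cast_sub hdm]
  have hTmd' : T ^ (m + 1 - d) = T ^ ((m : ℝ) + 1 - d) := by
    rw [← Real.rpow_natCast, Nat.cast_sub (by omega)]
    push_cast
    rfl
  have hone : ∀ p : ℤ × (Fin (m + 1) → Fin (m + 1) → ℤ), BoundedMatrix r (ratMatrix p.2 K) →
      volume {X | 2 * t ≤ |countError s d N k (ratMatrix p.2 K) K T e' (p.1 * (w / K))
        (p.1 * (w / K) + (K + e) * (w / K)) (w / K) (shear j X * g)|}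
      ≤ ENNReal.ofReal (4 * C₀ * (1 + |e|) * (1 + M) * (K * (w * T ^ ((m : ℝ) + 1 - d)
        * T ^ (-(2 * lam))))) := by
    intro p hp
    refine (H K T (ratMatrix p.2 K) _ _ _ t hK1 hT1 hp (by linarith) (by positivity)
      (by linarith) ?_).trans (ENNReal.ofReal_le_ofReal ?_)
    · rw [add_sub_cancel_left, hTmd]
      have h4 : K * ((K + e) * (w / K)) * T ^ ((m : ℝ) - d) * (1 + Real.log T)
          ≤ K * ((1 + |e|) * w) * T ^ ((m : ℝ) - d) * ((1 + M) * K) := by gcongr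
      have h5 : (K : ℝ) * ((1 + |e|) * w) * T ^ ((m : ℝ) - d) * ((1 + M) * K)
          = (1 + |e|) * (1 + M) * ((K : ℝ) ^ 2 * (w * T ^ ((m : ℝ) - d))) := by ring
      have h6 : (K : ℝ) ^ 2 * (w * T ^ ((m : ℝ) - d)) ≤ (K : ℝ) ^ (M * lam - 1) := by
        rw [hw, ← Real.rpow_add hT0, hTx, ← Real.rpow_natCast, ← Real.rpow_add hK0]
        refine Real.rpow_le_rpow_of_exponent_le hK1 ?_
        push_cast
        linarith
      have h7 : 1 ≤ (K : ℝ) ^ (M * lam - 1) := Real.one_le_rpow hK1 (by linarith)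
      have h8 : T ^ lam = (K : ℝ) ^ (M * lam - 1) * K := by
        rw [hTx, Real.rpow_sub hK0, Real.rpow_one]
        field_simp
      calc C₀ * (1 + K * ((K + e) * (w / K)) * T ^ ((m : ℝ) - d) * (1 + Real.log T))
          ≤ C₀ * ((K : ℝ) ^ (M * lam - 1) + (1 + |e|) * (1 + M) * (K : ℝ) ^ (M * lam - 1)) := by
            rw [h5] at h4
            refine mul_le_mul_of_nonneg_left (add_le_add h7 (h4.trans ?_)) (by linarith)
            gcongr
        _ = (K : ℝ) ^ (M * lam - 1) * (D / 2) := by rw [hD]; ring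
        _ ≤ (K : ℝ) ^ (M * lam - 1) * (K / 2) := by
            gcongr
            linarith
        _ = t := by rw [ht, h8]; ring
    · rw [add_sub_cancel_left, hTmd']
      have h4 : T ^ (-(2 * lam)) = 1 / (T ^ lam) ^ 2 := by
        rw [Real.rpow_neg hT0.le, mul_comm, Real.rpow_mul hT0.le, one_div, Real.rpow_ofNat]
      rw [ht, h4]
      calc C₀ * ((K + e) * (w / K)) * T ^ ((m : ℝ) + 1 - d) * (1 + Real.log T) / (T ^ lam / 2) ^ 2
          ≤ C₀ * ((1 + |e|) * w) * T ^ ((m : ℝ) + 1 - d) * ((1 + M) * K) / (T ^ lam / 2) ^ 2 := by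
            gcongr
        _ = _ := by
            field_simp
            ring
  have hsub : {X | shear j X * g ∈ countBad s d N k r M η κ lam e e' K}
      ⊆ ⋃ p ∈ (paramSet (m + 1) r M (η + κ) K).filter
          fun p => BoundedMatrix r (ratMatrix p.2 K),
        {X | 2 * t ≤ |countError s d N k (ratMatrix p.2 K) K T e' (p.1 * (w / K))
          (p.1 * (w / K) + (K + e) * (w / K)) (w / K) (shear j X * g)|} := by
    intro X hX
    obtain ⟨p, hp, hb, hle⟩ := hX
    refine Set.mem_biUnion (Finset.mem_coe.2 (Finset.mem_filter.2 ⟨hp, hb⟩)) ?_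
    have : 2 * t = T ^ lam := by rw [ht]; ring
    exact this.trans_le hle
  refine (measure_mono hsub).trans ((measure_biUnion_finset_le _ _).trans ?_)
  refine (Finset.sum_le_card_nsmul _ _ _ fun p hp =>
    hone p (Finset.mem_filter.1 hp).2).trans ?_
  rw [nsmul_eq_mul, ← ENNReal.ofReal_natCast, ← ENNReal.ofReal_mul (Nat.cast_nonneg _)]
  refine ENNReal.ofReal_le_ofReal ?_
  have hcard : (((paramSet (m + 1) r M (η + κ) K).filter
      fun p => BoundedMatrix r (ratMatrix p.2 K)).card : ℝ)
      ≤ 3 * (2 * r + 1) ^ ((m + 1) * (m + 1)) * ((K : ℝ) ^ ((m + 1) * (m + 1) + 2)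
        * T ^ (η + κ)) :=
    (Nat.cast_le.2 (Finset.card_filter_le _ _)).trans
      (card_paramSet_le (m + 1) r M (by linarith) hK1')
  have hfin : (K : ℝ) ^ ((m + 1) * (m + 1) + 2) * T ^ (η + κ) * (K * (w * T ^ ((m : ℝ) + 1 - d)
      * T ^ (-(2 * lam)))) ≤ 1 / (K : ℝ) ^ 2 := by
    have h4 : (K : ℝ) ^ ((m + 1) * (m + 1) + 2) * T ^ (η + κ) * (K * (w * T ^ ((m : ℝ) + 1 - d)
      * T ^ (-(2 * lam)))) = (K : ℝ) ^ ((m + 1) * (m + 1) + 3)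
        * (T ^ (η + κ) * (w * T ^ ((m : ℝ) + 1 - d) * T ^ (-(2 * lam)))) := by ring
    rw [h4, hw, ← Real.rpow_add hT0, ← Real.rpow_add hT0, ← Real.rpow_add hT0, hTx,
      ← Real.rpow_natCast (K : ℝ) ((m + 1) * (m + 1) + 3), ← Real.rpow_add hK0, one_div,
      ← Real.rpow_natCast (K : ℝ) 2, ← Real.rpow_neg hK0.le]
    refine Real.rpow_le_rpow_of_exponent_le hK1 ?_
    push_cast
    linarith
  calc _ ≤ 3 * (2 * r + 1) ^ ((m + 1) * (m + 1)) * ((K : ℝ) ^ ((m + 1) * (m + 1) + 2)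
        * T ^ (η + κ)) * (4 * C₀ * (1 + |e|) * (1 + M) * (K * (w * T ^ ((m : ℝ) + 1 - d)
        * T ^ (-(2 * lam))))) := by
        gcongr
    _ = 3 * (2 * r + 1) ^ ((m + 1) * (m + 1)) * (4 * C₀ * (1 + |e|) * (1 + M))
        * ((K : ℝ) ^ ((m + 1) * (m + 1) + 2) * T ^ (η + κ) * (K * (w * T ^ ((m : ℝ) + 1 - d)
      * T ^ (-(2 * lam))))) := by ring
    _ ≤ _ := by gcongr

/-- For almost every `g`, the lattice point counts deviate only finitely often. -/
theorem ae_eventually_notMem_countBad {m : ℕ} {s : Fin (m + 1) → ℝ} (hs : ∀ i, |s i| ≤ 1) {d : ℕ}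
    (hd : 2 ≤ d) (hdm : d ≤ m) (N : ℕ) (k : Fin (m + 1) → ℤ) {ε : ℝ} (hε : |ε| = 1) {r : ℕ}
    (hr : 1 ≤ r) (j : Fin (m + 1)) {M : ℕ} (hM : 1 ≤ M) {η κ lam : ℝ} (hη : 0 ≤ η) (hκ : 0 < κ)
    (h1 : 1 ≤ M * lam) (h2 : 3 ≤ M * (lam - (m - d - κ)))
    (h3 : ((m + 1) * (m + 1) + 5 : ℝ) ≤ M * (2 * lam - η - (m + 1 - d))) (e e' : ℝ)
    (μ : Measure (SLR (m + 1))) [μ.IsHaarMeasure] :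
    ∀ᵐ g ∂μ, GoodRow s d N k ε r (g j) →
      ∀ᶠ K : ℕ in atTop, g ∉ countBad s d N k r M η κ lam e e' K := by
  set S : Set (SLR (m + 1)) := {g | GoodRow s d N k ε r (g j)} ∩
    limsup (fun K : ℕ => countBad s d N k r M η κ lam e e' K) atTop with hS
  have hlim : ∀ g, g ∈ limsup (fun K : ℕ => countBad s d N k r M η κ lam e e' K) atTop ↔
      ∃ᶠ K : ℕ in atTop, g ∈ countBad s d N k r M η κ lam e e' K := fun g => by
    rw [limsup_eq_iInf_iSup_of_nat, frequently_atTop]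
    simp
  have hzero : μ S = 0 := by
    refine measure_eq_zero_of_shear μ j ((isClosed_setOf_goodRow s d N k ε r j).measurableSet.inter
      (MeasurableSet.measurableSet_limsup fun K => measurableSet_countBad _ _ _ _ _ _ _ _ _ _ _ K))
      fun g => ?_
    by_cases hg : GoodRow s d N k ε r (g j)
    · obtain ⟨C, hC⟩ := exists_measure_countBad_le hs hd hdm hε hr hg hM hη hκ h1 h2 h3 e e'
      obtain ⟨K₀, hK₀⟩ := eventually_atTop.1 hC
      have h0 : volume {X | ∃ᶠ K : ℕ in atTop,
          K₀ ≤ K ∧ shear j X * g ∈ countBad s d N k r M η κ lam e e' K} = 0 := by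
        refine measure_setOfPred_frequently_eq_zero (ne_top_of_le_ne_top
          (Summable.tsum_ofReal_ne_top ((Real.summable_one_div_nat_pow.2 one_lt_two).mul_left C))
          (ENNReal.tsum_le_tsum fun K => ?_))
        by_cases hK : K₀ ≤ K
        · simp only [hK, true_and]
          exact hK₀ K hK
        · simp [hK]
      refine measure_mono_null (fun X hX => ?_) h0
      exact (((hlim _).1 hX.2).and_eventually (eventually_ge_atTop K₀)).mono fun K hK => ⟨hK.2, hK.1⟩
    · refine measure_mono_null (t := ∅) (fun X hX => hg ?_) measure_empty
      have := hX.1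
      simp only [Set.mem_ofPred_eq] at this
      rwa [shear_mul_row] at this
  filter_upwards [measure_eq_zero_iff_ae_notMem.1 hzero] with g hg hrow
  by_contra hcon
  exact hg ⟨hrow, (hlim g).2 (by simpa [Filter.Frequently] using hcon)⟩

lemma GoodRow.mono {n : ℕ} {s : Fin n → ℝ} {d N : ℕ} {k : Fin n → ℤ} {ε r r' : ℝ} {a : Fin n → ℝ}
    (h : GoodRow s d N k ε r a) (hr : 0 < r) (hrr : r ≤ r') : GoodRow s d N k ε r' a := by
  intro b hb
  have h1 := h b hb
  have h2 : 0 ≤ ε * ∑ i, s i * (d * b i ^ (d - 1)) * a i :=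
    nonneg_of_mul_nonneg_right (zero_le_one.trans h1) hr
  exact h1.trans (mul_le_mul_of_nonneg_right hrr h2)

lemma sqNorm_div_sqrt_sqNorm {n : ℕ} {x : Fin n → ℝ} (hx : x ≠ 0) :
    sqNorm (fun i => x i / √(sqNorm x)) = 1 := by
  have h := sqNorm_pos hx
  unfold sqNorm at h ⊢
  simp only [div_pow, Real.sq_sqrt h.le]
  rw [← Finset.sum_div, div_self h.ne']

/-- Every cone of a sufficiently fine covering is good for one of the rows of `g`. -/
theorem exists_goodRow {n : ℕ} {s : Fin n → ℝ} (hs : ∀ i, s i ≠ 0) {d : ℕ} (hd : 2 ≤ d)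
    (g : SLR n) : ∃ N r : ℕ, 1 ≤ r ∧ ∀ k, (∃ x ≠ 0, coneCutoff N k x ≠ 0) →
      ∃ j, ∃ ε ∈ ({1, -1} : Set ℝ), GoodRow s d N k ε r (g j) := by
  set D : (Fin n → ℝ) → Fin n → ℝ := fun b j => ∑ i, s i * (d * b i ^ (d - 1)) * g j i with hD
  have hDc : Continuous D := by
    rw [hD]
    fun_prop
  have hD0 : ∀ b, b ≠ 0 → D b ≠ 0 := by
    intro b hb h0
    have hu : IsUnit (g : Matrix (Fin n) (Fin n) ℝ) := by
      rw [Matrix.isUnit_iff_isUnit_det, g.det_coe]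
      exact isUnit_one
    have h1 : (g : Matrix (Fin n) (Fin n) ℝ) *ᵥ (fun i => s i * (d * b i ^ (d - 1))) = 0 := by
      ext j
      rw [← h0]
      simp only [mulVec, dotProduct, hD]
      exact Finset.sum_congr rfl fun i _ => mul_comm _ _
    have h2 := Matrix.mulVec_injective_of_isUnit hu (h1.trans (mulVec_zero _).symm)
    refine hb (funext fun i => ?_)
    have h3 := congrFun h2 i
    have hd' : (d : ℝ) ≠ 0 := by exact_mod_cast (by omega : d ≠ 0)
    simp only [Pi.zero_apply, mul_eq_zero, hs i, hd', false_or] at h3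
    exact pow_eq_zero_iff (by omega) |>.1 h3
  have hsph : IsCompact {b : Fin n → ℝ | sqNorm b = 1} := by
    refine Metric.isCompact_of_isClosed_isBounded
      (isClosed_eq contDiff_sqNorm.continuous continuous_const) ?_
    refine (Metric.isBounded_closedBall (x := (0 : Fin n → ℝ)) (r := 1)).subset fun b hb => ?_
    have := norm_le_sqrt_sqNorm b
    rw [show sqNorm b = 1 from hb, Real.sqrt_one] at this
    simpa using this
  obtain ⟨c, hc, hcD⟩ : ∃ c > 0, ∀ b : Fin n → ℝ, sqNorm b = 1 → c ≤ ‖D b‖ := by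
    rcases Set.eq_empty_or_nonempty {b : Fin n → ℝ | sqNorm b = 1} with he | hne
    · refine ⟨1, one_pos, fun b hb => ?_⟩
      have : b ∈ {b : Fin n → ℝ | sqNorm b = 1} := hb
      simp [he] at this
    · obtain ⟨b₀, hb₀, hmin⟩ := hsph.exists_isMinOn hne hDc.norm.continuousOn
      refine ⟨‖D b₀‖, norm_pos_iff.2 (hD0 b₀ fun h => ?_), fun b hb => hmin hb⟩
      have : sqNorm b₀ = 1 := hb₀
      simp [h, sqNorm] at this
  have huc := (isCompact_closedBall (0 : Fin n → ℝ) 3).uniformContinuousOn_of_continuous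
    hDc.continuousOn
  rw [Metric.uniformContinuousOn_iff] at huc
  obtain ⟨δ, hδ, hδD⟩ := huc (c / 2) (by positivity)
  obtain ⟨N, hN⟩ := exists_nat_gt (max 1 (2 / δ))
  obtain ⟨r, hr⟩ := exists_nat_gt (max 1 (2 / c))
  have hN1 : (1 : ℝ) < N := (le_max_left _ _).trans_lt hN
  have hr1 : (1 : ℝ) < r := (le_max_left _ _).trans_lt hr
  have hN2 : 2 / (N : ℝ) < δ := by
    rw [div_lt_comm₀ (by positivity) hδ]
    exact (le_max_right _ _).trans_lt hN
  refine ⟨N, r, by exact_mod_cast hr1.le, fun k hk => ?_⟩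
  obtain ⟨x, hx, hxk⟩ := hk
  set b₀ : Fin n → ℝ := fun i => x i / √(sqNorm x) with hb₀
  have hb₀1 : sqNorm b₀ = 1 := sqNorm_div_sqrt_sqNorm hx
  have hb₀k : ∀ i, |N * b₀ i - k i| ≤ 1 := fun i =>
    bump_ne_zero (Finset.prod_ne_zero_iff.1 hxk i (Finset.mem_univ i))
  obtain ⟨j, hj⟩ : ∃ j, c ≤ |D b₀ j| := by
    by_contra! h
    exact absurd (hcD b₀ hb₀1) (not_le.2 ((pi_norm_lt_iff hc).2 h))
  have hb₀n : ‖b₀‖ ≤ 1 := by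
    have := norm_le_sqrt_sqNorm b₀
    rwa [hb₀1, Real.sqrt_one] at this
  have hbox : ∀ b : Fin n → ℝ, (∀ i, |N * b i - k i| ≤ 1) → |D b j - D b₀ j| ≤ c / 2 := by
    intro b hb
    have h1 : ‖b - b₀‖ ≤ 2 / N := (pi_norm_le_iff_of_nonneg (by positivity)).2 fun i => by
      have h4 : |b i - b₀ i| * N = |N * b i - N * b₀ i| := by
        rw [← mul_sub, abs_mul, Nat.abs_cast, mul_comm]
      rw [le_div_iff₀ (by positivity), Pi.sub_apply, Real.norm_eq_abs, h4]
      have h2 := hb i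
      have h3 := hb₀k i
      rw [abs_le] at h2 h3 ⊢
      constructor <;> nlinarith
    have h2 : 2 / (N : ℝ) ≤ 2 := div_le_self zero_le_two hN1.le
    have h3 : ‖b‖ ≤ 3 := by
      have := norm_le_norm_add_norm_sub b₀ b
      rw [norm_sub_rev] at this
      linarith
    have h4 := hδD b (by simpa using h3) b₀ (by simpa using hb₀n.trans (by norm_num))
      (by rw [dist_eq_norm]; linarith)
    rw [dist_eq_norm] at h4
    exact (norm_le_pi_norm (D b - D b₀) j).trans h4.le
  have hrc : 1 ≤ r * (c / 2) := by
    have := (le_max_right 1 (2 / c)).trans hr.le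
    rw [div_le_iff₀ hc] at this
    linarith
  have hr0 : (0 : ℝ) ≤ r := Nat.cast_nonneg r
  rcases le_total 0 (D b₀ j) with h0 | h0
  · refine ⟨j, 1, by simp, fun b hb => hrc.trans (mul_le_mul_of_nonneg_left ?_ hr0)⟩
    have h1 := (abs_le.1 (hbox b hb)).1
    rw [abs_of_nonneg h0] at hj
    change c / 2 ≤ 1 * D b j
    linarith
  · refine ⟨j, -1, by simp, fun b hb => hrc.trans (mul_le_mul_of_nonneg_left ?_ hr0)⟩
    have h1 := (abs_le.1 (hbox b hb)).2
    rw [abs_of_nonpos h0] at hj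
    change c / 2 ≤ -1 * D b j
    linarith

/-- The sum of `countWeight` over all cones. -/
def totalWeight {n : ℕ} (s : Fin n → ℝ) (d : ℕ) (h : Matrix (Fin n) (Fin n) ℝ)
    (K T e A B τ : ℝ) (x : Fin n → ℝ) : ℝ :=
  Real.smoothTransition (sqNorm x - 1) *
    Real.smoothTransition (K * (1 - sqNorm (x ᵥ* h) / T ^ 2) + e) *
    ramp A B τ (signForm s d x)

lemma sum_countWeight {n : ℕ} (s : Fin n → ℝ) (d N : ℕ) (h : Matrix (Fin n) (Fin n) ℝ)
    (K T e A B τ : ℝ) (x : Fin n → ℝ) :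
    ∑ k ∈ coneIndex n N, countWeight s d N k h K T e A B τ x = totalWeight s d h K T e A B τ x := by
  simp only [countWeight, coneWeight]
  rw [← Finset.sum_mul, ← Finset.sum_mul, sum_coneCutoff, one_mul, totalWeight]

lemma finite_setOf_sqNorm_intVec_le (n : ℕ) (R : ℝ) :
    {v : Fin n → ℤ | sqNorm (intVec v) ≤ R}.Finite := by
  obtain ⟨B, hB⟩ := exists_nat_gt (√R)
  refine (Set.Finite.pi' fun _ : Fin n => Set.finite_Icc (-B : ℤ) B).subset fun v hv i => ?_
  have h1 := (abs_le_sqrt_sqNorm (intVec v) i).trans ((Real.sqrt_le_sqrt hv).trans hB.le)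
  rw [intVec, abs_le] at h1
  exact ⟨by exact_mod_cast h1.1, by exact_mod_cast h1.2⟩

lemma exists_sqNorm_le_vecMul {n : ℕ} (g : SLR n) : ∃ C : ℝ, 1 ≤ C ∧
    (∀ v, sqNorm v ≤ C * sqNorm (v ᵥ* (g : Matrix (Fin n) (Fin n) ℝ))) ∧
    ∀ v, sqNorm (v ᵥ* (g : Matrix (Fin n) (Fin n) ℝ)) ≤ C * sqNorm v := by
  have key : ∀ h : Matrix (Fin n) (Fin n) ℝ, ∃ C : ℝ, 0 ≤ C ∧
      ∀ v, sqNorm (v ᵥ* h) ≤ C * sqNorm v := by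
    intro h
    refine ⟨∑ j, ∑ i, h i j ^ 2, by positivity, fun v => ?_⟩
    rw [sqNorm, Finset.sum_mul]
    refine Finset.sum_le_sum fun j _ => ?_
    rw [mul_comm]
    exact Finset.sum_mul_sq_le_sq_mul_sq Finset.univ v fun i => h i j
  obtain ⟨C₁, hC₁, h₁⟩ := key g
  obtain ⟨C₂, hC₂, h₂⟩ := key ((g⁻¹ : SLR n) : Matrix (Fin n) (Fin n) ℝ)
  have hinv : ∀ v, v ᵥ* (g : Matrix (Fin n) (Fin n) ℝ) ᵥ* ((g⁻¹ : SLR n) : Matrix _ _ ℝ) = v := by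
    intro v
    rw [vecMul_vecMul, ← Matrix.SpecialLinearGroup.coe_mul, mul_inv_cancel,
      Matrix.SpecialLinearGroup.coe_one, vecMul_one]
  refine ⟨1 + C₁ + C₂, by linarith, fun v => ?_, fun v => (h₁ v).trans ?_⟩
  · have h3 := h₂ (v ᵥ* (g : Matrix (Fin n) (Fin n) ℝ))
    rw [hinv] at h3
    refine h3.trans ?_
    have := sqNorm_nonneg (v ᵥ* (g : Matrix (Fin n) (Fin n) ℝ))
    gcongr
    linarith
  · have := sqNorm_nonneg v
    gcongr
    linarith

lemma countWeight_nonneg {n : ℕ} (s : Fin n → ℝ) (d N : ℕ) (k : Fin n → ℤ)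
    (h : Matrix (Fin n) (Fin n) ℝ) (K T e A B τ : ℝ) (x : Fin n → ℝ) :
    0 ≤ countWeight s d N k h K T e A B τ x :=
  mul_nonneg (mul_nonneg (coneCutoff_nonneg _ _ _) (mul_nonneg (Real.smoothTransition.nonneg _)
    (Real.smoothTransition.nonneg _))) (ramp_nonneg _ _ _ _)

lemma countWeight_le_one {n : ℕ} (s : Fin n → ℝ) (d N : ℕ) (k : Fin n → ℤ)
    (h : Matrix (Fin n) (Fin n) ℝ) (K T e A B τ : ℝ) (x : Fin n → ℝ) :
    countWeight s d N k h K T e A B τ x ≤ 1 :=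
  mul_le_one₀ (mul_le_one₀ (coneCutoff_le_one _ _ _) (mul_nonneg (Real.smoothTransition.nonneg _)
    (Real.smoothTransition.nonneg _)) (mul_le_one₀ (Real.smoothTransition.le_one _)
    (Real.smoothTransition.nonneg _) (Real.smoothTransition.le_one _)))
    (ramp_nonneg _ _ _ _) (ramp_le_one _ _ _ _)

lemma sqNorm_le_of_countWeight_ne_zero {n : ℕ} {s : Fin n → ℝ} {d N : ℕ} {k : Fin n → ℤ}
    {h : Matrix (Fin n) (Fin n) ℝ} {r K T e A B τ : ℝ} (hK : 1 ≤ K) (hT : 0 < T)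
    (hh : BoundedMatrix r h) {x : Fin n → ℝ} (hx : countWeight s d N k h K T e A B τ x ≠ 0) :
    sqNorm x ≤ r ^ 2 * (T ^ 2 * (1 + |e|)) := by
  have h1 := (coneWeight_ne_zero hT (left_ne_zero_of_mul hx)).2.2
  refine (hh.2 x).trans (mul_le_mul_of_nonneg_left ?_ (sq_nonneg r))
  have hK0 : 0 < K := by linarith
  have h6 : e ≤ K * |e| := (le_abs_self e).trans (le_mul_of_one_le_left (abs_nonneg _) hK)
  refine le_of_mul_le_mul_left (h1.le.trans ?_) hK0
  have : T ^ 2 * (K + e) ≤ T ^ 2 * (K + K * |e|) := by gcongr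
  linarith

lemma summable_countWeight {n : ℕ} {s : Fin n → ℝ} {d N : ℕ} {k : Fin n → ℤ}
    {h : Matrix (Fin n) (Fin n) ℝ} {r K T e A B τ : ℝ} (hK : 1 ≤ K) (hT : 0 < T)
    (hh : BoundedMatrix r h) (g : SLR n) :
    Summable fun v : Fin n → ℤ => countWeight s d N k h K T e A B τ
      (intVec v ᵥ* (g : Matrix (Fin n) (Fin n) ℝ)) := by
  obtain ⟨C, hC, hCg, -⟩ := exists_sqNorm_le_vecMul g
  refine summable_of_hasFiniteSupport ((finite_setOf_sqNorm_intVec_le n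
    (C * (r ^ 2 * (T ^ 2 * (1 + |e|))))).subset fun v hv => (hCg _).trans ?_)
  have := sqNorm_le_of_countWeight_ne_zero hK hT hh hv
  gcongr

lemma integrable_countWeight {n : ℕ} {s : Fin n → ℝ} {d N : ℕ} {k : Fin n → ℤ}
    {h : Matrix (Fin n) (Fin n) ℝ} {r K T e A B τ : ℝ} (hK : 1 ≤ K) (hT : 0 < T)
    (hh : BoundedMatrix r h) : Integrable (countWeight s d N k h K T e A B τ) := by
  set R := √(r ^ 2 * (T ^ 2 * (1 + |e|)))
  have hsupp : Function.support (countWeight s d N k h K T e A B τ)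
      ⊆ Metric.closedBall 0 R := fun x hx => by
    rw [mem_closedBall_zero_iff]
    exact (norm_le_sqrt_sqNorm x).trans
      (Real.sqrt_le_sqrt (sqNorm_le_of_countWeight_ne_zero hK hT hh hx))
  rw [← integrableOn_iff_integrable_of_support_subset hsupp]
  refine Measure.integrableOn_of_bounded (M := 1) measure_closedBall_lt_top.ne
    (measurable_countWeight s d N k h K T e A B τ).aestronglyMeasurable
    (Eventually.of_forall fun x => ?_)
  rw [Real.norm_of_nonneg (countWeight_nonneg _ _ _ _ _ _ _ _ _ _ _ _)]
  exact countWeight_le_one _ _ _ _ _ _ _ _ _ _ _ _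

/-- For almost every `g` the weighted lattice point counts agree with the volumes. -/
theorem ae_exists_totalWeight_error_le {m : ℕ} {s : Fin (m + 1) → ℝ} (hs : ∀ i, |s i| = 1) {d : ℕ}
    (hd : 2 ≤ d) (hdm : d ≤ m) {M : ℕ} (hM : 1 ≤ M) {η κ lam : ℝ} (hη : 0 ≤ η) (hκ : 0 < κ)
    (h1 : 1 ≤ M * lam) (h2 : 3 ≤ M * (lam - (m - d - κ)))
    (h3 : ((m + 1) * (m + 1) + 5 : ℝ) ≤ M * (2 * lam - η - (m + 1 - d))) (e e' : ℝ)
    (μ : Measure (SLR (m + 1))) [μ.IsHaarMeasure] :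
    ∀ᵐ g : SLR (m + 1) ∂μ, ∃ r₀ : ℕ, ∀ r ≥ r₀, ∃ C : ℝ, ∀ᶠ K : ℕ in atTop,
      ∀ p ∈ paramSet (m + 1) r M (η + κ) K, BoundedMatrix r (ratMatrix p.2 K) →
        |∑' v : Fin (m + 1) → ℤ, totalWeight s d (ratMatrix p.2 K) K ((K : ℝ) ^ M) e'
          (p.1 * (((K : ℝ) ^ M) ^ (-κ) / K))
          (p.1 * (((K : ℝ) ^ M) ^ (-κ) / K) + (K + e) * (((K : ℝ) ^ M) ^ (-κ) / K))
          (((K : ℝ) ^ M) ^ (-κ) / K) (intVec v ᵥ* (g : Matrix (Fin (m + 1)) (Fin (m + 1)) ℝ))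
        - ∫ x, totalWeight s d (ratMatrix p.2 K) K ((K : ℝ) ^ M) e'
          (p.1 * (((K : ℝ) ^ M) ^ (-κ) / K))
          (p.1 * (((K : ℝ) ^ M) ^ (-κ) / K) + (K + e) * (((K : ℝ) ^ M) ^ (-κ) / K))
          (((K : ℝ) ^ M) ^ (-κ) / K) x| ≤ C * ((K : ℝ) ^ M) ^ lam := by
  have hae : ∀ᵐ g : SLR (m + 1) ∂μ, ∀ (N : ℕ) (k : Fin (m + 1) → ℤ) (r : ℕ) (j : Fin (m + 1)) (b : Bool),
      1 ≤ r → GoodRow s d N k (if b then 1 else -1) r (g j) →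
        ∀ᶠ K : ℕ in atTop, g ∉ countBad s d N k r M η κ lam e e' K := by
    rw [ae_all_iff]; intro N
    rw [ae_all_iff]; intro k
    rw [ae_all_iff]; intro r
    rw [ae_all_iff]; intro j
    rw [ae_all_iff]; intro b
    by_cases hr : 1 ≤ r
    · filter_upwards [ae_eventually_notMem_countBad (fun i => (hs i).le) hd hdm N k
        (ε := if b then 1 else -1) (by cases b <;> simp) hr j hM hη hκ h1 h2 h3 e e' μ] with g hg
      exact fun _ => hg
    · exact Eventually.of_forall fun g h => absurd h hr
  filter_upwards [hae] with g hg
  obtain ⟨N, r₀, hr₀, hgood⟩ := exists_goodRow (s := s)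
    (fun i h => by simpa [h] using hs i) hd g
  refine ⟨r₀, fun r hr => ⟨(coneIndex (m + 1) N).card, ?_⟩⟩
  have hr1 : 1 ≤ r := hr₀.trans hr
  have hk : ∀ k ∈ coneIndex (m + 1) N, ∀ᶠ K : ℕ in atTop,
      (∀ x ≠ 0, coneCutoff N k x = 0) ∨ g ∉ countBad s d N k r M η κ lam e e' K := by
    intro k _
    by_cases h : ∃ x ≠ 0, coneCutoff N k x ≠ 0
    · obtain ⟨j, ε, hε, hrow⟩ := hgood k h
      have hrow' := hrow.mono (by exact_mod_cast hr₀) (by exact_mod_cast hr : (r₀ : ℝ) ≤ r)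
      refine Eventually.mono ?_ fun K => Or.inr
      rcases hε with rfl | rfl
      · exact hg N k r j true hr1 (by simpa using hrow')
      · exact hg N k r j false hr1 (by simpa using hrow')
    · refine Eventually.of_forall fun K => Or.inl fun x hx => ?_
      by_contra hne
      exact h ⟨x, hx, hne⟩
  filter_upwards [(Filter.eventually_all_finset _).2 hk, eventually_ge_atTop 1] with K hK hK1 p hp hb
  have hK1' : (1 : ℝ) ≤ K := by exact_mod_cast hK1
  have hT0 : (0 : ℝ) < (K : ℝ) ^ M := by positivity
  simp only [← sum_countWeight s d N]
  rw [Summable.tsum_finsetSum fun k _ => summable_countWeight hK1' hT0 hb g,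
    integral_finsetSum _ fun k _ => integrable_countWeight hK1' hT0 hb, ← Finset.sum_sub_distrib]
  refine (Finset.abs_sum_le_sum_abs _ _).trans ?_
  refine (Finset.sum_le_card_nsmul _ _ (((K : ℝ) ^ M) ^ lam) fun k hk' => ?_).trans
    (le_of_eq (nsmul_eq_mul _ _))
  rcases hK k hk' with h0 | hnot
  · have hz : ∀ A B τ, countWeight s d N k (ratMatrix p.2 K) K ((K : ℝ) ^ M) e' A B τ
        = fun _ => 0 := by
      intro A B τ
      ext x
      by_cases hx : x = 0
      · rw [countWeight, coneWeight, hx, Real.smoothTransition.zero_of_nonpos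
          (x := sqNorm (0 : Fin (m + 1) → ℝ) - 1) (by simp [sqNorm])]
        simp
      · rw [countWeight, coneWeight, h0 x hx]
        simp
    simp only [hz, tsum_zero, integral_zero, sub_zero, abs_zero]
    positivity
  · by_contra! hlt
    exact hnot ⟨p, hp, hb, hlt.le⟩

lemma abs_sqNorm_add_sub_le {n : ℕ} (v u : Fin n → ℝ) {k : ℝ} (hk : 0 < k) :
    |sqNorm (v + u) - sqNorm v| ≤ sqNorm v / k + (1 + k) * sqNorm u := by
  simp only [sqNorm, Pi.add_apply]
  rw [← Finset.sum_sub_distrib, Finset.sum_div, Finset.mul_sum, ← Finset.sum_add_distrib]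
  refine (Finset.abs_sum_le_sum_abs _ _).trans (Finset.sum_le_sum fun i _ => ?_)
  have h1 : (v i - k * u i) ^ 2 / k = v i ^ 2 / k - 2 * v i * u i + k * u i ^ 2 := by
    field_simp
    ring
  have h2 : (v i + k * u i) ^ 2 / k = v i ^ 2 / k + 2 * v i * u i + k * u i ^ 2 := by
    field_simp
    ring
  have h3 : 0 ≤ (v i - k * u i) ^ 2 / k := by positivity
  have h4 : 0 ≤ (v i + k * u i) ^ 2 / k := by positivity
  have h5 := sq_nonneg (u i)
  rw [abs_le]
  constructor <;> nlinarith

lemma sqNorm_vecMul_le_of_abs_le {n : ℕ} {E : Matrix (Fin n) (Fin n) ℝ} {ε : ℝ}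
    (hE : ∀ a b, |E a b| ≤ ε) (x : Fin n → ℝ) :
    sqNorm (x ᵥ* E) ≤ n ^ 2 * ε ^ 2 * sqNorm x := by
  have h1 : ∀ j, (x ᵥ* E) j ^ 2 ≤ n * ε ^ 2 * sqNorm x := fun j => by
    refine (Finset.sum_mul_sq_le_sq_mul_sq Finset.univ x fun i => E i j).trans ?_
    rw [mul_comm]
    refine mul_le_mul_of_nonneg_right ?_ (sqNorm_nonneg x)
    refine (Finset.sum_le_card_nsmul Finset.univ _ (ε ^ 2) fun i _ => ?_).trans
      (le_of_eq (by simp))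
    rw [← sq_abs]
    exact pow_le_pow_left₀ (abs_nonneg _) (hE i j) 2
  refine (Finset.sum_le_card_nsmul Finset.univ _ _ fun j _ => h1 j).trans (le_of_eq ?_)
  simp
  ring

/-- Rational approximation of `g⁻¹` with denominator `K`. -/
lemma exists_ratMatrix_approx {n : ℕ} (g : SLR n) : ∃ C : ℝ, 1 ≤ C ∧ ∃ r₁ : ℕ, ∀ r ≥ r₁,
    ∀ᶠ K : ℕ in atTop, ∃ H : Fin n → Fin n → ℤ,
      (∀ a b, H a b ∈ Finset.Icc (-(r * K : ℕ) : ℤ) (r * K : ℕ)) ∧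
      BoundedMatrix r (ratMatrix H K) ∧
      ∀ v, |sqNorm ((v ᵥ* (g : Matrix (Fin n) (Fin n) ℝ)) ᵥ* ratMatrix H K) - sqNorm v|
        ≤ C / K * sqNorm v := by
  obtain ⟨C₀, hC₀, -, hC⟩ := exists_sqNorm_le_vecMul g
  set G' : Matrix (Fin n) (Fin n) ℝ := ((g⁻¹ : SLR n) : Matrix (Fin n) (Fin n) ℝ) with hG'
  obtain ⟨B, hB⟩ : ∃ B : ℝ, ∀ a b, |G' a b| ≤ B := by
    refine ⟨∑ a, ∑ b, |G' a b|, fun a b => ?_⟩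
    exact (Finset.single_le_sum (f := fun b => |G' a b|) (fun _ _ => abs_nonneg _)
      (Finset.mem_univ b)).trans (Finset.single_le_sum (f := fun a => ∑ b, |G' a b|)
        (fun _ _ => Finset.sum_nonneg fun _ _ => abs_nonneg _) (Finset.mem_univ a))
  set C : ℝ := 1 + 2 * n ^ 2 * C₀ with hCdef
  have hC1 : 1 ≤ C := by
    have : 0 ≤ 2 * (n : ℝ) ^ 2 * C₀ := by positivity
    linarith
  obtain ⟨r₁, hr₁⟩ := exists_nat_gt (max (B + 1) (2 * C₀))
  refine ⟨C, hC1, r₁, fun r hr => ?_⟩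
  have hrB : B + 1 ≤ r := ((le_max_left _ _).trans hr₁.le).trans (by exact_mod_cast hr)
  have hrC : 2 * C₀ ≤ r := ((le_max_right _ _).trans hr₁.le).trans (by exact_mod_cast hr)
  filter_upwards [eventually_ge_atTop 1, eventually_ge_atTop ⌈2 * C⌉₊] with K hK1 hKC
  have hK1' : (1 : ℝ) ≤ K := by exact_mod_cast hK1
  have hK0 : (0 : ℝ) < K := by linarith
  have hKC' : 2 * C ≤ K := (Nat.le_ceil _).trans (by exact_mod_cast hKC)
  set H : Fin n → Fin n → ℤ := fun a b => round (K * G' a b) with hH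
  have hE : ∀ a b, |(ratMatrix H K - G') a b| ≤ 1 / K := by
    intro a b
    have h1 := abs_sub_round ((K : ℝ) * G' a b)
    rw [Matrix.sub_apply, ratMatrix, Matrix.of_apply, le_div_iff₀ hK0]
    have h2 : |(H a b : ℝ) / K - G' a b| * K = |K * G' a b - H a b| := by
      rw [← abs_of_pos hK0, ← abs_mul, abs_of_pos hK0, sub_mul, div_mul_cancel₀ _ hK0.ne',
        abs_sub_comm, mul_comm (G' a b)]
    rw [h2]
    exact h1.trans (by norm_num)
  have hid : ∀ v : Fin n → ℝ, (v ᵥ* (g : Matrix (Fin n) (Fin n) ℝ)) ᵥ* G' = v := fun v => by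
    rw [vecMul_vecMul, hG', ← Matrix.SpecialLinearGroup.coe_mul, mul_inv_cancel,
      Matrix.SpecialLinearGroup.coe_one, vecMul_one]
  have hid' : ∀ v : Fin n → ℝ, (v ᵥ* G') ᵥ* (g : Matrix (Fin n) (Fin n) ℝ) = v := fun v => by
    rw [vecMul_vecMul, hG', ← Matrix.SpecialLinearGroup.coe_mul, inv_mul_cancel,
      Matrix.SpecialLinearGroup.coe_one, vecMul_one]
  have happ : ∀ v, |sqNorm ((v ᵥ* (g : Matrix (Fin n) (Fin n) ℝ)) ᵥ* ratMatrix H K) - sqNorm v|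
      ≤ C / K * sqNorm v := by
    intro v
    set x := v ᵥ* (g : Matrix (Fin n) (Fin n) ℝ) with hx
    have h1 : x ᵥ* ratMatrix H K = v + x ᵥ* (ratMatrix H K - G') := by
      rw [vecMul_sub, hx, hid, add_sub_cancel]
    have h2 := sqNorm_vecMul_le_of_abs_le hE x
    have h3 := hC v
    have h4 := sqNorm_nonneg v
    rw [h1]
    refine (abs_sqNorm_add_sub_le v _ hK0).trans ?_
    calc sqNorm v / K + (1 + K) * sqNorm (x ᵥ* (ratMatrix H K - G'))
        ≤ sqNorm v / K + (K + K) * (n ^ 2 * (1 / K) ^ 2 * (C₀ * sqNorm v)) := by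
          have h5 := sqNorm_nonneg (x ᵥ* (ratMatrix H K - G'))
          have h6 : sqNorm (x ᵥ* (ratMatrix H K - G')) ≤ n ^ 2 * (1 / K) ^ 2 * (C₀ * sqNorm v) :=
            h2.trans (by gcongr)
          gcongr
      _ = C / K * sqNorm v := by
          rw [hCdef]
          field_simp
          ring
  refine ⟨H, fun a b => ?_, ⟨fun a b => ?_, fun x => ?_⟩, happ⟩
  · have h1 := hE a b
    have h2 := hB a b
    rw [Matrix.sub_apply, ratMatrix, Matrix.of_apply] at h1
    have h3 : 1 / (K : ℝ) ≤ 1 := (div_le_one hK0).2 hK1'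
    have h4 : |(H a b : ℝ) / K| ≤ r := by
      rw [abs_le] at h1 h2 ⊢
      constructor <;> linarith [h1.1, h1.2, h2.1, h2.2]
    rw [abs_div, abs_of_pos hK0, div_le_iff₀ hK0, abs_le] at h4
    rw [Finset.mem_Icc]
    exact ⟨by exact_mod_cast h4.1, by exact_mod_cast h4.2⟩
  · have h1 := hE a b
    have h2 := hB a b
    rw [Matrix.sub_apply] at h1
    have h3 : 1 / (K : ℝ) ≤ 1 := (div_le_one hK0).2 hK1'
    rw [abs_le] at h1 h2 ⊢
    constructor <;> linarith [h1.1, h1.2, h2.1, h2.2]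
  · have h1 := happ (x ᵥ* G')
    rw [hid'] at h1
    have h2 := hC (x ᵥ* G')
    rw [hid'] at h2
    have h3 := sqNorm_nonneg (x ᵥ* G')
    have h4 : C / K ≤ 1 / 2 := by
      rw [div_le_div_iff₀ hK0 two_pos]
      linarith
    have h5 : sqNorm (x ᵥ* G') ≤ 2 * sqNorm (x ᵥ* ratMatrix H K) := by
      have := (abs_le.1 h1).1
      nlinarith
    have h6 := sqNorm_nonneg (x ᵥ* ratMatrix H K)
    have hr1 : (r : ℝ) ≤ r ^ 2 := by
      have : (1 : ℝ) ≤ r := by linarith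
      nlinarith
    calc sqNorm x ≤ C₀ * (2 * sqNorm (x ᵥ* ratMatrix H K)) := h2.trans (by gcongr)
      _ = 2 * C₀ * sqNorm (x ᵥ* ratMatrix H K) := by ring
      _ ≤ r ^ 2 * sqNorm (x ᵥ* ratMatrix H K) := by gcongr; linarith

/-- The points `v` with `F(v)` in `J` and `‖v‖² ≤ R`, where `F = g · signForm s d`. -/
def formRegion {n : ℕ} (s : Fin n → ℝ) (d : ℕ) (g : SLR n) (J : Set ℝ) (R : ℝ) : Set (Fin n → ℝ) :=
  {v | signForm s d (v ᵥ* (g : Matrix (Fin n) (Fin n) ℝ)) ∈ J ∧ sqNorm v ≤ R}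

lemma measurableSet_formRegion {n : ℕ} (s : Fin n → ℝ) (d : ℕ) (g : SLR n) {J : Set ℝ}
    (hJ : MeasurableSet J) (R : ℝ) : MeasurableSet (formRegion s d g J R) := by
  have h1 : Measurable fun v : Fin n → ℝ => signForm s d (v ᵥ* (g : Matrix (Fin n) (Fin n) ℝ)) :=
    ((continuous_signForm s d).comp
      (Continuous.matrix_vecMul continuous_id continuous_const)).measurable
  exact (h1 hJ).inter (contDiff_sqNorm.continuous.measurable measurableSet_Iic)

lemma formRegion_subset_closedBall {n : ℕ} (s : Fin n → ℝ) (d : ℕ) (g : SLR n) (J : Set ℝ) (R : ℝ) :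
    formRegion s d g J R ⊆ Metric.closedBall 0 √R := fun v hv => by
  rw [mem_closedBall_zero_iff]
  exact (norm_le_sqrt_sqNorm v).trans (Real.sqrt_le_sqrt hv.2)

lemma volume_formRegion_ne_top {n : ℕ} (s : Fin n → ℝ) (d : ℕ) (g : SLR n) (J : Set ℝ) (R : ℝ) :
    volume (formRegion s d g J R) ≠ ⊤ :=
  ((measure_mono (formRegion_subset_closedBall s d g J R)).trans_lt measure_closedBall_lt_top).ne

lemma signForm_smul {n : ℕ} (s : Fin n → ℝ) (d : ℕ) (a : ℝ) (x : Fin n → ℝ) :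
    signForm s d (a • x) = a ^ d * signForm s d x := by
  simp only [signForm, Pi.smul_apply, smul_eq_mul, mul_pow, Finset.mul_sum]
  exact Finset.sum_congr rfl fun i _ => by ring

open scoped Pointwise in
lemma formRegion_smul {n : ℕ} (s : Fin n → ℝ) (d : ℕ) (g : SLR n) {a : ℝ} (ha : 0 < a)
    (A B R : ℝ) : formRegion s d g (Set.Icc A B) R
      = a • formRegion s d g (Set.Icc (A / a ^ d) (B / a ^ d)) (R / a ^ 2) := by
  ext v
  rw [Set.mem_smul_set_iff_inv_smul_mem₀ ha.ne']
  have h1 : signForm s d ((a⁻¹ • v) ᵥ* (g : Matrix (Fin n) (Fin n) ℝ))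
      = signForm s d (v ᵥ* (g : Matrix (Fin n) (Fin n) ℝ)) / a ^ d := by
    rw [smul_vecMul, signForm_smul, inv_pow, div_eq_inv_mul]
  have h2 : sqNorm (a⁻¹ • v) = sqNorm v / a ^ 2 := by
    rw [sqNorm_smul, inv_pow, div_eq_inv_mul]
  change (_ ∧ _) ↔ (_ ∧ _)
  rw [h1, h2, Set.mem_Icc, Set.mem_Icc, div_le_div_iff_of_pos_right (by positivity),
    div_le_div_iff_of_pos_right (by positivity), div_le_div_iff_of_pos_right (by positivity)]

/-- The volume asymptotic for `F⁻¹(J) ∩ B_T`, `J` a compact interval of arbitrary position. -/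
lemma abs_volume_formRegion_sub_le {n : ℕ} {s : Fin n → ℝ} {d : ℕ} {g : SLR n} {c CF : ℝ}
    (hCF : 0 ≤ CF)
    (hV : ∀ I : Set ℝ, MeasurableSet I → I ⊆ Set.Icc (-1) 1 → ∀ T : ℝ, 2 < T →
      |(volume (formRegion s d g I (T ^ 2))).toReal - c * (volume I).toReal * T ^ ((n : ℝ) - d)|
        ≤ CF * (volume I).toReal * T ^ ((n : ℝ) - d - 1) * Real.log T)
    {A B a T : ℝ} (ha : 1 ≤ a) (hAB : A ≤ B) (hA : -a ^ d ≤ A) (hB : B ≤ a ^ d) (hT : 2 * a < T) :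
    |(volume (formRegion s d g (Set.Icc A B) (T ^ 2))).toReal - c * (B - A) * T ^ ((n : ℝ) - d)|
      ≤ CF * (B - A) * T ^ ((n : ℝ) - d) * (a * Real.log T / T) := by
  have ha0 : 0 < a := by linarith
  have had : 0 < a ^ d := by positivity
  have hT0 : 0 < T := by linarith
  have h1 := hV (Set.Icc (A / a ^ d) (B / a ^ d)) measurableSet_Icc
    (Set.Icc_subset_Icc (by rw [le_div_iff₀ had]; linarith) (by rw [div_le_iff₀ had]; linarith))
    (T / a) (by rw [lt_div_iff₀ ha0]; exact hT)
  rw [Real.volume_Icc, ← sub_div, ENNReal.toReal_ofReal (div_nonneg (by linarith) had.le),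
    div_pow] at h1
  have h2 : (volume (formRegion s d g (Set.Icc A B) (T ^ 2))).toReal
      = a ^ n * (volume (formRegion s d g (Set.Icc (A / a ^ d) (B / a ^ d))
        (T ^ 2 / a ^ 2))).toReal := by
    rw [formRegion_smul s d g ha0, Measure.addHaar_smul, ENNReal.toReal_mul, Module.finrank_fin_fun,
      ENNReal.toReal_ofReal (abs_nonneg _), abs_of_nonneg (by positivity)]
  have hTa : (T / a) ^ ((n : ℝ) - d) = T ^ ((n : ℝ) - d) * a ^ d / a ^ n := by
    rw [Real.div_rpow hT0.le ha0.le, Real.rpow_sub ha0 (n : ℝ) d, Real.rpow_natCast,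
      Real.rpow_natCast]
    field_simp
  have hTa' : (T / a) ^ ((n : ℝ) - d - 1) = T ^ ((n : ℝ) - d) * a ^ d / a ^ n * (a / T) := by
    rw [Real.rpow_sub_one (by positivity), hTa]
    field_simp
  rw [hTa, hTa'] at h1
  have han : 0 < a ^ n := by positivity
  have h3 : (volume (formRegion s d g (Set.Icc A B) (T ^ 2))).toReal
      - c * (B - A) * T ^ ((n : ℝ) - d)
      = a ^ n * ((volume (formRegion s d g (Set.Icc (A / a ^ d) (B / a ^ d))
        (T ^ 2 / a ^ 2))).toReal
        - c * ((B - A) / a ^ d) * (T ^ ((n : ℝ) - d) * a ^ d / a ^ n)) := by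
    rw [h2]
    field_simp
  rw [h3, abs_mul, abs_of_pos han]
  calc a ^ n * _ ≤ a ^ n * (CF * ((B - A) / a ^ d)
        * (T ^ ((n : ℝ) - d) * a ^ d / a ^ n * (a / T)) * Real.log (T / a)) := by gcongr
    _ = CF * (B - A) * T ^ ((n : ℝ) - d) * (a * Real.log (T / a) / T) := by
        field_simp
    _ ≤ CF * (B - A) * T ^ ((n : ℝ) - d) * (a * Real.log T / T) := by
        have h4 : Real.log (T / a) ≤ Real.log T :=
          Real.log_le_log (by positivity) (div_le_self hT0.le ha)
        have h5 : 0 ≤ B - A := by linarith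
        gcongr

lemma totalWeight_nonneg {n : ℕ} (s : Fin n → ℝ) (d : ℕ) (h : Matrix (Fin n) (Fin n) ℝ)
    (K T e A B τ : ℝ) (x : Fin n → ℝ) : 0 ≤ totalWeight s d h K T e A B τ x :=
  mul_nonneg (mul_nonneg (Real.smoothTransition.nonneg _) (Real.smoothTransition.nonneg _))
    (ramp_nonneg _ _ _ _)

lemma totalWeight_le_one {n : ℕ} (s : Fin n → ℝ) (d : ℕ) (h : Matrix (Fin n) (Fin n) ℝ)
    (K T e A B τ : ℝ) (x : Fin n → ℝ) : totalWeight s d h K T e A B τ x ≤ 1 :=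
  mul_le_one₀ (mul_le_one₀ (Real.smoothTransition.le_one _) (Real.smoothTransition.nonneg _)
    (Real.smoothTransition.le_one _)) (ramp_nonneg _ _ _ _) (ramp_le_one _ _ _ _)

lemma continuous_totalWeight {n : ℕ} (s : Fin n → ℝ) (d : ℕ) (h : Matrix (Fin n) (Fin n) ℝ)
    (K T e A B τ : ℝ) : Continuous (totalWeight s d h K T e A B τ) := by
  have h1 : Continuous (sqNorm : (Fin n → ℝ) → ℝ) := contDiff_sqNorm.continuous
  have h2 : Continuous fun x : Fin n → ℝ => sqNorm (x ᵥ* h) := (contDiff_sqNorm_vecMul h).continuous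
  have h3 := (contDiff_ramp A B τ).continuous.comp (continuous_signForm s d)
  have h4 := Real.smoothTransition.continuous
  exact ((h4.comp (h1.sub continuous_const)).mul
    (h4.comp (((continuous_const.sub (h2.div_const _)).const_mul K).add continuous_const))).mul h3

/-- `h` approximates the inverse of `g` on the level of Euclidean norms. -/
def ApproxInverse {n : ℕ} (g : SLR n) (C K : ℝ) (h : Matrix (Fin n) (Fin n) ℝ) : Prop :=
  ∀ v, |sqNorm ((v ᵥ* (g : Matrix (Fin n) (Fin n) ℝ)) ᵥ* h) - sqNorm v| ≤ C / K * sqNorm v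

section
variable {n : ℕ} {s : Fin n → ℝ} {d : ℕ} {g : SLR n} {C K T e A B τ : ℝ}
  {h : Matrix (Fin n) (Fin n) ℝ}

lemma of_totalWeight_ne_zero (hK : 0 < K) (hT : 0 < T) (hτ : 0 < τ) (hh : ApproxInverse g C K h)
    {v : Fin n → ℝ}
    (hv : totalWeight s d h K T e A B τ (v ᵥ* (g : Matrix (Fin n) (Fin n) ℝ)) ≠ 0) :
    signForm s d (v ᵥ* (g : Matrix (Fin n) (Fin n) ℝ)) ∈ Set.Ioo A B ∧
      (1 - C / K) * sqNorm v ≤ T ^ 2 * (1 + e / K) := by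
  refine ⟨ramp_ne_zero hτ (right_ne_zero_of_mul hv), ?_⟩
  have h1 := right_ne_zero_of_mul (left_ne_zero_of_mul hv)
  have h2 : 0 < K * (1 - sqNorm ((v ᵥ* (g : Matrix (Fin n) (Fin n) ℝ)) ᵥ* h) / T ^ 2) + e := by
    by_contra! h0
    exact h1 (Real.smoothTransition.zero_of_nonpos h0)
  have h3 := (abs_le.1 (hh v)).1
  have h4 : sqNorm ((v ᵥ* (g : Matrix (Fin n) (Fin n) ℝ)) ᵥ* h) ≤ T ^ 2 * (1 + e / K) := by
    set y := sqNorm ((v ᵥ* (g : Matrix (Fin n) (Fin n) ℝ)) ᵥ* h)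
    have h5 : T ^ 2 * (1 + e / K) - y = T ^ 2 / K * (K * (1 - y / T ^ 2) + e) := by
      field_simp
      ring
    have h6 : 0 ≤ T ^ 2 / K * (K * (1 - y / T ^ 2) + e) := by positivity
    linarith
  linarith

lemma totalWeight_eq_one (hK : 0 < K) (hT : 0 < T) (hτ : 0 < τ) (hh : ApproxInverse g C K h)
    {v : Fin n → ℝ} (h2 : 2 ≤ sqNorm (v ᵥ* (g : Matrix (Fin n) (Fin n) ℝ)))
    (hF : signForm s d (v ᵥ* (g : Matrix (Fin n) (Fin n) ℝ)) ∈ Set.Icc (A + τ) (B - τ))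
    (hv : (1 + C / K) * sqNorm v ≤ T ^ 2 * (1 + (e - 1) / K)) :
    totalWeight s d h K T e A B τ (v ᵥ* (g : Matrix (Fin n) (Fin n) ℝ)) = 1 := by
  rw [totalWeight, ramp_eq_one hτ hF.1 hF.2, Real.smoothTransition.one_of_one_le (by linarith),
    Real.smoothTransition.one_of_one_le, one_mul, one_mul]
  have h3 := (abs_le.1 (hh v)).2
  set y := sqNorm ((v ᵥ* (g : Matrix (Fin n) (Fin n) ℝ)) ᵥ* h)
  have h4 : y ≤ T ^ 2 * (1 + (e - 1) / K) := by linarith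
  have h5 : K * (1 - y / T ^ 2) + e - 1 = K / T ^ 2 * (T ^ 2 * (1 + (e - 1) / K) - y) := by
    field_simp
    ring
  have h6 : 0 ≤ K / T ^ 2 * (T ^ 2 * (1 + (e - 1) / K) - y) :=
    mul_nonneg (by positivity) (by linarith)
  linarith

lemma sqNorm_le_of_totalWeight_ne_zero (hC : 1 ≤ C) (hK : 2 * C ≤ K) (hT : 0 < T) (hτ : 0 < τ)
    (hh : ApproxInverse g C K h) {v : Fin n → ℝ}
    (hv : totalWeight s d h K T e A B τ (v ᵥ* (g : Matrix (Fin n) (Fin n) ℝ)) ≠ 0) :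
    sqNorm v ≤ 2 * (T ^ 2 * (1 + e / K)) := by
  have hK0 : 0 < K := by linarith
  have h1 := (of_totalWeight_ne_zero hK0 hT hτ hh hv).2
  have h2 : C / K ≤ 1 / 2 := by
    rw [div_le_div_iff₀ hK0 two_pos]
    linarith
  have h3 := sqNorm_nonneg v
  nlinarith

lemma hasFiniteSupport_totalWeight (hC : 1 ≤ C) (hK : 2 * C ≤ K) (hT : 0 < T) (hτ : 0 < τ)
    (hh : ApproxInverse g C K h) : (fun v : Fin n → ℤ =>
      totalWeight s d h K T e A B τ (intVec v ᵥ* (g : Matrix (Fin n) (Fin n) ℝ))).HasFiniteSupport :=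
  (finite_setOf_sqNorm_intVec_le n (2 * (T ^ 2 * (1 + e / K)))).subset fun _ hv =>
    sqNorm_le_of_totalWeight_ne_zero hC hK hT hτ hh hv

lemma integrable_totalWeight (hC : 1 ≤ C) (hK : 2 * C ≤ K) (hT : 0 < T) (hτ : 0 < τ)
    (hh : ApproxInverse g C K h) : Integrable fun v : Fin n → ℝ =>
      totalWeight s d h K T e A B τ (v ᵥ* (g : Matrix (Fin n) (Fin n) ℝ)) := by
  have hsupp : (Function.support fun v : Fin n → ℝ =>
      totalWeight s d h K T e A B τ (v ᵥ* (g : Matrix (Fin n) (Fin n) ℝ)))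
      ⊆ Metric.closedBall 0 √(2 * (T ^ 2 * (1 + e / K))) := fun v hv => by
    rw [mem_closedBall_zero_iff]
    exact (norm_le_sqrt_sqNorm v).trans
      (Real.sqrt_le_sqrt (sqNorm_le_of_totalWeight_ne_zero hC hK hT hτ hh hv))
  rw [← integrableOn_iff_integrable_of_support_subset hsupp]
  refine Measure.integrableOn_of_bounded (M := 1) measure_closedBall_lt_top.ne
    ((continuous_totalWeight s d h K T e A B τ).comp
      (Continuous.matrix_vecMul continuous_id continuous_const)).aestronglyMeasurable
    (Eventually.of_forall fun x => ?_)
  rw [Real.norm_of_nonneg (totalWeight_nonneg _ _ _ _ _ _ _ _ _ _)]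
  exact totalWeight_le_one _ _ _ _ _ _ _ _ _ _

lemma integral_totalWeight_le (hC : 1 ≤ C) (hK : 2 * C ≤ K) (hT : 0 < T) (hτ : 0 < τ)
    (hh : ApproxInverse g C K h) (he : 0 ≤ e) :
    ∫ x, totalWeight s d h K T e A B τ x
      ≤ (volume (formRegion s d g (Set.Icc A B) (T ^ 2 * (1 + 2 * (e + C) / K)))).toReal := by
  have hK0 : 0 < K := by linarith
  rw [← integral_vecMul g]
  set S := formRegion s d g (Set.Icc A B) (T ^ 2 * (1 + 2 * (e + C) / K)) with hS
  have hSm : MeasurableSet S := measurableSet_formRegion s d g measurableSet_Icc _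
  have hSi : Integrable (S.indicator fun _ => (1 : ℝ)) :=
    (integrable_indicator_iff hSm).2 (integrableOn_const (volume_formRegion_ne_top s d g _ _))
  have hle : ∀ v, totalWeight s d h K T e A B τ (v ᵥ* (g : Matrix (Fin n) (Fin n) ℝ))
      ≤ S.indicator (fun _ => (1 : ℝ)) v := fun v => by
    by_cases hv : totalWeight s d h K T e A B τ (v ᵥ* (g : Matrix (Fin n) (Fin n) ℝ)) = 0
    · rw [hv]
      exact Set.indicator_nonneg (fun _ _ => zero_le_one) v
    · obtain ⟨h1, h2⟩ := of_totalWeight_ne_zero hK0 hT hτ hh hv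
      have h3 : v ∈ S := by
        refine ⟨Set.Ioo_subset_Icc_self h1, ?_⟩
        have h4 : C / K ≤ 1 / 2 := by
          rw [div_le_div_iff₀ hK0 two_pos]
          linarith
        have h5 : 1 + e / K ≤ (1 - C / K) * (1 + 2 * (e + C) / K) := by
          have h6 : 0 ≤ e / K := by positivity
          have h7 : 0 ≤ C / K := by positivity
          have h8 : 2 * (e + C) / K = 2 * (e / K) + 2 * (C / K) := by ring
          rw [h8]
          nlinarith
        have h6 : (1 - C / K) * sqNorm v
            ≤ (1 - C / K) * (T ^ 2 * (1 + 2 * (e + C) / K)) := by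
          refine h2.trans ?_
          have := mul_le_mul_of_nonneg_left h5 (sq_nonneg T)
          linarith
        exact le_of_mul_le_mul_left h6 (by linarith)
      rw [Set.indicator_of_mem h3]
      exact totalWeight_le_one _ _ _ _ _ _ _ _ _ _
  refine (integral_mono_of_nonneg (Eventually.of_forall fun v =>
    totalWeight_nonneg _ _ _ _ _ _ _ _ _ _) hSi (Eventually.of_forall hle)).trans (le_of_eq ?_)
  rw [integral_indicator hSm, setIntegral_const]
  simp [Measure.real]

lemma le_integral_totalWeight (hC : 1 ≤ C) (hK : 2 * C ≤ K) (hT : 0 < T) (hτ : 0 < τ)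
    (hh : ApproxInverse g C K h) {R : ℝ} (hR : (1 + C / K) * R ≤ T ^ 2 * (1 + (e - 1) / K)) :
    (volume (formRegion s d g (Set.Icc (A + τ) (B - τ)) R)).toReal
      - (volume {v : Fin n → ℝ | sqNorm (v ᵥ* (g : Matrix (Fin n) (Fin n) ℝ)) ≤ 2}).toReal
      ≤ ∫ x, totalWeight s d h K T e A B τ x := by
  have hK0 : 0 < K := by linarith
  rw [← integral_vecMul g]
  set S := formRegion s d g (Set.Icc (A + τ) (B - τ)) R with hS
  set Z := {v : Fin n → ℝ | sqNorm (v ᵥ* (g : Matrix (Fin n) (Fin n) ℝ)) ≤ 2} with hZ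
  have hSm : MeasurableSet S := measurableSet_formRegion s d g measurableSet_Icc _
  have hZm : MeasurableSet Z :=
    (contDiff_sqNorm_vecMul (g : Matrix (Fin n) (Fin n) ℝ)).continuous.measurable measurableSet_Iic
  have hZt : volume Z ≠ ⊤ := by
    obtain ⟨C₀, hC₀, hC', -⟩ := exists_sqNorm_le_vecMul g
    have : Z ⊆ Metric.closedBall 0 √(C₀ * 2) := fun v hv => by
      rw [mem_closedBall_zero_iff]
      refine (norm_le_sqrt_sqNorm v).trans (Real.sqrt_le_sqrt ((hC' v).trans ?_))
      exact mul_le_mul_of_nonneg_left hv (by linarith)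
    exact ((measure_mono this).trans_lt measure_closedBall_lt_top).ne
  have hSi : Integrable (S.indicator fun _ => (1 : ℝ)) :=
    (integrable_indicator_iff hSm).2 (integrableOn_const (volume_formRegion_ne_top s d g _ _))
  have hZi : Integrable (Z.indicator fun _ => (1 : ℝ)) :=
    (integrable_indicator_iff hZm).2 (integrableOn_const hZt)
  have hle : ∀ v, S.indicator (fun _ => (1 : ℝ)) v - Z.indicator (fun _ => (1 : ℝ)) v
      ≤ totalWeight s d h K T e A B τ (v ᵥ* (g : Matrix (Fin n) (Fin n) ℝ)) := fun v => by
    have h0 := totalWeight_nonneg s d h K T e A B τ (v ᵥ* (g : Matrix (Fin n) (Fin n) ℝ))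
    by_cases hvS : v ∈ S
    · by_cases hvZ : v ∈ Z
      · rw [Set.indicator_of_mem hvS, Set.indicator_of_mem hvZ]
        linarith
      · rw [Set.indicator_of_mem hvS, Set.indicator_of_notMem hvZ, totalWeight_eq_one hK0 hT hτ hh
          (not_le.1 hvZ).le hvS.1, sub_zero]
        refine le_trans (mul_le_mul_of_nonneg_left hvS.2 ?_) hR
        positivity
    · rw [Set.indicator_of_notMem hvS]
      have : 0 ≤ Z.indicator (fun _ => (1 : ℝ)) v :=
        Set.indicator_nonneg (fun _ _ => zero_le_one) v
      linarith
  refine le_trans (le_of_eq ?_) (integral_mono (hSi.sub hZi)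
    (integrable_totalWeight hC hK hT hτ hh) hle)
  simp only [Pi.sub_apply]
  rw [integral_sub hSi hZi, integral_indicator hSm, integral_indicator hZm, setIntegral_const,
    setIntegral_const]
  simp [Measure.real]

/-- Integer vectors counted in the theorem. -/
def latticeRegion {n : ℕ} (s : Fin n → ℝ) (d : ℕ) (g : SLR n) (I : Set ℝ) (R : ℝ) :
    Set (Fin n → ℤ) :=
  {v | signForm s d (intVec v ᵥ* (g : Matrix (Fin n) (Fin n) ℝ)) ∈ I ∧ sqNorm (intVec v) ≤ R}

lemma finite_latticeRegion (s : Fin n → ℝ) (d : ℕ) (g : SLR n) (I : Set ℝ) (R : ℝ) :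
    (latticeRegion s d g I R).Finite :=
  (finite_setOf_sqNorm_intVec_le n R).subset fun _ hv => hv.2

lemma ncard_latticeRegion_le (hC : 1 ≤ C) (hK : 2 * C ≤ K) (hT : 0 < T) (hτ : 0 < τ)
    (hh : ApproxInverse g C K h) {I : Set ℝ} {R : ℝ} (hI : I ⊆ Set.Icc (A + τ) (B - τ))
    (hR : (1 + C / K) * R ≤ T ^ 2 * (1 + (e - 1) / K)) :
    ((latticeRegion s d g I R).ncard : ℝ)
      ≤ ({v : Fin n → ℤ | sqNorm (intVec v ᵥ* (g : Matrix (Fin n) (Fin n) ℝ)) ≤ 2}.ncard : ℝ)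
        + ∑' v : Fin n → ℤ,
          totalWeight s d h K T e A B τ (intVec v ᵥ* (g : Matrix (Fin n) (Fin n) ℝ)) := by
  have hK0 : 0 < K := by linarith
  set Z := {v : Fin n → ℤ | sqNorm (intVec v ᵥ* (g : Matrix (Fin n) (Fin n) ℝ)) ≤ 2} with hZ
  have hZf : Z.Finite := by
    obtain ⟨C₀, hC₀, hC', -⟩ := exists_sqNorm_le_vecMul g
    refine (finite_setOf_sqNorm_intVec_le n (C₀ * 2)).subset fun v hv => (hC' _).trans ?_
    exact mul_le_mul_of_nonneg_left hv (by linarith)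
  set L := latticeRegion s d g I R with hL
  have hLf : L.Finite := finite_latticeRegion s d g I R
  have hDf : (L \ Z).Finite := hLf.sdiff
  have h1 : L.ncard ≤ Z.ncard + (L \ Z).ncard :=
    (Set.ncard_le_ncard (fun v hv => by
      by_cases h : v ∈ Z
      exacts [Or.inl h, Or.inr ⟨hv, h⟩]) (hZf.union hDf)).trans (Set.ncard_union_le _ _)
  have h2 : ((L \ Z).ncard : ℝ) ≤ ∑' v : Fin n → ℤ,
      totalWeight s d h K T e A B τ (intVec v ᵥ* (g : Matrix (Fin n) (Fin n) ℝ)) := by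
    rw [Set.ncard_eq_toFinset_card _ hDf]
    refine le_trans (le_of_eq ?_) (Summable.sum_le_tsum hDf.toFinset
      (fun v _ => totalWeight_nonneg _ _ _ _ _ _ _ _ _ _) (summable_of_hasFiniteSupport
        (hasFiniteSupport_totalWeight hC hK hT hτ hh)))
    rw [Finset.sum_congr rfl fun v hv => ?_, Finset.sum_const, nsmul_eq_mul, mul_one]
    obtain ⟨hv1, hv2⟩ := hDf.mem_toFinset.1 hv
    refine totalWeight_eq_one hK0 hT hτ hh (not_le.1 hv2).le (hI hv1.1)
      (le_trans (mul_le_mul_of_nonneg_left hv1.2 ?_) hR)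
    positivity
  have h3 : (L.ncard : ℝ) ≤ Z.ncard + (L \ Z).ncard := by exact_mod_cast h1
  linarith

lemma tsum_totalWeight_le (hC : 1 ≤ C) (hK : 2 * C ≤ K) (hT : 0 < T) (hτ : 0 < τ)
    (hh : ApproxInverse g C K h) {I : Set ℝ} {R : ℝ} (hI : Set.Ioo A B ⊆ I) (he : e ≤ -C)
    (hR : T ^ 2 ≤ R) :
    ∑' v : Fin n → ℤ, totalWeight s d h K T e A B τ (intVec v ᵥ* (g : Matrix (Fin n) (Fin n) ℝ))
      ≤ ((latticeRegion s d g I R).ncard : ℝ) := by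
  have hK0 : 0 < K := by linarith
  have hLf : (latticeRegion s d g I R).Finite := finite_latticeRegion s d g I R
  rw [tsum_eq_sum (s := hLf.toFinset), Set.ncard_eq_toFinset_card _ hLf]
  · refine (Finset.sum_le_card_nsmul _ _ 1 fun v _ =>
      totalWeight_le_one _ _ _ _ _ _ _ _ _ _).trans (le_of_eq (by simp))
  · intro v hv
    by_contra hne
    refine hv (hLf.mem_toFinset.2 ?_)
    obtain ⟨h1, h2⟩ := of_totalWeight_ne_zero hK0 hT hτ hh hne
    refine ⟨hI h1, ?_⟩
    have h3 : C / K ≤ 1 / 2 := by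
      rw [div_le_div_iff₀ hK0 two_pos]
      linarith
    have h4 : e / K ≤ -(C / K) := by
      rw [← neg_div]
      gcongr
    have h5 : (1 - C / K) * sqNorm (intVec v) ≤ (1 - C / K) * T ^ 2 := by
      have := mul_le_mul_of_nonneg_left h4 (sq_nonneg T)
      nlinarith
    exact (le_of_mul_le_mul_left h5 (by linarith)).trans hR

end

lemma one_le_natCast_pow {K : ℕ} (hK : 1 ≤ K) (M : ℕ) : (1 : ℝ) ≤ (K : ℝ) ^ M :=
  one_le_pow₀ (by exact_mod_cast hK)

lemma natCast_pow_rpow_le {K M : ℕ} (hK : 1 ≤ K) {x : ℝ} {j : ℕ} (h : j ≤ M * x) :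
    ((K : ℝ) ^ M) ^ (-x) ≤ ((K : ℝ) ^ j)⁻¹ := by
  have hK1 : (1 : ℝ) ≤ K := by exact_mod_cast hK
  rw [← Real.rpow_natCast, ← Real.rpow_mul (by linarith), ← Real.rpow_natCast,
    ← Real.rpow_neg (by linarith)]
  exact Real.rpow_le_rpow_of_exponent_le hK1 (by linarith)

lemma log_two_mul_natCast_pow_le {K M : ℕ} (hK : 1 ≤ K) (hM : 1 ≤ M) :
    Real.log (2 * (K : ℝ) ^ M) ≤ 2 * M * K := by
  have hK1 : (1 : ℝ) ≤ K := by exact_mod_cast hK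
  have hM1 : (1 : ℝ) ≤ M := by exact_mod_cast hM
  rw [Real.log_mul two_ne_zero (by positivity), Real.log_pow]
  have h1 := Real.log_le_sub_one_of_pos two_pos
  have h2 := Real.log_le_sub_one_of_pos (by linarith : (0 : ℝ) < K)
  nlinarith

/-- The hypothesis on the volumes of `F⁻¹(I) ∩ B_T` for `I` inside `[-1, 1]`. -/
def VolumeAsymptotic {n : ℕ} (s : Fin n → ℝ) (d : ℕ) (g : SLR n) (c CF : ℝ) : Prop :=
  ∀ I : Set ℝ, MeasurableSet I → I ⊆ Set.Icc (-1) 1 → ∀ T : ℝ, 2 < T →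
    |(volume (formRegion s d g I (T ^ 2))).toReal - c * (volume I).toReal * T ^ ((n : ℝ) - d)|
      ≤ CF * (volume I).toReal * T ^ ((n : ℝ) - d - 1) * Real.log T

section
variable {n : ℕ} {s : Fin n → ℝ} {d : ℕ} {g : SLR n} {c CF : ℝ}

lemma eventually_abs_volume_sub_le (hd : 1 ≤ d) (hCF : 0 ≤ CF) (hV : VolumeAsymptotic s d g c CF)
    {M : ℕ} (hM : 1 ≤ M) {η : ℝ} (hη : 0 ≤ η) (hMη : 2 ≤ M * (1 - η / d)) {c₁ : ℝ} (hc₁ : 1 ≤ c₁) :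
    ∃ C : ℝ, 0 ≤ C ∧ ∀ᶠ K : ℕ in atTop, ∀ A B R : ℝ, A ≤ B → -(c₁ * ((K : ℝ) ^ M) ^ η) ≤ A →
      B ≤ c₁ * ((K : ℝ) ^ M) ^ η → (K : ℝ) ^ M ≤ 2 * R → R ≤ 2 * (K : ℝ) ^ M →
      |(volume (formRegion s d g (Set.Icc A B) (R ^ 2))).toReal - c * (B - A) * R ^ ((n : ℝ) - d)|
        ≤ C / K * (B - A) * R ^ ((n : ℝ) - d) := by
  refine ⟨CF * (4 * c₁ * M), by positivity, ?_⟩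
  filter_upwards [eventually_ge_atTop 1, eventually_gt_atTop ⌈4 * c₁⌉₊] with K hK hKc
    A B R hAB hA hB hR1 hR2
  have hK1 : (1 : ℝ) ≤ K := by exact_mod_cast hK
  have hKc' : 4 * c₁ < K := Nat.lt_of_ceil_lt hKc
  have hd0 : (0 : ℝ) < d := by exact_mod_cast hd
  have hT1 : (1 : ℝ) ≤ (K : ℝ) ^ M := one_le_natCast_pow hK M
  have hR0 : 0 < R := by linarith
  set T : ℝ := (K : ℝ) ^ M with hT
  set a : ℝ := c₁ * T ^ (η / d) with ha
  have ha1 : 1 ≤ a := one_le_mul_of_one_le_of_one_le hc₁ (Real.one_le_rpow hT1 (by positivity))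
  have had : c₁ * T ^ η ≤ a ^ d := by
    rw [ha, mul_pow, ← Real.rpow_natCast (T ^ (η / d)), ← Real.rpow_mul (by linarith),
      div_mul_cancel₀ _ hd0.ne']
    have := le_self_pow₀ hc₁ (by omega : d ≠ 0)
    gcongr
  have hTK : T ^ (η / d) ≤ T * ((K : ℝ) ^ 2)⁻¹ := by
    have h1 := natCast_pow_rpow_le hK (M := M) (x := 1 - η / d) (j := 2) (by exact_mod_cast hMη)
    rw [neg_sub, Real.rpow_sub_one (by positivity), div_le_iff₀ (by positivity), mul_comm] at h1
    exact h1
  have haT : a * K ^ 2 ≤ c₁ * T := by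
    rw [ha, mul_assoc]
    refine mul_le_mul_of_nonneg_left ?_ (by linarith)
    rwa [← div_eq_mul_inv, le_div_iff₀ (by positivity)] at hTK
  have h2a : 2 * a < R := by
    have h1 : (4 * a) * K ^ 2 < T * K ^ 2 := by
      have h2 : (4 * c₁) * T < K * T := by gcongr
      have h3 : (K : ℝ) * T ≤ K ^ 2 * T := by
        gcongr
        nlinarith
      linarith
    have := lt_of_mul_lt_mul_right h1 (by positivity)
    linarith
  refine (abs_volume_formRegion_sub_le hCF hV ha1 hAB (by linarith) (by linarith) h2a).trans ?_
  have hlog : Real.log R ≤ 2 * M * K :=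
    (Real.log_le_log hR0 hR2).trans (log_two_mul_natCast_pow_le hK hM)
  have hB0 : 0 ≤ B - A := by linarith
  have hmain : a * Real.log R / R ≤ 4 * c₁ * M / K := by
    rw [div_le_div_iff₀ hR0 (by linarith)]
    have hK0 : (0 : ℝ) ≤ K := by linarith
    calc a * Real.log R * K ≤ a * (2 * M * K) * K := by gcongr
      _ = 2 * M * (a * K ^ 2) := by ring
      _ ≤ 2 * M * (c₁ * (2 * R)) := by
          exact mul_le_mul_of_nonneg_left (haT.trans (by gcongr)) (by positivity)
      _ = 4 * c₁ * M * R := by ring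
  calc CF * (B - A) * R ^ ((n : ℝ) - d) * (a * Real.log R / R)
      ≤ CF * (B - A) * R ^ ((n : ℝ) - d) * (4 * c₁ * M / K) := by gcongr
    _ = CF * (4 * c₁ * M) / K * (B - A) * R ^ ((n : ℝ) - d) := by ring

lemma eventually_abs_rpow_sub_one_le (Y ν : ℝ) : ∃ C : ℝ, 0 ≤ C ∧ ∀ᶠ K : ℕ in atTop,
    |(1 + Y / K) ^ ν - 1| ≤ C / (K : ℝ) := by
  have h1 : HasDerivAt (fun x : ℝ => (1 + x) ^ ν) (1 * ν * (1 + 0) ^ (ν - 1)) 0 :=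
    ((hasDerivAt_id (0 : ℝ)).const_add 1).rpow_const (Or.inl (by simp))
  have h2 := h1.differentiableAt.isBigO_sub
  have h3 : Tendsto (fun K : ℕ => Y / (K : ℝ)) atTop (nhds 0) := tendsto_const_div_atTop_nhds_zero_nat Y
  obtain ⟨C, hC, h4⟩ := (h2.comp_tendsto h3).exists_nonneg
  refine ⟨C * |Y|, by positivity, ?_⟩
  filter_upwards [h4.bound] with K hK
  simp only [Function.comp_apply, add_zero, Real.one_rpow, sub_zero, Real.norm_eq_abs, abs_div,
    Nat.abs_cast] at hK
  rwa [mul_div_assoc]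

/-- Volumes of the regions of interest for a thickening of an interval of length `T ^ (-κ)`. -/
lemma eventually_abs_volume_thickening_sub_le (hc : 0 ≤ c) (hd : 1 ≤ d) (hCF : 0 ≤ CF)
    (hV : VolumeAsymptotic s d g c CF)
    {M : ℕ} (hM : 1 ≤ M) {η : ℝ} (hη : 0 ≤ η) (hMη : 2 ≤ M * (1 - η / d)) {c₁ : ℝ} (hc₁ : 1 ≤ c₁)
    (w Y κ : ℝ) :
    ∃ C : ℝ, 0 ≤ C ∧ ∀ᶠ K : ℕ in atTop, ∀ A : ℝ, -(c₁ * ((K : ℝ) ^ M) ^ η) ≤ A →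
      A + (K + w) * (((K : ℝ) ^ M) ^ (-κ) / K) ≤ c₁ * ((K : ℝ) ^ M) ^ η →
      |(volume (formRegion s d g (Set.Icc A (A + (K + w) * (((K : ℝ) ^ M) ^ (-κ) / K)))
        (((K : ℝ) ^ M) ^ 2 * (1 + Y / K)))).toReal - c * ((K : ℝ) ^ M) ^ ((n : ℝ) - d - κ)|
        ≤ C / K * ((K : ℝ) ^ M) ^ ((n : ℝ) - d - κ) := by
  obtain ⟨C₁, hC₁, h₁⟩ := eventually_abs_volume_sub_le hd hCF hV hM hη hMη hc₁
  obtain ⟨C₂, hC₂, h₂⟩ := eventually_abs_rpow_sub_one_le Y (1 / 2 * ((n : ℝ) - d))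
  refine ⟨C₁ * ((1 + C₂) * (1 + |w|)) + c * (C₂ + |w| + C₂ * |w|), by positivity, ?_⟩
  filter_upwards [h₁, h₂, eventually_ge_atTop 1, eventually_ge_atTop ⌈2 * |Y|⌉₊,
    eventually_ge_atTop ⌈|w|⌉₊] with K h₁ h₂ hK hKY hKw A hA hB
  have hK1 : (1 : ℝ) ≤ K := by exact_mod_cast hK
  have hK0 : (0 : ℝ) < K := by linarith
  have hKY' : 2 * |Y| ≤ K := (Nat.le_ceil _).trans (by exact_mod_cast hKY)
  have hKw' : |w| ≤ K := (Nat.le_ceil _).trans (by exact_mod_cast hKw)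
  have hT1 : (1 : ℝ) ≤ (K : ℝ) ^ M := one_le_natCast_pow hK M
  set T : ℝ := (K : ℝ) ^ M with hT
  have hT0 : 0 < T := by linarith
  have hy : |Y / K| ≤ 1 / 2 := by
    rw [abs_div, Nat.abs_cast, div_le_div_iff₀ hK0 two_pos]
    linarith
  have hy' := abs_le.1 hy
  set y := Y / K with hydef
  have hy0 : 0 < 1 + y := by linarith
  set R := T * (1 + y) ^ (1 / 2 : ℝ) with hR
  have hsq : R ^ 2 = T ^ 2 * (1 + y) := by
    rw [hR, mul_pow, ← Real.sqrt_eq_rpow, Real.sq_sqrt hy0.le]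
  have hR0 : 0 < R := by positivity
  have hR1 : T ≤ 2 * R := by
    refine le_of_sq_le_sq ?_ (by positivity)
    nlinarith [sq_nonneg T]
  have hR2 : R ≤ 2 * T := by
    refine le_of_sq_le_sq ?_ (by positivity)
    nlinarith [sq_nonneg T]
  have hlen : 0 ≤ (K + w) * (T ^ (-κ) / K) :=
    mul_nonneg (by linarith [neg_abs_le w]) (by positivity)
  have h3 := h₁ A (A + (K + w) * (T ^ (-κ) / K)) R (by linarith) hA hB hR1 hR2
  rw [hsq, add_sub_cancel_left] at h3
  have hRν : R ^ ((n : ℝ) - d) = T ^ ((n : ℝ) - d) * (1 + y) ^ (1 / 2 * ((n : ℝ) - d)) := by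
    rw [hR, Real.mul_rpow hT0.le (by positivity), ← Real.rpow_mul hy0.le]
  have hTa : T ^ ((n : ℝ) - d - κ) = T ^ ((n : ℝ) - d) * T ^ (-κ) := by
    rw [← Real.rpow_add hT0, ← sub_eq_add_neg]
  set ρ := (1 + y) ^ (1 / 2 * ((n : ℝ) - d)) - 1 with hρ
  have hlen' : (K + w) * (T ^ (-κ) / K) * R ^ ((n : ℝ) - d)
      = T ^ ((n : ℝ) - d - κ) * ((1 + w / K) * (1 + ρ)) := by
    rw [hRν, hTa, hρ]
    field_simp
    ring
  rw [mul_assoc c, mul_assoc (C₁ / K), hlen'] at h3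
  set V := (volume (formRegion s d g (Set.Icc A (A + (K + w) * (T ^ (-κ) / K)))
    (T ^ 2 * (1 + y)))).toReal
  set X := T ^ ((n : ℝ) - d - κ) with hX
  have hX0 : 0 < X := by positivity
  have hwK : |w / K| ≤ |w| / K := by rw [abs_div, Nat.abs_cast]
  have hwK' : |w| / K ≤ |w| := div_le_self (abs_nonneg _) hK1
  have hρ' : |ρ| ≤ C₂ := h₂.trans (div_le_self hC₂ hK1)
  have h4 : |(1 + w / K) * (1 + ρ)| ≤ (1 + C₂) * (1 + |w|) := by
    rw [abs_mul, mul_comm]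
    refine mul_le_mul ((abs_add_le _ _).trans ?_) ((abs_add_le _ _).trans ?_) (abs_nonneg _)
      (by positivity)
    · rw [abs_one]; linarith
    · rw [abs_one]; linarith
  have h5 : |(1 + w / K) * (1 + ρ) - 1| ≤ (C₂ + |w| + C₂ * |w|) / K := by
    have h6 : (1 + w / K) * (1 + ρ) - 1 = ρ + w / K + ρ * (w / K) := by ring
    rw [h6]
    refine (abs_add_le _ _).trans ((add_le_add (abs_add_le _ _) (le_of_eq (abs_mul _ _))).trans ?_)
    have h7 : |ρ| * |w / K| ≤ C₂ * (|w| / K) := by gcongr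
    have h8 : (C₂ + |w| + C₂ * |w|) / K = C₂ / K + |w| / K + C₂ * (|w| / K) := by ring
    rw [h8]
    linarith
  have h6 : V - c * X = (V - c * (X * ((1 + w / K) * (1 + ρ))))
      + c * X * ((1 + w / K) * (1 + ρ) - 1) := by ring
  rw [h6]
  refine (abs_add_le _ _).trans ?_
  rw [abs_mul (c * X), abs_of_nonneg (by positivity : 0 ≤ c * X)]
  calc _ ≤ C₁ / K * (X * ((1 + C₂) * (1 + |w|))) + c * X * ((C₂ + |w| + C₂ * |w|) / K) := by
        refine add_le_add (h3.trans ?_) (by gcongr)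
        have := le_of_abs_le h4
        gcongr
    _ = _ := by ring

end

lemma one_add_pow_le_one_add {x : ℝ} (hx : 0 ≤ x) (hx1 : x ≤ 1) (k : ℕ) :
    (1 + x) ^ k ≤ 1 + 3 ^ k * x := by
  induction k with
  | zero => simp [hx]
  | succ k ih =>
    have h1 : (1 : ℝ) ≤ 3 ^ k := one_le_pow₀ (by norm_num)
    calc (1 + x) ^ (k + 1) ≤ (1 + 3 ^ k * x) * (1 + x) := by
          rw [pow_succ]
          gcongr
      _ ≤ 1 + 3 ^ (k + 1) * x := by
          rw [pow_succ]
          have h2 : 3 ^ k * x * x ≤ 3 ^ k * x * 1 := by gcongr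
          nlinarith

lemma le_natCast_pow_mul {K M : ℕ} (hK : 1 ≤ K) {t : ℝ} (ht : t ≤ ((K : ℝ) + 1) ^ M) :
    t ≤ (K : ℝ) ^ M * (1 + 3 ^ M / K) := by
  have hK1 : (1 : ℝ) ≤ K := by exact_mod_cast hK
  have h1 : ((K : ℝ) + 1) ^ M = (K : ℝ) ^ M * (1 + 1 / K) ^ M := by
    rw [← mul_pow]
    congr 1
    field_simp
  have h2 := one_add_pow_le_one_add (x := 1 / (K : ℝ)) (by positivity)
    ((div_le_one (by linarith)).2 hK1) M
  rw [mul_one_div] at h2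
  rw [h1] at ht
  exact ht.trans (by gcongr)

lemma sq_le_natCast_pow_mul {K M : ℕ} (hK : 1 ≤ K) {t : ℝ} (ht0 : 0 ≤ t)
    (ht : t ≤ ((K : ℝ) + 1) ^ M) : t ^ 2 ≤ ((K : ℝ) ^ M) ^ 2 * (1 + 3 ^ (M * 2) / K) := by
  rw [← pow_mul]
  refine le_natCast_pow_mul hK ?_
  rw [pow_mul]
  gcongr

lemma mul_one_sub_le_rpow_neg {T t x δ : ℝ} (hT : 0 < T) (hTt : T ≤ t) (ht : t ≤ T * (1 + δ))
    (hx : 0 ≤ x) : T ^ (-x) * (1 - x * δ) ≤ t ^ (-x) := by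
  have ht0 : 0 < t := hT.trans_le hTt
  have h1 : t ^ (-x) = T ^ (-x) * (t / T) ^ (-x) := by
    rw [← Real.mul_rpow hT.le (by positivity), mul_div_cancel₀ _ hT.ne']
  rw [h1]
  refine mul_le_mul_of_nonneg_left ?_ (by positivity)
  have h2 : t / T ≤ 1 + δ := by
    rw [div_le_iff₀ hT]
    linarith
  have h3 := Real.log_le_sub_one_of_pos (div_pos ht0 hT)
  rw [Real.rpow_def_of_pos (by positivity)]
  have h4 := Real.add_one_le_exp (Real.log (t / T) * -x)
  nlinarith

lemma rpow_mul_one_sub_le {T t x δ : ℝ} (hT : 0 < T) (hTt : T ≤ t) (ht : t ≤ T * (1 + δ))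
    (hx : 0 ≤ x) : t ^ x * (1 - x * δ) ≤ T ^ x := by
  have ht0 : 0 < t := hT.trans_le hTt
  have h1 := mul_one_sub_le_rpow_neg hT hTt ht hx
  rw [Real.rpow_neg hT.le, Real.rpow_neg ht0.le] at h1
  have h2 : 0 < T ^ x := by positivity
  have h3 : 0 < t ^ x := by positivity
  rw [inv_mul_le_iff₀ h2, ← div_eq_mul_inv, le_div_iff₀ h3] at h1
  linarith

lemma mem_paramSet {n r M K : ℕ} {θ : ℝ} {l : ℤ} {H : Fin n → Fin n → ℤ}
    (hl : |(l : ℝ)| ≤ (K : ℝ) ^ 2 * ((K : ℝ) ^ M) ^ θ)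
    (hH : ∀ a b, H a b ∈ Finset.Icc (-(r * K : ℕ) : ℤ) (r * K : ℕ)) :
    (l, H) ∈ paramSet n r M θ K := by
  rw [paramSet, Finset.mem_product]
  constructor
  · rw [Finset.mem_Icc, ← abs_le, Int.abs_eq_natAbs, Nat.cast_le]
    refine Nat.le_floor ?_
    rwa [Nat.cast_natAbs, Int.cast_abs]
  · exact Fintype.mem_piFinset.2 fun a => Fintype.mem_piFinset.2 fun b => hH a b

/-- The weighted lattice point counts agree with the integrals up to `O(T ^ lam)`. -/
def CountAsymptotic {n : ℕ} (s : Fin n → ℝ) (d : ℕ) (g : SLR n) (M : ℕ) (η κ lam e e' : ℝ) : Prop :=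
  ∃ r₀ : ℕ, ∀ r ≥ r₀, ∃ C : ℝ, ∀ᶠ K : ℕ in atTop,
    ∀ p ∈ paramSet n r M (η + κ) K, BoundedMatrix r (ratMatrix p.2 K) →
      |∑' v : Fin n → ℤ, totalWeight s d (ratMatrix p.2 K) K ((K : ℝ) ^ M) e'
        (p.1 * (((K : ℝ) ^ M) ^ (-κ) / K))
        (p.1 * (((K : ℝ) ^ M) ^ (-κ) / K) + (K + e) * (((K : ℝ) ^ M) ^ (-κ) / K))
        (((K : ℝ) ^ M) ^ (-κ) / K) (intVec v ᵥ* (g : Matrix (Fin n) (Fin n) ℝ))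
      - ∫ x, totalWeight s d (ratMatrix p.2 K) K ((K : ℝ) ^ M) e'
        (p.1 * (((K : ℝ) ^ M) ^ (-κ) / K))
        (p.1 * (((K : ℝ) ^ M) ^ (-κ) / K) + (K + e) * (((K : ℝ) ^ M) ^ (-κ) / K))
        (((K : ℝ) ^ M) ^ (-κ) / K) x| ≤ C * ((K : ℝ) ^ M) ^ lam

/-- Locating a point in the grid of mesh `T ^ (-κ) / K`. -/
lemma exists_grid_point {K M : ℕ} (hK : 1 ≤ K) {η κ c₀ : ℝ} (hη : 0 ≤ η) (hκ : 0 < κ)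
    (hKc : c₀ + 2 ≤ K) {a : ℝ} (ha : |a| ≤ c₀ * ((K : ℝ) ^ M) ^ η) :
    ∃ l : ℤ, l * (((K : ℝ) ^ M) ^ (-κ) / K) ≤ a ∧
      a < l * (((K : ℝ) ^ M) ^ (-κ) / K) + ((K : ℝ) ^ M) ^ (-κ) / K ∧
      |((l - 1 : ℤ) : ℝ)| ≤ (K : ℝ) ^ 2 * ((K : ℝ) ^ M) ^ (η + κ) ∧
      |((l + 1 : ℤ) : ℝ)| ≤ (K : ℝ) ^ 2 * ((K : ℝ) ^ M) ^ (η + κ) := by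
  have hK1 : (1 : ℝ) ≤ K := by exact_mod_cast hK
  have hT1 : (1 : ℝ) ≤ (K : ℝ) ^ M := one_le_natCast_pow hK M
  set T : ℝ := (K : ℝ) ^ M
  have hT0 : 0 < T := by linarith
  set τ : ℝ := T ^ (-κ) / K with hτ
  have hτ0 : 0 < τ := by positivity
  have h1 : (⌊a / τ⌋ : ℝ) ≤ a / τ := Int.floor_le _
  have h2 : a / τ < ⌊a / τ⌋ + 1 := Int.lt_floor_add_one _
  have h3 : |a / τ| ≤ c₀ * K * T ^ (η + κ) := by
    rw [abs_div, abs_of_pos hτ0, div_le_iff₀ hτ0]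
    refine ha.trans (le_of_eq ?_)
    rw [hτ, Real.rpow_add hT0, Real.rpow_neg hT0.le]
    field_simp
  have h4 : 1 ≤ T ^ (η + κ) := Real.one_le_rpow hT1 (by linarith)
  have h5 : c₀ * K * T ^ (η + κ) + 2 ≤ (K : ℝ) ^ 2 * T ^ (η + κ) := by
    have h6 : 1 ≤ K * T ^ (η + κ) := one_le_mul_of_one_le_of_one_le hK1 h4
    have h7 : (c₀ + 2) * (K * T ^ (η + κ)) ≤ K * (K * T ^ (η + κ)) := by gcongr
    nlinarith
  have h6 := abs_le.1 h3
  refine ⟨⌊a / τ⌋, (le_div_iff₀ hτ0).1 h1, ?_, ?_, ?_⟩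
  · have := (div_lt_iff₀ hτ0).1 h2
    linarith
  · push_cast
    rw [abs_le]
    constructor <;> linarith
  · push_cast
    rw [abs_le]
    constructor <;> linarith

section
variable {n : ℕ} {s : Fin n → ℝ} {d : ℕ} {g : SLR n} {c CF : ℝ}

set_option maxHeartbeats 1000000 in
lemma eventually_ncard_latticeRegion_le (hc : 0 ≤ c) (hd : 1 ≤ d) (hCF : 0 ≤ CF)
    (hV : VolumeAsymptotic s d g c CF) {M : ℕ} (hM : 1 ≤ M) {η κ lam : ℝ} (hη : 0 ≤ η) (hκ : 0 < κ)
    (hlam : 0 ≤ lam) (ha : 0 ≤ (n : ℝ) - d - κ)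
    (hMη : 2 ≤ M * (1 - η / d)) (hcount : ∀ E : ℕ, CountAsymptotic s d g M η κ lam 4 E) {c₀ : ℝ}
    (hc₀ : 0 ≤ c₀) :
    ∃ C : ℝ, ∀ᶠ K : ℕ in atTop, ∀ t : ℝ, (K : ℝ) ^ M ≤ t → t ≤ ((K : ℝ) + 1) ^ M →
      ∀ a : ℝ, |a| ≤ c₀ * ((K : ℝ) ^ M) ^ η → ∀ I ⊆ Set.Icc a (a + t ^ (-κ)),
        ((latticeRegion s d g I (t ^ 2)).ncard : ℝ)
          ≤ c * t ^ ((n : ℝ) - d - κ) + C * (t ^ ((n : ℝ) - d - κ) / K + t ^ lam) := by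
  obtain ⟨CA, hCA, r₁, happ⟩ := exists_ratMatrix_approx g
  set E : ℕ := ⌈CA + 3 ^ (M * 2) + CA * 3 ^ (M * 2) + 1⌉₊ with hE
  have hE1 : CA + 3 ^ (M * 2) + CA * 3 ^ (M * 2) + 1 ≤ E := Nat.le_ceil _
  obtain ⟨r₀, hr₀⟩ := hcount E
  obtain ⟨Cc, hCc⟩ := hr₀ (max r₀ r₁) (le_max_left _ _)
  obtain ⟨CV, hCV, hvol⟩ := eventually_abs_volume_thickening_sub_le hc hd hCF hV hM hη hMη
    (by linarith : 1 ≤ c₀ + 5) 4 (2 * (E + CA)) κ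
  set Z : ℝ := ({v : Fin n → ℤ | sqNorm (intVec v ᵥ* (g : Matrix (Fin n) (Fin n) ℝ)) ≤ 2}.ncard : ℝ)
    with hZ
  refine ⟨CV + |Cc| + Z, ?_⟩
  filter_upwards [happ (max r₀ r₁) (le_max_right _ _), hCc, hvol, eventually_ge_atTop 1,
    eventually_ge_atTop ⌈c₀ + 2⌉₊, eventually_ge_atTop ⌈2 * CA⌉₊] with K happ hCc hvol hK hKc hKA
    t ht1 ht2 a haN I hI
  have hK1 : (1 : ℝ) ≤ K := by exact_mod_cast hK
  have hK0 : (0 : ℝ) < K := by linarith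
  have hKc' : c₀ + 2 ≤ K := (Nat.le_ceil _).trans (by exact_mod_cast hKc)
  have hKA' : 2 * CA ≤ K := (Nat.le_ceil _).trans (by exact_mod_cast hKA)
  have hT1 : (1 : ℝ) ≤ (K : ℝ) ^ M := one_le_natCast_pow hK M
  obtain ⟨H, hH1, hH2, hH3⟩ := happ
  obtain ⟨l, hl1, hl2, hl3, -⟩ := exists_grid_point hK hη hκ hKc' haN
  have hc1 := hCc (l - 1, H) (mem_paramSet hl3 hH1) hH2
  have ht3 := sq_le_natCast_pow_mul hK (by linarith) ht2
  dsimp only at hc1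
  set T : ℝ := (K : ℝ) ^ M with hT
  have hT0 : 0 < T := by linarith
  set τ : ℝ := T ^ (-κ) / K with hτ
  have hτ0 : 0 < τ := by positivity
  have hκ1 : T ^ (-κ) ≤ 1 := Real.rpow_le_one_of_one_le_of_nonpos hT1 (by linarith)
  have hKτ : K * τ = T ^ (-κ) := mul_div_cancel₀ _ hK0.ne'
  have hτ1 : τ ≤ 1 := (div_le_one hK0).2 (hκ1.trans hK1)
  have hTη : 1 ≤ T ^ η := Real.one_le_rpow hT1 hη
  have htκ : t ^ (-κ) ≤ T ^ (-κ) := Real.rpow_le_rpow_of_nonpos hT0 ht1 (by linarith)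
  have haN' := abs_le.1 haN
  have hAeq : ((l - 1 : ℤ) : ℝ) * τ = l * τ - τ := by push_cast; ring
  rw [hAeq] at hc1
  have hv1 := hvol (l * τ - τ) (by linarith) (by nlinarith)
  have hup := ncard_latticeRegion_le (s := s) (d := d) (A := l * τ - τ)
    (B := l * τ - τ + (K + 4) * τ) (e := E) (I := I) (R := t ^ 2) hCA hKA' hT0 hτ0 hH3 ?_ ?_
  · have hInt := integral_totalWeight_le (s := s) (d := d) (A := l * τ - τ)
      (B := l * τ - τ + (K + 4) * τ) (e := E) hCA hKA' hT0 hτ0 hH3 (Nat.cast_nonneg E)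
    have h1 := (abs_le.1 hc1).2
    have h2 := (abs_le.1 hv1).2
    have h3 : T ^ ((n : ℝ) - d - κ) ≤ t ^ ((n : ℝ) - d - κ) := Real.rpow_le_rpow hT0.le ht1 ha
    have h4 : T ^ lam ≤ t ^ lam := Real.rpow_le_rpow hT0.le ht1 hlam
    have h5 : 1 ≤ t ^ lam := Real.one_le_rpow (hT1.trans ht1) hlam
    have h6 : Cc * T ^ lam ≤ |Cc| * t ^ lam :=
      mul_le_mul (le_abs_self _) h4 (by positivity) (abs_nonneg _)
    have h7 : CV / K * T ^ ((n : ℝ) - d - κ) ≤ CV * (t ^ ((n : ℝ) - d - κ) / K) := by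
      rw [div_mul_eq_mul_div, mul_div_assoc]
      gcongr
    have h8 : c * T ^ ((n : ℝ) - d - κ) ≤ c * t ^ ((n : ℝ) - d - κ) := by gcongr
    have hZ0 : 0 ≤ Z := Nat.cast_nonneg _
    have h9 : Z ≤ Z * t ^ lam := le_mul_of_one_le_right hZ0 h5
    have ht0 : 0 < t := by linarith
    have h10 : 0 ≤ CV * t ^ lam := by positivity
    have h11 : 0 ≤ (|Cc| + Z) * (t ^ ((n : ℝ) - d - κ) / K) := by positivity
    rw [← hZ] at hup
    have h12 : (CV + |Cc| + Z) * (t ^ ((n : ℝ) - d - κ) / K + t ^ lam)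
        = CV * (t ^ ((n : ℝ) - d - κ) / K) + (|Cc| + Z) * (t ^ ((n : ℝ) - d - κ) / K)
          + CV * t ^ lam + |Cc| * t ^ lam + Z * t ^ lam := by ring
    rw [h12]
    linarith
  · refine hI.trans (Set.Icc_subset_Icc (by linarith) ?_)
    nlinarith
  · have hx1 : 1 / (K : ℝ) ≤ 1 := (div_le_one hK0).2 hK1
    have hx0 : 0 < 1 / (K : ℝ) := by positivity
    have h1 : (1 + CA / K) * (1 + 3 ^ (M * 2) / K) ≤ 1 + ((E : ℝ) - 1) / K := by
      rw [div_eq_mul_one_div CA, div_eq_mul_one_div ((3 : ℝ) ^ (M * 2)),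
        div_eq_mul_one_div ((E : ℝ) - 1)]
      set x := 1 / (K : ℝ)
      have h2 : CA * 3 ^ (M * 2) * (x * x) ≤ CA * 3 ^ (M * 2) * (1 * x) := by gcongr
      have h3 : (CA + 3 ^ (M * 2) + CA * 3 ^ (M * 2) + 1) * x ≤ E * x := by gcongr
      linarith
    calc (1 + CA / K) * t ^ 2 ≤ (1 + CA / K) * (T ^ 2 * (1 + 3 ^ (M * 2) / K)) := by gcongr
      _ = T ^ 2 * ((1 + CA / K) * (1 + 3 ^ (M * 2) / K)) := by ring
      _ ≤ T ^ 2 * (1 + ((E : ℝ) - 1) / K) := by gcongr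

set_option maxHeartbeats 1000000 in
lemma eventually_le_ncard_latticeRegion (hc : 0 ≤ c) (hd : 1 ≤ d) (hCF : 0 ≤ CF)
    (hV : VolumeAsymptotic s d g c CF) {M : ℕ} (hM : 1 ≤ M) {η κ lam w : ℝ} (hη : 0 ≤ η)
    (hκ : 0 < κ) (hlam : 0 ≤ lam) (ha : 0 ≤ (n : ℝ) - d - κ)
    (hMη : 2 ≤ M * (1 - η / d)) (hw : κ * 3 ^ M + 1 ≤ w)
    (hcount : ∀ E : ℕ, CountAsymptotic s d g M η κ lam (-w) (-E)) {c₀ : ℝ} (hc₀ : 0 ≤ c₀) :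
    ∃ C : ℝ, ∀ᶠ K : ℕ in atTop, ∀ t : ℝ, (K : ℝ) ^ M ≤ t → t ≤ ((K : ℝ) + 1) ^ M →
      ∀ a : ℝ, |a| ≤ c₀ * ((K : ℝ) ^ M) ^ η → ∀ I, Set.Ioo a (a + t ^ (-κ)) ⊆ I →
        c * t ^ ((n : ℝ) - d - κ) - C * (t ^ ((n : ℝ) - d - κ) / K + t ^ lam)
          ≤ ((latticeRegion s d g I (t ^ 2)).ncard : ℝ) := by
  obtain ⟨CA, hCA, r₁, happ⟩ := exists_ratMatrix_approx g
  set E : ℕ := ⌈CA⌉₊ with hE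
  have hE1 : CA ≤ E := Nat.le_ceil _
  obtain ⟨r₀, hr₀⟩ := hcount E
  obtain ⟨Cc, hCc⟩ := hr₀ (max r₀ r₁) (le_max_left _ _)
  obtain ⟨CV, hCV, hvol⟩ := eventually_abs_volume_thickening_sub_le hc hd hCF hV hM hη hMη
    (by linarith : 1 ≤ c₀ + 5) (-w - 2) (-(E + 1 + CA)) κ
  set Z : ℝ := (volume {v : Fin n → ℝ | sqNorm (v ᵥ* (g : Matrix (Fin n) (Fin n) ℝ)) ≤ 2}).toReal
    with hZ
  refine ⟨CV + |Cc| + Z + c * (((n : ℝ) - d - κ) * 3 ^ M), ?_⟩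
  filter_upwards [happ (max r₀ r₁) (le_max_right _ _), hCc, hvol, eventually_ge_atTop 1,
    eventually_ge_atTop ⌈c₀ + 2⌉₊, eventually_ge_atTop ⌈2 * CA⌉₊] with K happ hCc hvol hK hKc hKA
    t ht1 ht2 a haN I hI
  have hK1 : (1 : ℝ) ≤ K := by exact_mod_cast hK
  have hK0 : (0 : ℝ) < K := by linarith
  have hKc' : c₀ + 2 ≤ K := (Nat.le_ceil _).trans (by exact_mod_cast hKc)
  have hKA' : 2 * CA ≤ K := (Nat.le_ceil _).trans (by exact_mod_cast hKA)
  have hT1 : (1 : ℝ) ≤ (K : ℝ) ^ M := one_le_natCast_pow hK M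
  obtain ⟨H, hH1, hH2, hH3⟩ := happ
  obtain ⟨l, hl1, hl2, -, hl3⟩ := exists_grid_point hK hη hκ hKc' haN
  have hc1 := hCc (l + 1, H) (mem_paramSet hl3 hH1) hH2
  have ht3 := le_natCast_pow_mul hK ht2
  dsimp only at hc1
  set T : ℝ := (K : ℝ) ^ M with hT
  have hT0 : 0 < T := by linarith
  have ht0 : 0 < t := by linarith
  set τ : ℝ := T ^ (-κ) / K with hτ
  have hτ0 : 0 < τ := by positivity
  have hκ1 : T ^ (-κ) ≤ 1 := Real.rpow_le_one_of_one_le_of_nonpos hT1 (by linarith)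
  have hKτ : K * τ = T ^ (-κ) := mul_div_cancel₀ _ hK0.ne'
  have hτ1 : τ ≤ 1 := (div_le_one hK0).2 (hκ1.trans hK1)
  have hTη : 1 ≤ T ^ η := Real.one_le_rpow hT1 hη
  have hw0 : 0 ≤ w := le_trans (by positivity) hw
  have htκ : (K - κ * 3 ^ M) * τ ≤ t ^ (-κ) := by
    refine le_trans (le_of_eq ?_) (mul_one_sub_le_rpow_neg hT0 ht1 ht3 hκ.le)
    rw [← hKτ]
    field_simp
  have haN' := abs_le.1 haN
  have hAeq : ((l + 1 : ℤ) : ℝ) * τ = l * τ + τ := by push_cast; ring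
  rw [hAeq] at hc1
  have hwτ : 0 ≤ w * τ := by positivity
  have hv1 := hvol (l * τ + τ + τ) (by linarith) (by nlinarith)
  have hlow := tsum_totalWeight_le (s := s) (d := d) (A := l * τ + τ)
    (B := l * τ + τ + (K + -w) * τ) (e := -E) (I := I) (R := t ^ 2) hCA hKA' hT0 hτ0 hH3 ?_
    (by linarith) (by gcongr)
  · have hInt := le_integral_totalWeight (s := s) (d := d) (A := l * τ + τ)
      (B := l * τ + τ + (K + -w) * τ) (e := -E) (R := T ^ 2 * (1 + -(E + 1 + CA) / K))
      hCA hKA' hT0 hτ0 hH3 ?_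
    · have hBeq : l * τ + τ + (K + -w) * τ - τ = l * τ + τ + τ + (K + (-w - 2)) * τ := by ring
      rw [hBeq] at hInt
      have h1 := (abs_le.1 hc1).1
      have h2 := (abs_le.1 hv1).1
      have h3 : T ^ ((n : ℝ) - d - κ) ≤ t ^ ((n : ℝ) - d - κ) := Real.rpow_le_rpow hT0.le ht1 ha
      have h4 : T ^ lam ≤ t ^ lam := Real.rpow_le_rpow hT0.le ht1 hlam
      have h5 : 1 ≤ t ^ lam := Real.one_le_rpow (hT1.trans ht1) hlam
      have h6 : Cc * T ^ lam ≤ |Cc| * t ^ lam :=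
        mul_le_mul (le_abs_self _) h4 (by positivity) (abs_nonneg _)
      have h7 : CV / K * T ^ ((n : ℝ) - d - κ) ≤ CV * (t ^ ((n : ℝ) - d - κ) / K) := by
        rw [div_mul_eq_mul_div, mul_div_assoc]
        gcongr
      have h8 := mul_le_mul_of_nonneg_left (rpow_mul_one_sub_le hT0 ht1 ht3 ha) hc
      have h8' : c * (t ^ ((n : ℝ) - d - κ) * (1 - ((n : ℝ) - d - κ) * (3 ^ M / K)))
          = c * t ^ ((n : ℝ) - d - κ)
            - c * (((n : ℝ) - d - κ) * 3 ^ M) * (t ^ ((n : ℝ) - d - κ) / K) := by ring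
      rw [h8'] at h8
      have hZ0 : 0 ≤ Z := ENNReal.toReal_nonneg
      have h9 : Z ≤ Z * t ^ lam := le_mul_of_one_le_right hZ0 h5
      have h10 : 0 ≤ CV * t ^ lam := by positivity
      have h11 : 0 ≤ (|Cc| + Z) * (t ^ ((n : ℝ) - d - κ) / K) := by positivity
      have h13 : 0 ≤ c * (((n : ℝ) - d - κ) * 3 ^ M) * t ^ lam := by positivity
      rw [← hZ] at hInt
      have h12 : (CV + |Cc| + Z + c * (((n : ℝ) - d - κ) * 3 ^ M))
          * (t ^ ((n : ℝ) - d - κ) / K + t ^ lam)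
          = CV * (t ^ ((n : ℝ) - d - κ) / K) + (|Cc| + Z) * (t ^ ((n : ℝ) - d - κ) / K)
            + CV * t ^ lam + |Cc| * t ^ lam + Z * t ^ lam
            + c * (((n : ℝ) - d - κ) * 3 ^ M) * (t ^ ((n : ℝ) - d - κ) / K)
            + c * (((n : ℝ) - d - κ) * 3 ^ M) * t ^ lam := by ring
      rw [h12]
      linarith
    · have h1 : (1 + CA / K) * (1 + -(E + 1 + CA) / K) ≤ 1 + (-(E : ℝ) - 1) / K := by
        rw [div_eq_mul_one_div CA, div_eq_mul_one_div (-((E : ℝ) + 1 + CA)),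
          div_eq_mul_one_div (-(E : ℝ) - 1)]
        have h2 : 0 ≤ CA * (E + 1 + CA) * (1 / (K : ℝ)) ^ 2 := by positivity
        linarith
      calc (1 + CA / K) * (T ^ 2 * (1 + -(E + 1 + CA) / K))
          = T ^ 2 * ((1 + CA / K) * (1 + -(E + 1 + CA) / K)) := by ring
        _ ≤ T ^ 2 * (1 + (-(E : ℝ) - 1) / K) := by gcongr
  · refine (Set.Ioo_subset_Ioo hl2.le ?_).trans hI
    nlinarith

end

lemma ae_countAsymptotic {n : ℕ} {s : Fin n → ℝ} (hs : ∀ i, |s i| = 1) {d : ℕ}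
    (hd : 2 ≤ d) (hdn : d < n) {M : ℕ} (hM : 1 ≤ M) {η κ lam : ℝ} (hη : 0 ≤ η) (hκ : 0 < κ)
    (h1 : 1 ≤ M * lam) (h2 : 3 ≤ M * (lam - (n - d - κ - 1)))
    (h3 : (n * n + 5 : ℝ) ≤ M * (2 * lam - η - (n - d))) (w : ℝ)
    (μ : Measure (SLR n)) [μ.IsHaarMeasure] :
    ∀ᵐ g : SLR n ∂μ, (∀ E : ℕ, CountAsymptotic s d g M η κ lam 4 E) ∧
      ∀ E : ℕ, CountAsymptotic s d g M η κ lam (-w) (-E) := by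
  obtain _ | m := n
  · omega
  have h2' : 3 ≤ M * (lam - (m - d - κ)) := by
    push_cast at h2
    linarith
  have h3' : ((m + 1) * (m + 1) + 5 : ℝ) ≤ M * (2 * lam - η - (m + 1 - d)) := by
    push_cast at h3
    exact h3
  refine Eventually.and (ae_all_iff.2 fun E => ?_) (ae_all_iff.2 fun E => ?_)
  · exact ae_exists_totalWeight_error_le hs hd (by omega) hM hη hκ h1 h2' h3' 4 E μ
  · exact ae_exists_totalWeight_error_le hs hd (by omega) hM hη hκ h1 h2' h3' (-w) (-E) μ

lemma exists_exponents {a b η d k : ℝ} (hb : 0 < b) (hab : b < a) (hd : 0 < d) (hη : η < d) :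
    ∃ (M : ℕ) (lam : ℝ), 1 ≤ M ∧ 0 < lam ∧ lam < a ∧ 1 ≤ M * lam ∧ 3 ≤ M * (lam - (a - 1)) ∧
      k ≤ M * (2 * (lam - b)) ∧ 2 ≤ M * (1 - η / d) := by
  have key : ∀ c x : ℝ, 0 < x → ∀ᶠ M : ℕ in atTop, c ≤ M * x := fun c x hx =>
    (tendsto_natCast_atTop_atTop.atTop_mul_const hx).eventually_ge_atTop c
  have h0 : max b (a - 1) < a := max_lt hab (by linarith)
  have h1 := le_max_left b (a - 1)
  have h2 := le_max_right b (a - 1)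
  set lam := (max b (a - 1) + a) / 2 with hlam
  have h3 : η / d < 1 := (div_lt_one hd).2 hη
  obtain ⟨M, hM⟩ := ((eventually_ge_atTop 1).and ((key 1 lam (by linarith)).and
    ((key 3 (lam - (a - 1)) (by linarith)).and ((key k (2 * (lam - b)) (by linarith)).and
      (key 2 (1 - η / d) (by linarith)))))).exists
  exact ⟨M, lam, hM.1, by linarith, by linarith, hM.2⟩

lemma exists_endpoint_of_ordConnected {I : Set ℝ} (hI : I.OrdConnected) {N ℓ : ℝ} (hℓ : 0 < ℓ)
    (hIN : I ⊆ Set.Icc (-N) N) (hvol : (volume I).toReal = ℓ) :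
    ∃ a, |a| ≤ N ∧ Set.Ioo a (a + ℓ) ⊆ I ∧ I ⊆ Set.Icc a (a + ℓ) := by
  have hne : I.Nonempty := by
    rw [Set.nonempty_iff_ne_empty]
    rintro rfl
    simp only [measure_empty, ENNReal.toReal_zero] at hvol
    linarith
  have hbb : BddBelow I := bddBelow_Icc.mono hIN
  have hba : BddAbove I := bddAbove_Icc.mono hIN
  have h1 : Set.Ioo (sInf I) (sSup I) ⊆ I :=
    IsConnected.Ioo_csInf_csSup_subset ⟨hne, hI.isPreconnected⟩ hbb hba
  have h2 : I ⊆ Set.Icc (sInf I) (sSup I) := subset_Icc_csInf_csSup hbb hba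
  have hle : sInf I ≤ sSup I := csInf_le_csSup hne hbb hba
  have hv : volume I = ENNReal.ofReal (sSup I - sInf I) :=
    le_antisymm ((measure_mono h2).trans_eq Real.volume_Icc)
      (Real.volume_Ioo.symm.trans_le (measure_mono h1))
  rw [hv, ENNReal.toReal_ofReal (by linarith)] at hvol
  have h3 : sInf I + ℓ = sSup I := by linarith
  refine ⟨sInf I, abs_le.2 ⟨le_csInf hne fun x hx => (hIN hx).1, ?_⟩, by rwa [h3], by rwa [h3]⟩
  obtain ⟨x, hx⟩ := hne
  exact (csInf_le hbb hx).trans (hIN hx).2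

lemma eventually_const_mul_rpow_lt (C : ℝ) {u w : ℝ} (h : u < w) :
    ∀ᶠ t : ℝ in atTop, C * t ^ u < t ^ w := by
  filter_upwards [(tendsto_rpow_atTop (sub_pos.2 h)).eventually_gt_atTop C,
    eventually_gt_atTop 0] with t ht ht0
  have h1 : t ^ w = t ^ (w - u) * t ^ u := by rw [← Real.rpow_add ht0, sub_add_cancel]
  rw [h1]
  gcongr

/-- Uniform counting for the forms `∑ i, s i * x i ^ d` with signs `s i`. -/
theorem exists_ae_abs_ncard_latticeRegion_sub_lt {n : ℕ} {s : Fin n → ℝ} (hs : ∀ i, |s i| = 1)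
    {d : ℕ} (hd : 2 ≤ d) (hdn : d < n) {η κ : ℝ} (hη : 0 ≤ η) (hηd : η < d)
    (hκ : 0 < κ) (hκn : κ < (n - d - η) / 2) {N : ℝ → ℝ} (hN : N =O[atTop] fun t : ℝ => t ^ η)
    (μ : Measure (SLR n)) [μ.IsHaarMeasure] :
    ∃ δ : ℝ, 0 < δ ∧ δ < 1 ∧ ∀ᵐ g : SLR n ∂μ, ∀ c CF : ℝ, 0 ≤ c → 0 ≤ CF →
      VolumeAsymptotic s d g c CF → ∃ tF > (0 : ℝ), ∀ t > tF, ∀ I : Set ℝ, I.OrdConnected →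
        I ⊆ Set.Icc (-(N t)) (N t) → (volume I).toReal = t ^ (-κ) →
        |((latticeRegion s d g I (t ^ 2)).ncard : ℝ) - c * t ^ ((n : ℝ) - d - κ)|
          < t ^ (δ * ((n : ℝ) - d - κ)) := by
  set a : ℝ := n - d - κ with ha
  have hd0 : (0 : ℝ) < d := by positivity
  have ha0 : 0 < a := by linarith
  obtain ⟨M, lam, hM, hlam0, hlama, h1, h2, h3, h4⟩ := exists_exponents
    (a := a) (b := (n - d + η) / 2) (η := η) (d := d) (k := n * n + 5) (by linarith) (by linarith)
    hd0 hηd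
  have hM0 : (0 : ℝ) < M := by positivity
  set u : ℝ := max (a - 1 / M) lam with hu
  have hua : u < a := max_lt (by linarith [one_div_pos.2 hM0]) hlama
  have hu0 : 0 < u := hlam0.trans_le (le_max_right _ _)
  refine ⟨(u + a) / 2 / a, by positivity, by rw [div_lt_one ha0]; linarith, ?_⟩
  rw [div_mul_cancel₀ _ ha0.ne']
  filter_upwards [ae_countAsymptotic hs hd hdn hM hη hκ h1 h2 (by linarith) (κ * 3 ^ M + 1) μ]
    with g hg c CF hc hCF hV
  obtain ⟨cN, hcN, hN'⟩ := hN.exists_nonneg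
  have hc₀ : 0 ≤ cN * ((2 : ℝ) ^ M) ^ η := by positivity
  obtain ⟨C₁, hC₁⟩ := eventually_ncard_latticeRegion_le hc (by omega) hCF hV hM hη hκ hlam0.le
    ha0.le h4 hg.1 hc₀
  obtain ⟨C₂, hC₂⟩ := eventually_le_ncard_latticeRegion hc (by omega) hCF hV hM hη hκ hlam0.le
    ha0.le h4 le_rfl hg.2 hc₀
  have hK : Tendsto (fun t : ℝ => ⌊t ^ (1 / M : ℝ)⌋₊) atTop atTop :=
    tendsto_nat_floor_atTop.comp (tendsto_rpow_atTop (by positivity))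
  have hev : ∀ᶠ t : ℝ in atTop, ∀ I : Set ℝ, I.OrdConnected →
      I ⊆ Set.Icc (-(N t)) (N t) → (volume I).toReal = t ^ (-κ) →
        |((latticeRegion s d g I (t ^ 2)).ncard : ℝ) - c * t ^ a| < t ^ ((u + a) / 2) := by
    filter_upwards [hK.eventually hC₁, hK.eventually hC₂, hK.eventually (eventually_ge_atTop 1),
      hN'.bound, eventually_ge_atTop 1,
      eventually_const_mul_rpow_lt (3 * (|C₁| + |C₂|)) (by linarith : u < (u + a) / 2)]
      with t hC₁ hC₂ hK1 hNt ht1 htu I hI hIN hvol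
    have ht0 : 0 < t := by linarith
    set K : ℕ := ⌊t ^ (1 / M : ℝ)⌋₊ with hKdef
    have hK1' : (1 : ℝ) ≤ K := by exact_mod_cast hK1
    have hroot : (t ^ (1 / M : ℝ)) ^ M = t := by
      rw [← Real.rpow_natCast, ← Real.rpow_mul ht0.le, one_div_mul_cancel hM0.ne', Real.rpow_one]
    have hroot0 : 0 ≤ t ^ (1 / M : ℝ) := by positivity
    have hKle : (K : ℝ) ≤ t ^ (1 / M : ℝ) := Nat.floor_le hroot0
    have hKlt : t ^ (1 / M : ℝ) < K + 1 := Nat.lt_floor_add_one _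
    have hT1 : (K : ℝ) ^ M ≤ t := by
      conv_rhs => rw [← hroot]
      gcongr
    have hT2 : t ≤ ((K : ℝ) + 1) ^ M := by
      conv_lhs => rw [← hroot]
      gcongr
    obtain ⟨x, hx, hxI, hIx⟩ := exists_endpoint_of_ordConnected hI (by positivity) hIN hvol
    have hx' : |x| ≤ cN * ((2 : ℝ) ^ M) ^ η * ((K : ℝ) ^ M) ^ η := by
      rw [Real.norm_eq_abs, Real.norm_of_nonneg (by positivity : 0 ≤ t ^ η)] at hNt
      refine (hx.trans (le_abs_self _)).trans (hNt.trans ?_)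
      rw [mul_assoc, ← Real.mul_rpow (by positivity) (by positivity), ← mul_pow]
      have : t ≤ (2 * (K : ℝ)) ^ M := hT2.trans (by gcongr; linarith)
      gcongr
    have hup := hC₁ t hT1 hT2 x hx' I hIx
    have hlow := hC₂ t hT1 hT2 x hx' I hxI
    have hX : t ^ a / K + t ^ lam ≤ 3 * t ^ u := by
      have h5 : t ^ lam ≤ t ^ u := Real.rpow_le_rpow_of_exponent_le ht1 (le_max_right _ _)
      have h6 : t ^ (a - 1 / M) ≤ t ^ u := Real.rpow_le_rpow_of_exponent_le ht1 (le_max_left _ _)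
      have h7 : t ^ a / K ≤ 2 * t ^ (a - 1 / M) := by
        have h0 : t ^ (a - 1 / M) = t ^ a / t ^ (1 / M : ℝ) := Real.rpow_sub ht0 a _
        rw [h0, div_le_iff₀ (by linarith), mul_div_assoc', div_mul_eq_mul_div,
          le_div_iff₀ (by positivity)]
        have h8 : t ^ (1 / M : ℝ) ≤ 2 * K := by linarith
        have h9 : 0 ≤ t ^ a := by positivity
        nlinarith
      linarith
    have hX0 : 0 ≤ t ^ a / K + t ^ lam := by positivity
    have h5 : C₁ * (t ^ a / K + t ^ lam) ≤ |C₁| * (3 * t ^ u) :=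
      mul_le_mul (le_abs_self _) hX hX0 (abs_nonneg _)
    have h6 : C₂ * (t ^ a / K + t ^ lam) ≤ |C₂| * (3 * t ^ u) :=
      mul_le_mul (le_abs_self _) hX hX0 (abs_nonneg _)
    have h7 : 0 ≤ |C₁| * (3 * t ^ u) := by positivity
    have h8 : 0 ≤ |C₂| * (3 * t ^ u) := by positivity
    rw [abs_lt]
    constructor <;> linarith
  obtain ⟨t₀, ht₀⟩ := eventually_atTop.1 hev
  exact ⟨max t₀ 1, by positivity, fun t ht => ht₀ t ((le_max_left _ _).trans ht.le)⟩

lemma eucNorm_le_iff {n : ℕ} {v : Fin n → ℝ} {t : ℝ} (ht : 0 ≤ t) :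
    eucNorm v ≤ t ↔ sqNorm v ≤ t ^ 2 := by
  rw [eucNorm, Real.sqrt_le_iff]
  exact and_iff_right ht

lemma NF_eq_ncard {p q d : ℕ} (g : SLR (p + q)) (I : Set ℝ) {t : ℝ} (ht : 0 ≤ t) :
    NF p q d g I t = (latticeRegion
      (fun i : Fin (p + q) => if (i : ℕ) < p then (1 : ℝ) else -1) d g I (t ^ 2)).ncard := by
  rw [← Nat.card_coe_set_eq, NF]
  congr 2
  ext v
  exact and_congr_right fun _ => eucNorm_le_iff ht

/-- Theorem 5.1 of the paper: uniform counting for all intervals of fixed length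
`t^{−κ}` in `[−N(t), N(t)]`, where `c_F` is the constant from the volume estimate
`vol(F⁻¹(I) ∩ B_T) = c_F|I|T^{n−d} + O_F(|I|N^{1/d}T^{n−d−1}log T)`. -/
theorem uniform_counting_fixed_length
    (p q d : ℕ) (hp : 1 ≤ p) (hq : 1 ≤ q) (hd2 : 2 ≤ d) (hdeven : Even d)
    (hnd : d < p + q)
    (η : ℝ) (hη0 : 0 ≤ η) (hη : η < min (d : ℝ) ((p + q : ℝ) - d))
    (κ : ℝ) (hκ0 : 0 < κ) (hκ : κ < ((p + q : ℝ) - d - η) / 2)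
    (N : ℝ → ℝ) (hNmono : Monotone N)
    (hNO : N =O[atTop] fun t : ℝ => t ^ η)
    (μ : Measure (SLR (p + q))) [μ.IsHaarMeasure] :
    ∃ δ : ℝ, 0 < δ ∧ δ < 1 ∧ ∀ᵐ g ∂μ, ∀ cF : ℝ, 0 < cF →
      -- `cF` is a constant realizing the volume estimate for `F = g·F₀`:
      (∀ Nb : ℝ, 1 ≤ Nb → ∃ CF > (0 : ℝ),
        ∀ I : Set ℝ, MeasurableSet I → I ⊆ Set.Icc (-Nb) Nb →
          ∀ T : ℝ, 2 * Nb ^ (1 / (d : ℝ)) < T →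
          |(volume {v : Fin (p + q) → ℝ | Fg p q d g v ∈ I ∧ eucNorm v ≤ T}).toReal
              - cF * (volume I).toReal * T ^ ((p + q : ℝ) - d)|
            ≤ CF * (volume I).toReal * Nb ^ (1 / (d : ℝ)) * T ^ ((p + q : ℝ) - d - 1)
                * Real.log T) →
      ∃ tF > (0 : ℝ), ∀ t > tF, ∀ I : Set ℝ, I.OrdConnected →
        I ⊆ Set.Icc (-(N t)) (N t) → (volume I).toReal = t ^ (-κ) →
        |(NF p q d g I t : ℝ) - cF * t ^ ((p + q : ℝ) - d - κ)|
          < t ^ (δ * ((p + q : ℝ) - d - κ)) := by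
  have hn : ((p + q : ℕ) : ℝ) = (p : ℝ) + q := Nat.cast_add p q
  have hηd := (lt_min_iff.1 hη).1
  rw [← hn] at hκ
  obtain ⟨δ, hδ0, hδ1, h⟩ := exists_ae_abs_ncard_latticeRegion_sub_lt
    (s := fun i : Fin (p + q) => if (i : ℕ) < p then (1 : ℝ) else -1)
    (fun i => by split_ifs <;> simp) hd2 hnd hη0 hηd hκ0 hκ hNO μ
  refine ⟨δ, hδ0, hδ1, ?_⟩
  filter_upwards [h] with g hg cF hcF hvol
  obtain ⟨CF, hCF, hCF'⟩ := hvol 1 le_rfl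
  simp only [Real.one_rpow, mul_one] at hCF'
  rw [← hn] at hCF' ⊢
  have hasymp : VolumeAsymptotic
      (fun i : Fin (p + q) => if (i : ℕ) < p then (1 : ℝ) else -1) d g cF CF := by
    intro I hI hI1 T hT
    have hset : {v : Fin (p + q) → ℝ | Fg p q d g v ∈ I ∧ eucNorm v ≤ T} = formRegion
        (fun i : Fin (p + q) => if (i : ℕ) < p then (1 : ℝ) else -1) d g I (T ^ 2) := by
      ext v
      exact and_congr_right fun _ => eucNorm_le_iff (by linarith)
    rw [← hset]
    exact hCF' I hI hI1 T hT
  obtain ⟨tF, htF, ht⟩ := hg cF CF hcF.le hCF.le hasymp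
  refine ⟨tF, htF, fun t htt I hI hIN hIv => ?_⟩
  rw [NF_eq_ncard g I (htF.trans htt).le]
  exact ht t htt I hI hIN hIv

end
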